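/- Let γ₃ > 0. Then there exist ε₁ ∈ (0,1), an integer k ≥ 1, and a constant c > 0 depending only on γ₃ such that the following holds. Let η ∈ ℝ with |η| ≥ 1 and let μ₁, …, μ_k be Borel probability measures on (0,∞) such that for every j ∈ {1,…,k}, every a ∈ ℝ and every σ ∈ [|η|^{−2}, |η|^{−ε₁}], one has μ_j({x > 0 : |log x − a| ≤ σ}) ≤ 2 σ^{γ₃}. Then for every t ∈ (0, ε₁): |∫_{(0,∞)^k} e^{i η x₁ x₂ ⋯ x_k} dμ₁(x₁) ⋯ dμ_k(x_k)| ≤ c |η|^{−ε₁} + |η|^{−t³/(2√k)} ∏_{j=1}^k M_j(t²), where M_j(s) := ∫_{(0,∞)} e^{s |log x|} dμ_j(x). -/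

import Mathlib

open MeasureTheory
open scoped ENNReal

section ActSet
open Finset
open scoped Pointwise

/-- If `#(A + C) ≤ K * #A`, then `#(X + C) ≤ K * #(X + A)` for every finite set `X`. -/
lemma card_add_le_of_card_add_le {A C : Finset ℤ} (hA : A.Nonempty) {K : ℝ}
    (h : (#(A + C) : ℝ) ≤ K * #A) (X : Finset ℤ) : (#(X + C) : ℝ) ≤ K * #(X + A) := by
  have hA' : A ∈ A.powerset.erase ∅ := mem_erase_of_ne_of_mem hA.ne_empty (mem_powerset_self _)
  obtain ⟨U, hU, hUA⟩ :=
    exists_min_image (A.powerset.erase ∅) (fun U ↦ #(U + C) / #U : _ → ℚ≥0) ⟨A, hA'⟩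
  rw [mem_erase, mem_powerset, ← nonempty_iff_ne_empty] at hU
  have hUpos : 0 < #U := hU.1.card_pos
  have hUposR : (0 : ℝ) < #U := by exact_mod_cast hUpos
  have hApos : (0 : ℝ) < #A := by exact_mod_cast hA.card_pos
  have key : ∀ A' ⊆ A, A'.Nonempty → #(U + C) * #A' ≤ #(A' + C) * #U := by
    intro A' hA'' hne
    have := hUA A' (mem_erase_of_ne_of_mem hne.ne_empty (mem_powerset.2 hA''))
    rw [div_le_div_iff₀ (by exact_mod_cast hUpos) (by exact_mod_cast hne.card_pos)] at this
    exact_mod_cast this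
  have hpet := pluennecke_petridis_inequality_add (A := U) (B := C) X (by
    intro A' hA''
    rcases A'.eq_empty_or_nonempty with rfl | hne
    · simp
    · exact key A' (hA''.trans hU.2) hne)
  have h1 : (#(X + U + C) : ℝ) * #U ≤ #(U + C) * #(X + U) := by exact_mod_cast hpet
  have h2 : (#(U + C) : ℝ) * #A ≤ #(A + C) * #U := by exact_mod_cast key A subset_rfl hA
  have h3 : (#(U + C) : ℝ) ≤ K * #U := by
    have : (#(U + C) : ℝ) * #A ≤ (K * #U) * #A := by nlinarith
    exact le_of_mul_le_mul_right this hApos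
  have h4 : (#(X + C) : ℝ) ≤ #(X + U + C) := by
    have : #(X + C) ≤ #(X + C + U) := card_le_card_add_right hU.1
    rw [add_right_comm] at this
    exact_mod_cast this
  have h5 : (#(X + U) : ℝ) ≤ #(X + A) := by
    exact_mod_cast card_le_card (add_subset_add_left hU.2)
  have hK : 0 ≤ K := by
    by_contra hK
    have : K * #A < 0 := mul_neg_of_neg_of_pos (not_le.1 hK) hApos
    linarith [Nat.cast_nonneg (α := ℝ) #(A + C)]
  have h6 : (#(X + U + C) : ℝ) * #U ≤ (K * #(X + U)) * #U := by
    refine h1.trans ?_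
    nlinarith [Nat.cast_nonneg (α := ℝ) #(X + U)]
  have h7 := le_of_mul_le_mul_right h6 hUposR
  exact h4.trans (h7.trans (by gcongr))

/-- Two sets with small sumset with `A`, where `A` has small doubling, can be added to `A`
simultaneously. -/
lemma card_add_add_le {A C D : Finset ℤ} (hA : A.Nonempty) {K K₁ K₂ : ℝ}
    (hK : (#(A + A) : ℝ) ≤ K * #A)
    (h1 : (#(A + C) : ℝ) ≤ K₁ * #A) (h2 : (#(A + D) : ℝ) ≤ K₂ * #A)
    (hK₁ : 0 ≤ K₁) (hK₂ : 0 ≤ K₂) :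
    (#(A + C + D) : ℝ) ≤ K₁ * K₂ * K ^ 3 * #A := by
  have hApos : (0 : ℝ) < #A := by exact_mod_cast hA.card_pos
  have e1 := card_add_le_of_card_add_le hA h1 (A + D)
  have e2 := card_add_le_of_card_add_le hA h2 (A + A)
  have e3 : (#(A + A + A) : ℝ) ≤ K ^ 3 * #A := by
    have := pluennecke_ruzsa_inequality_nsmul_add hA A 3
    rw [show (3 : ℕ) • A = A + A + A by rw [succ_nsmul, succ_nsmul, one_nsmul]] at this
    have h' : (#(A + A + A) : ℝ) ≤ ((#(A + A) : ℝ) / #A) ^ 3 * #A := by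
      have h'' := (NNRat.cast_le (K := ℝ)).2 this
      push_cast at h''
      exact h''
    refine h'.trans ?_
    have : (#(A + A) : ℝ) / #A ≤ K := by rwa [div_le_iff₀ hApos]
    gcongr
  rw [add_right_comm A D C] at e1
  rw [show A + D + A = A + A + D by abel] at e1
  calc (#(A + C + D) : ℝ) ≤ K₁ * #(A + A + D) := e1
    _ ≤ K₁ * (K₂ * (K ^ 3 * #A)) := by
        refine mul_le_mul_of_nonneg_left (e2.trans ?_) hK₁
        exact mul_le_mul_of_nonneg_left e3 hK₂
    _ = _ := by ring

/-- The rounded dilate `⌊ξ B⌋` of a finite set of integers. -/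
noncomputable def dil (ξ : ℝ) (B : Finset ℤ) : Finset ℤ := B.image fun b : ℤ => ⌊ξ * b⌋

/-- The set of real numbers acting on `B` with expansion at most `K`. -/
def actSet (B : Finset ℤ) (K : ℝ) : Set ℝ :=
  {ξ | |ξ| ≤ K ∧ (#(B + dil ξ B) : ℝ) ≤ K * #B}

lemma mem_dil {ξ : ℝ} {B : Finset ℤ} {y : ℤ} : y ∈ dil ξ B ↔ ∃ b ∈ B, ⌊ξ * b⌋ = y := by
  simp [dil]

lemma actSet_mono {B : Finset ℤ} {K K' : ℝ} (h : K ≤ K') : actSet B K ⊆ actSet B K' :=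
  fun _ hξ => ⟨hξ.1.trans h, hξ.2.trans (by gcongr)⟩

lemma zero_mem_actSet {B : Finset ℤ} {K : ℝ} (hK : 1 ≤ K) : (0 : ℝ) ∈ actSet B K := by
  refine ⟨by simp; linarith, ?_⟩
  have : dil 0 B ⊆ {0} := by
    intro y hy
    obtain ⟨b, -, rfl⟩ := mem_dil.1 hy
    simp
  have h2 : #(B + dil 0 B) ≤ #B := by
    refine (card_le_card (add_subset_add_left this)).trans ?_
    simp
  have h3 : (#(B + dil 0 B) : ℝ) ≤ #B := by exact_mod_cast h2
  nlinarith [Nat.cast_nonneg (α := ℝ) #B]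

lemma one_mem_actSet {B : Finset ℤ} {K : ℝ} (hK : 1 ≤ K) (hB : (#(B + B) : ℝ) ≤ K * #B) :
    (1 : ℝ) ∈ actSet B K := by
  refine ⟨by simpa using hK, ?_⟩
  have : dil 1 B = B := by ext y; simp [mem_dil]
  rwa [this]

lemma card_add_three_le {X E : Finset ℤ} {a b : ℝ} (hX : (#X : ℝ) ≤ a) (hE : (#E : ℝ) ≤ b)
    (ha : 0 ≤ a) : (#(X + E) : ℝ) ≤ a * b := by
  have : (#(X + E) : ℝ) ≤ #X * #E := by exact_mod_cast card_add_le
  refine this.trans ?_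
  gcongr

lemma actSet_add {B : Finset ℤ} (hB : B.Nonempty) {K a b : ℝ} (hK : 2 ≤ K)
    (hBB : (#(B + B) : ℝ) ≤ K * #B) (ha : a ∈ actSet B K) (hb : b ∈ actSet B K) :
    a + b ∈ actSet B (K ^ 6) := by
  have hK2 : 2 * K ≤ K ^ 6 := by
    have : (2:ℝ) ≤ K ^ 5 := by
      calc (2 : ℝ) ≤ K := hK
        _ = K ^ 1 := by ring
        _ ≤ K ^ 5 := by gcongr <;> linarith
    calc 2 * K ≤ K ^ 5 * K := by gcongr
      _ = K ^ 6 := by ring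
  refine ⟨?_, ?_⟩
  · have := abs_add_le a b
    linarith [ha.1, hb.1]
  have hsub : B + dil (a + b) B ⊆ (B + dil a B + dil b B) + {0, 1} := by
    intro y hy
    obtain ⟨x, hx, z, hz, rfl⟩ := mem_add.1 hy
    obtain ⟨w, hw, rfl⟩ := mem_dil.1 hz
    have e : ⌊(a + b) * w⌋ - ⌊a * w⌋ - ⌊b * w⌋ = 0 ∨ ⌊(a + b) * w⌋ - ⌊a * w⌋ - ⌊b * w⌋ = 1 := by
      have h1 := Int.floor_le ((a + b) * w)
      have h2 := Int.lt_floor_add_one ((a + b) * w)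
      have h3 := Int.floor_le (a * w)
      have h4 := Int.lt_floor_add_one (a * w)
      have h5 := Int.floor_le (b * w)
      have h6 := Int.lt_floor_add_one (b * w)
      have h7 : ((⌊(a + b) * w⌋ - ⌊a * w⌋ - ⌊b * w⌋ : ℤ) : ℝ) < 2 := by push_cast; linarith
      have h8 : (-1 : ℝ) < ((⌊(a + b) * w⌋ - ⌊a * w⌋ - ⌊b * w⌋ : ℤ) : ℝ) := by push_cast; linarith
      have h7' : ⌊(a + b) * w⌋ - ⌊a * w⌋ - ⌊b * w⌋ < 2 := by exact_mod_cast h7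
      have h8' : -1 < ⌊(a + b) * w⌋ - ⌊a * w⌋ - ⌊b * w⌋ := by exact_mod_cast h8
      omega
    refine mem_add.2 ⟨x + ⌊a * w⌋ + ⌊b * w⌋, add_mem_add (add_mem_add hx
      (mem_dil.2 ⟨w, hw, rfl⟩)) (mem_dil.2 ⟨w, hw, rfl⟩),
      ⌊(a + b) * w⌋ - ⌊a * w⌋ - ⌊b * w⌋, ?_, by ring⟩
    simpa using e
  have h1 := card_add_add_le hB hBB ha.2 hb.2 (by linarith) (by linarith)
  have h2 : (#({0, 1} : Finset ℤ) : ℝ) ≤ K := by simpa using hK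
  have h3 := card_add_three_le h1 h2 (by positivity)
  have h4 : (#(B + dil (a + b) B) : ℝ) ≤ #((B + dil a B + dil b B) + {0, 1}) := by
    exact_mod_cast card_le_card hsub
  refine h4.trans (h3.trans (le_of_eq (by ring)))

lemma actSet_neg {B : Finset ℤ} (hB : B.Nonempty) {K a : ℝ} (hK : 2 ≤ K)
    (hBB : (#(B + B) : ℝ) ≤ K * #B) (ha : a ∈ actSet B K) : -a ∈ actSet B (K ^ 3) := by
  have hBpos : (0 : ℝ) < #B := by exact_mod_cast hB.card_pos
  have hK1 : K ≤ K ^ 3 := by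
    calc K = K ^ 1 := by ring
      _ ≤ K ^ 3 := by gcongr <;> linarith
  refine ⟨by rw [abs_neg]; exact ha.1.trans hK1, ?_⟩
  have hsub : B + dil (-a) B ⊆ (B - dil a B) + {-1, 0} := by
    intro y hy
    obtain ⟨x, hx, z, hz, rfl⟩ := mem_add.1 hy
    obtain ⟨w, hw, rfl⟩ := mem_dil.1 hz
    have e : ⌊-a * w⌋ + ⌊a * w⌋ = -1 ∨ ⌊-a * w⌋ + ⌊a * w⌋ = 0 := by
      have h1 := Int.floor_le (-a * w)
      have h2 := Int.lt_floor_add_one (-a * w)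
      have h3 := Int.floor_le (a * w)
      have h4 := Int.lt_floor_add_one (a * w)
      have h7 : ((⌊-a * w⌋ + ⌊a * w⌋ : ℤ) : ℝ) < 1 := by push_cast; linarith
      have h8 : (-2 : ℝ) < ((⌊-a * w⌋ + ⌊a * w⌋ : ℤ) : ℝ) := by push_cast; linarith
      have h7' : ⌊-a * w⌋ + ⌊a * w⌋ < 1 := by exact_mod_cast h7
      have h8' : -2 < ⌊-a * w⌋ + ⌊a * w⌋ := by exact_mod_cast h8
      omega
    refine mem_add.2 ⟨x - ⌊a * w⌋, sub_mem_sub hx (mem_dil.2 ⟨w, hw, rfl⟩),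
      ⌊-a * w⌋ + ⌊a * w⌋, ?_, by ring⟩
    simpa using e
  have h1 : (#(B - dil a B) : ℝ) ≤ K ^ 2 * #B := by
    have h : (#(B - dil a B) : ℝ) * #B ≤ #(B + B) * #(dil a B + B) := by
      exact_mod_cast ruzsa_triangle_inequality_sub_add_add B B (dil a B)
    have h' := ha.2
    rw [add_comm] at h'
    have : (#(B - dil a B) : ℝ) * #B ≤ (K ^ 2 * #B) * #B := by
      refine h.trans ?_
      calc (#(B + B) : ℝ) * #(dil a B + B) ≤ (K * #B) * (K * #B) := by gcongr
        _ = _ := by ring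
    exact le_of_mul_le_mul_right this hBpos
  have h2 : (#({-1, 0} : Finset ℤ) : ℝ) ≤ K := by
    have : #({-1, 0} : Finset ℤ) = 2 := by decide
    rw [this]; exact_mod_cast hK
  have h3 := card_add_three_le h1 h2 (by positivity)
  have h4 : (#(B + dil (-a) B) : ℝ) ≤ #((B - dil a B) + {-1, 0}) := by
    exact_mod_cast card_le_card hsub
  refine h4.trans (h3.trans (le_of_eq (by ring)))

lemma card_Icc_ceil_le {K : ℝ} (hK : 9 ≤ K) :
    (#(Icc (-(⌈K⌉ + 2)) (⌈K⌉ + 2)) : ℝ) ≤ 3 * K := by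
  have h1 : (0 : ℤ) ≤ ⌈K⌉ := Int.ceil_nonneg (by linarith)
  rw [Int.card_Icc]
  have : (((⌈K⌉ + 2 + 1 - -(⌈K⌉ + 2)).toNat : ℤ) : ℝ) ≤ 3 * K := by
    rw [Int.toNat_of_nonneg (by omega)]
    push_cast
    have := Int.ceil_lt_add_one K
    linarith
  exact_mod_cast this

lemma actSet_mul {B : Finset ℤ} (hB : B.Nonempty) {K a b : ℝ} (hK : 9 ≤ K)
    (hBB : (#(B + B) : ℝ) ≤ K * #B) (ha : a ∈ actSet B K) (hb : b ∈ actSet B K) :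
    a * b ∈ actSet B (K ^ 9) := by
  have hBpos : (0 : ℝ) < #B := by exact_mod_cast hB.card_pos
  refine ⟨?_, ?_⟩
  · rw [abs_mul]
    calc |a| * |b| ≤ K * K := mul_le_mul ha.1 hb.1 (abs_nonneg _) (by linarith)
      _ = K ^ 2 := by ring
      _ ≤ K ^ 9 := by gcongr <;> linarith
  obtain ⟨F, -, hFK, hF⟩ := ruzsa_covering_add (A := dil b B) (K := K) hB (by
    rw [add_comm]; exact hb.2)
  have hsub : B + dil (a * b) B ⊆
      ((B + dil a B + -dil a B) + dil a F) + Icc (-(⌈K⌉ + 2)) (⌈K⌉ + 2) := by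
    intro y hy
    obtain ⟨x, hx, z, hz, rfl⟩ := mem_add.1 hy
    obtain ⟨w, hw, rfl⟩ := mem_dil.1 hz
    obtain ⟨f, hf, d, hd, hfd⟩ := mem_add.1 (hF (mem_dil.2 ⟨w, hw, rfl⟩))
    obtain ⟨u, hu, v, hv, rfl⟩ := mem_sub.1 hd
    refine mem_add.2 ⟨x + ⌊a * u⌋ + -⌊a * v⌋ + ⌊a * f⌋,
      add_mem_add (add_mem_add (add_mem_add hx (mem_dil.2 ⟨u, hu, rfl⟩))
      (neg_mem_neg (mem_dil.2 ⟨v, hv, rfl⟩))) (mem_dil.2 ⟨f, hf, rfl⟩),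
      ⌊a * b * w⌋ - ⌊a * u⌋ + ⌊a * v⌋ - ⌊a * f⌋, ?_, by ring⟩
    have e1 : ((f : ℝ) + (u - v)) = ⌊b * w⌋ := by exact_mod_cast hfd
    have h1 := Int.floor_le (a * b * w)
    have h2 := Int.lt_floor_add_one (a * b * w)
    have h3 := Int.floor_le (a * u)
    have h4 := Int.lt_floor_add_one (a * u)
    have h5 := Int.floor_le (a * v)
    have h6 := Int.lt_floor_add_one (a * v)
    have h7 := Int.floor_le (a * f)
    have h8 := Int.lt_floor_add_one (a * f)
    have h9 : |a * (b * w - ⌊b * w⌋)| ≤ K := by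
      rw [abs_mul]
      have : |b * w - ⌊b * w⌋| ≤ 1 := by
        rw [abs_le]
        constructor <;> linarith [Int.floor_le (b * w), Int.lt_floor_add_one (b * w)]
      calc |a| * |b * w - ⌊b * w⌋| ≤ |a| * 1 := by gcongr
        _ ≤ K := by linarith [ha.1]
    rw [← e1] at h9
    have h10 : a * (b * w - (f + (u - v))) = a * b * w - a * f - a * u + a * v := by ring
    rw [h10, abs_le] at h9
    have hc := Int.le_ceil K
    have hlt : ((⌊a * b * w⌋ - ⌊a * u⌋ + ⌊a * v⌋ - ⌊a * f⌋ : ℤ) : ℝ) < ((⌈K⌉ + 3 : ℤ) : ℝ) := by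
      push_cast; linarith
    have hgt : ((-(⌈K⌉ + 3) : ℤ) : ℝ) < ((⌊a * b * w⌋ - ⌊a * u⌋ + ⌊a * v⌋ - ⌊a * f⌋ : ℤ) : ℝ) := by
      push_cast; linarith
    have hlt' : ⌊a * b * w⌋ - ⌊a * u⌋ + ⌊a * v⌋ - ⌊a * f⌋ < ⌈K⌉ + 3 := by exact_mod_cast hlt
    have hgt' : -(⌈K⌉ + 3) < ⌊a * b * w⌋ - ⌊a * u⌋ + ⌊a * v⌋ - ⌊a * f⌋ := by exact_mod_cast hgt
    rw [mem_Icc]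
    omega
  have hneg : (#(B + -dil a B) : ℝ) ≤ K ^ 2 * #B := by
    have h : (#(B - dil a B) : ℝ) * #B ≤ #(B + B) * #(dil a B + B) := by
      exact_mod_cast ruzsa_triangle_inequality_sub_add_add B B (dil a B)
    have h' := ha.2
    rw [add_comm] at h'
    have : (#(B - dil a B) : ℝ) * #B ≤ (K ^ 2 * #B) * #B := by
      refine h.trans ?_
      calc (#(B + B) : ℝ) * #(dil a B + B) ≤ (K * #B) * (K * #B) := by gcongr
        _ = _ := by ring
    rw [← sub_eq_add_neg]
    exact le_of_mul_le_mul_right this hBpos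
  have h1 := card_add_add_le hB hBB ha.2 hneg (by linarith) (by positivity)
  have h2 : (#(dil a F) : ℝ) ≤ K := by
    refine le_trans ?_ hFK
    exact_mod_cast (card_image_le : #(dil a F) ≤ #F)
  have h3 := card_add_three_le h1 h2 (by positivity)
  have h4 := card_add_three_le h3 (card_Icc_ceil_le hK) (by positivity)
  have h5 := Nat.cast_le (α := ℝ) |>.2 (card_le_card hsub)
  refine h5.trans (h4.trans ?_)
  calc K * K ^ 2 * K ^ 3 * #B * K * (3 * K) = (K ^ 8 * #B) * 3 := by ring
    _ ≤ (K ^ 8 * #B) * K := by gcongr; linarith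
    _ = _ := by ring

lemma actSet_inv {B : Finset ℤ} {K b : ℝ} (hK : 9 ≤ K)
    (hb : b ∈ actSet B K) (hbK : K⁻¹ ≤ |b|) :
    b⁻¹ ∈ actSet B (K ^ 4) := by
  have hbpos : 0 < |b| := lt_of_lt_of_le (by positivity) hbK
  have hb0 : b ≠ 0 := abs_pos.1 hbpos
  refine ⟨?_, ?_⟩
  · rw [abs_inv]
    calc |b|⁻¹ ≤ (K⁻¹)⁻¹ := by gcongr
      _ = K ^ 1 := by simp
      _ ≤ K ^ 4 := by gcongr <;> linarith
  set V := B + dil b⁻¹ B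
  have himg : V.image (fun v : ℤ => ⌊b * v⌋) ⊆
      (B + dil b B) + Icc (-(⌈K⌉ + 2)) (⌈K⌉ + 2) := by
    intro y hy
    obtain ⟨v, hv, rfl⟩ := mem_image.1 hy
    obtain ⟨x, hx, z, hz, rfl⟩ := mem_add.1 hv
    obtain ⟨w, hw, rfl⟩ := mem_dil.1 hz
    refine mem_add.2 ⟨w + ⌊b * x⌋, add_mem_add hw (mem_dil.2 ⟨x, hx, rfl⟩),
      ⌊b * ((x + ⌊b⁻¹ * w⌋ : ℤ) : ℝ)⌋ - w - ⌊b * x⌋, ?_, by ring⟩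
    set q : ℝ := b * ((x + ⌊b⁻¹ * w⌋ : ℤ) : ℝ) with hq
    have h1 := Int.floor_le q
    have h2 := Int.lt_floor_add_one q
    have h3 := Int.floor_le (b * x)
    have h4 := Int.lt_floor_add_one (b * x)
    have h9 : |b * (b⁻¹ * w - ⌊b⁻¹ * w⌋)| ≤ K := by
      rw [abs_mul]
      have : |b⁻¹ * w - ⌊b⁻¹ * w⌋| ≤ 1 := by
        rw [abs_le]
        constructor <;> linarith [Int.floor_le (b⁻¹ * w), Int.lt_floor_add_one (b⁻¹ * w)]
      calc |b| * |b⁻¹ * w - ⌊b⁻¹ * w⌋| ≤ |b| * 1 := by gcongr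
        _ ≤ K := by linarith [hb.1]
    have h10 : b * (b⁻¹ * w - ⌊b⁻¹ * w⌋) = w + b * x - q := by
      rw [hq]; push_cast; field_simp; ring
    rw [h10, abs_le] at h9
    have hc := Int.le_ceil K
    have hlt : ((⌊q⌋ - w - ⌊b * x⌋ : ℤ) : ℝ) < ((⌈K⌉ + 3 : ℤ) : ℝ) := by
      push_cast; linarith
    have hgt : ((-(⌈K⌉ + 3) : ℤ) : ℝ) < ((⌊q⌋ - w - ⌊b * x⌋ : ℤ) : ℝ) := by
      push_cast; linarith
    have hlt' : ⌊q⌋ - w - ⌊b * x⌋ < ⌈K⌉ + 3 := by exact_mod_cast hlt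
    have hgt' : -(⌈K⌉ + 3) < ⌊q⌋ - w - ⌊b * x⌋ := by exact_mod_cast hgt
    rw [mem_Icc]
    omega
  have hfib : #V ≤ #(Icc (-(⌈K⌉ + 2)) (⌈K⌉ + 2)) * #(V.image (fun v : ℤ => ⌊b * v⌋)) := by
    refine card_le_mul_card_image V _ fun y hy => ?_
    obtain ⟨v₀, hv₀, rfl⟩ := mem_image.1 hy
    rw [← card_image_of_injective _ (sub_left_injective (b := v₀))]
    refine card_le_card fun d hd => ?_
    obtain ⟨v, hv, rfl⟩ := mem_image.1 hd
    have hvv := (mem_filter.1 hv).2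
    have h1 := Int.floor_le (b * v)
    have h2 := Int.lt_floor_add_one (b * v)
    have h3 := Int.floor_le (b * v₀)
    have h4 := Int.lt_floor_add_one (b * v₀)
    have hvv' : (⌊b * v⌋ : ℝ) = ⌊b * v₀⌋ := by exact_mod_cast hvv
    have h5 : |b * (v - v₀)| ≤ 1 := by
      rw [abs_le]; constructor <;> nlinarith
    rw [abs_mul] at h5
    have h6 : |(v : ℝ) - v₀| ≤ K := by
      have : K⁻¹ * |(v : ℝ) - v₀| ≤ 1 := le_trans (by gcongr) h5
      rwa [inv_mul_le_iff₀ (by linarith), mul_one] at this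
    rw [abs_le] at h6
    have hc := Int.le_ceil K
    have hlt' : v - v₀ ≤ ⌈K⌉ := by
      have : ((v - v₀ : ℤ) : ℝ) ≤ ((⌈K⌉ : ℤ) : ℝ) := by push_cast; linarith
      exact_mod_cast this
    have hgt' : -⌈K⌉ ≤ v - v₀ := by
      have : ((-⌈K⌉ : ℤ) : ℝ) ≤ ((v - v₀ : ℤ) : ℝ) := by push_cast; linarith
      exact_mod_cast this
    rw [mem_Icc]
    omega
  have hfibR : (#V : ℝ) ≤ #(Icc (-(⌈K⌉ + 2)) (⌈K⌉ + 2)) *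
      #(V.image (fun v : ℤ => ⌊b * v⌋)) := by exact_mod_cast hfib
  have h4 := card_add_three_le hb.2 (card_Icc_ceil_le hK) (by positivity)
  have h5 := Nat.cast_le (α := ℝ) |>.2 (card_le_card himg)
  calc (#V : ℝ) ≤ (3 * K) * (K * #B * (3 * K)) := by
        refine hfibR.trans ?_
        exact mul_le_mul (card_Icc_ceil_le hK) (h5.trans h4) (by positivity) (by positivity)
    _ = (K ^ 3 * #B) * 9 := by ring
    _ ≤ (K ^ 3 * #B) * K := by gcongr
    _ = K ^ 4 * #B := by ring

/-- A monotone family of sets of reals which is closed under the field operations, up to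
polynomial losses, at all levels at least `K₀`. -/
structure ApproxField (S : ℝ → Set ℝ) (K₀ : ℝ) : Prop where
  mono : ∀ K K', K ≤ K' → S K ⊆ S K'
  zero_mem : (0 : ℝ) ∈ S K₀
  one_mem : (1 : ℝ) ∈ S K₀
  add_mem : ∀ K, K₀ ≤ K → ∀ a ∈ S K, ∀ b ∈ S K, a + b ∈ S (K ^ 64)
  sub_mem : ∀ K, K₀ ≤ K → ∀ a ∈ S K, ∀ b ∈ S K, a - b ∈ S (K ^ 64)
  mul_mem : ∀ K, K₀ ≤ K → ∀ a ∈ S K, ∀ b ∈ S K, a * b ∈ S (K ^ 64)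
  div_mem : ∀ K, K₀ ≤ K → ∀ a ∈ S K, ∀ b ∈ S K, K⁻¹ ≤ |b| → a / b ∈ S (K ^ 64)

lemma approxField_actSet {B : Finset ℤ} (hB : B.Nonempty) {K₀ : ℝ} (hK₀ : 9 ≤ K₀)
    (hBB : (#(B + B) : ℝ) ≤ K₀ * #B) : ApproxField (actSet B) K₀ := by
  have hd : ∀ K, K₀ ≤ K → (#(B + B) : ℝ) ≤ K * #B := fun K hK => hBB.trans (by gcongr)
  have hp : ∀ K, K₀ ≤ K → ∀ i j : ℕ, i ≤ j → K ^ i ≤ K ^ j := fun K hK i j hij =>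
    pow_le_pow_right₀ (by linarith) hij
  have hp1 : ∀ K, K₀ ≤ K → ∀ j : ℕ, 1 ≤ j → K ≤ K ^ j := fun K hK j hij => by
    simpa using hp K hK 1 j hij
  refine ⟨fun K K' h => actSet_mono h, zero_mem_actSet (by linarith),
    one_mem_actSet (by linarith) hBB, ?_, ?_, ?_, ?_⟩
  · intro K hK a ha b hb
    exact actSet_mono (hp K hK 6 64 (by norm_num)) (actSet_add hB (by linarith) (hd K hK) ha hb)
  · intro K hK a ha b hb
    have h3 := hp1 K hK 3 (by norm_num)
    have := actSet_add hB (K := K ^ 3) (by linarith) (hd _ (by linarith)) (actSet_mono h3 ha)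
      (actSet_neg hB (by linarith) (hd K hK) hb)
    rw [← pow_mul, ← sub_eq_add_neg] at this
    exact actSet_mono (hp K hK _ 64 (by norm_num)) this
  · intro K hK a ha b hb
    exact actSet_mono (hp K hK 9 64 (by norm_num)) (actSet_mul hB (by linarith) (hd K hK) ha hb)
  · intro K hK a ha b hb hbK
    have h3 := hp1 K hK 4 (by norm_num)
    have := actSet_mul hB (K := K ^ 4) (by linarith) (hd _ (by linarith)) (actSet_mono h3 ha)
      (actSet_inv (by linarith) hb hbK)
    rw [← pow_mul, ← div_eq_mul_inv] at this
    exact actSet_mono (hp K hK _ 64 (by norm_num)) this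

end ActSet

section Covering
open Finset

/-- The number of cells `[m r, (m + 1) r)` met by `A ∩ [-1, 1]`. -/
noncomputable def cov (r : ℝ) (A : Set ℝ) : ℕ :=
  ((fun a : ℝ => ⌊a / r⌋) '' (A ∩ Set.Icc (-1) 1)).ncard

lemma finite_cells {r : ℝ} (hr : 0 < r) (A : Set ℝ) :
    ((fun a : ℝ => ⌊a / r⌋) '' (A ∩ Set.Icc (-1) 1)).Finite := by
  refine (Set.finite_Icc ⌊-1 / r⌋ ⌊1 / r⌋).subset ?_
  rintro _ ⟨a, ⟨-, ha⟩, rfl⟩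
  exact ⟨Int.floor_le_floor (by gcongr; exact ha.1), Int.floor_le_floor (by gcongr; exact ha.2)⟩

lemma cov_mono {r : ℝ} (hr : 0 < r) {A A' : Set ℝ} (h : A ⊆ A') : cov r A ≤ cov r A' :=
  Set.ncard_le_ncard (Set.image_mono (Set.inter_subset_inter_left _ h)) (finite_cells hr A')

lemma one_le_cov {r : ℝ} (hr : 0 < r) {A : Set ℝ} (h : (0 : ℝ) ∈ A) : 1 ≤ cov r A := by
  rw [Nat.one_le_iff_ne_zero, ← Nat.pos_iff_ne_zero, cov, Set.ncard_pos (finite_cells hr A)]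
  exact ⟨_, 0, ⟨h, by norm_num⟩, rfl⟩

lemma cov_le {r : ℝ} (hr : 0 < r) (hr1 : r ≤ 1) (A : Set ℝ) : (cov r A : ℝ) ≤ 4 / r := by
  have h1 : cov r A ≤ (Set.Icc ⌊-1 / r⌋ ⌊1 / r⌋).ncard := by
    refine Set.ncard_le_ncard ?_ (Set.finite_Icc _ _)
    rintro _ ⟨a, ⟨-, ha⟩, rfl⟩
    exact ⟨Int.floor_le_floor (by gcongr; exact ha.1), Int.floor_le_floor (by gcongr; exact ha.2)⟩
  have h2 : (Set.Icc ⌊-1 / r⌋ ⌊1 / r⌋).ncard = (⌊1 / r⌋ + 1 - ⌊-1 / r⌋).toNat := by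
    rw [← Int.card_Icc, ← Set.ncard_coe_finset, coe_Icc]
  have h3 : (((⌊1 / r⌋ + 1 - ⌊-1 / r⌋).toNat : ℤ) : ℝ) ≤ 4 / r := by
    have hle : ⌊-1 / r⌋ ≤ ⌊1 / r⌋ := Int.floor_le_floor (by gcongr; norm_num)
    rw [Int.toNat_of_nonneg (by omega)]
    push_cast
    have e1 := Int.floor_le (1 / r)
    have e2 := Int.lt_floor_add_one (-1 / r)
    have e3 : 1 ≤ 1 / r := by rw [le_div_iff₀ hr]; linarith
    have e4 : -1 / r = -(1 / r) := by ring
    have e5 : 4 / r = 4 * (1 / r) := by ring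
    linarith
  have h4 : (cov r A : ℝ) ≤ ((⌊1 / r⌋ + 1 - ⌊-1 / r⌋).toNat : ℝ) := by
    rw [← h2]; exact_mod_cast h1
  exact h4.trans (by exact_mod_cast h3)

/-- A family `f` of points of `A ∩ [-1, 1]`, separated by `r`, has at most `cov r A` members. -/
lemma card_le_cov {ι : Type*} {r : ℝ} (hr : 0 < r) {A : Set ℝ} (s : Finset ι) (f : ι → ℝ)
    (hf : ∀ i ∈ s, f i ∈ A ∧ |f i| ≤ 1) (hsep : ∀ i ∈ s, ∀ j ∈ s, i ≠ j → r ≤ |f i - f j|) :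
    #s ≤ cov r A := by
  have hinj : Set.InjOn (fun i => ⌊f i / r⌋) s := by
    intro i hi j hj hij
    by_contra hne
    have h := hsep i hi j hj hne
    have h1 := Int.abs_sub_lt_one_of_floor_eq_floor hij
    rw [← sub_div, abs_div, abs_of_pos hr, div_lt_one hr] at h1
    linarith
  rw [← card_image_of_injOn hinj, ← Set.ncard_coe_finset]
  refine Set.ncard_le_ncard ?_ (finite_cells hr A)
  intro x hx
  rw [mem_coe, mem_image] at hx
  obtain ⟨i, hi, rfl⟩ := hx
  exact ⟨f i, ⟨(hf i hi).1, abs_le.1 (hf i hi).2⟩, rfl⟩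

/-- `A` has an `r`-separated subset with at least `cov r A / 2` members. -/
lemma exists_separated {r : ℝ} (hr : 0 < r) (A : Set ℝ) :
    ∃ P : Finset ℝ, (∀ p ∈ P, p ∈ A ∧ |p| ≤ 1) ∧ (∀ p ∈ P, ∀ q ∈ P, p ≠ q → r ≤ |p - q|) ∧
      cov r A ≤ 2 * #P := by
  classical
  set C := (finite_cells hr A).toFinset with hC
  have hCc : #C = cov r A := by
    rw [cov, Set.ncard_eq_toFinset_card _ (finite_cells hr A)]
  have hrep : ∀ m : ℤ, ∃ a : ℝ, m ∈ C → (a ∈ A ∧ |a| ≤ 1) ∧ ⌊a / r⌋ = m := by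
    intro m
    by_cases hm : m ∈ C
    · rw [hC, Set.Finite.mem_toFinset] at hm
      obtain ⟨a, ⟨ha, ha1⟩, ham⟩ := hm
      exact ⟨a, fun _ => ⟨⟨ha, abs_le.2 ha1⟩, ham⟩⟩
    · exact ⟨0, fun h => absurd h hm⟩
  choose f hf using hrep
  have key : ∀ D ⊆ C, (∀ m ∈ D, ∀ m' ∈ D, m ≠ m' → 2 ≤ |m - m'|) → ∃ P : Finset ℝ,
      (∀ p ∈ P, p ∈ A ∧ |p| ≤ 1) ∧ (∀ p ∈ P, ∀ q ∈ P, p ≠ q → r ≤ |p - q|) ∧ #P = #D := by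
    intro D hD hsep
    refine ⟨D.image f, ?_, ?_, card_image_of_injOn ?_⟩
    · intro p hp
      obtain ⟨m, hm, rfl⟩ := mem_image.1 hp
      exact (hf m (hD hm)).1
    · intro p hp q hq hpq
      obtain ⟨m, hm, rfl⟩ := mem_image.1 hp
      obtain ⟨m', hm', rfl⟩ := mem_image.1 hq
      have hne : m ≠ m' := fun h => hpq (by rw [h])
      have h2 := hsep m hm m' hm' hne
      have e := (hf m (hD hm)).2
      have e' := (hf m' (hD hm')).2
      have h3 : 1 ≤ |f m / r - f m' / r| := by
        have b1 := Int.floor_le (f m / r)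
        have b2 := Int.lt_floor_add_one (f m / r)
        have b3 := Int.floor_le (f m' / r)
        have b4 := Int.lt_floor_add_one (f m' / r)
        rw [e] at b1 b2
        rw [e'] at b3 b4
        rcases le_abs.1 h2 with h | h
        · have : (2 : ℝ) ≤ m - m' := by exact_mod_cast h
          exact le_trans (by linarith) (le_abs_self _)
        · have : (2 : ℝ) ≤ -(m - m') := by exact_mod_cast h
          exact le_trans (by linarith) (neg_le_abs _)
      rw [← sub_div, abs_div, abs_of_pos hr, le_div_iff₀ hr] at h3
      linarith
    · intro m hm m' hm' h
      rw [← (hf m (hD hm)).2, ← (hf m' (hD hm')).2, h]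
  have hsum : #(C.filter (fun m : ℤ => m % 2 = 0)) + #(C.filter (fun m : ℤ => ¬ m % 2 = 0)) = #C :=
    card_filter_add_card_filter_not (fun m : ℤ => m % 2 = 0)
  by_cases hbig : cov r A ≤ 2 * #(C.filter (fun m : ℤ => m % 2 = 0))
  · obtain ⟨P, h1, h2, h3⟩ := key (C.filter (fun m : ℤ => m % 2 = 0)) (filter_subset _ _) (by
      intro m hm m' hm' hne
      have e1 := (mem_filter.1 hm).2
      have e2 := (mem_filter.1 hm').2
      rcases lt_or_gt_of_ne hne with h | h
      · rw [abs_of_neg (by omega)]; omega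
      · rw [abs_of_pos (by omega)]; omega)
    exact ⟨P, h1, h2, by rw [h3]; exact hbig⟩
  · obtain ⟨P, h1, h2, h3⟩ := key (C.filter (fun m : ℤ => ¬ m % 2 = 0)) (filter_subset _ _) (by
      intro m hm m' hm' hne
      have e1 := (mem_filter.1 hm).2
      have e2 := (mem_filter.1 hm').2
      rcases lt_or_gt_of_ne hne with h | h
      · rw [abs_of_neg (by omega)]; omega
      · rw [abs_of_pos (by omega)]; omega)
    refine ⟨P, h1, h2, ?_⟩
    rw [h3]
    omega

lemma cov_le_mul_cov {r r' : ℝ} (hr : 0 < r) (hr' : 0 < r') {m : ℕ} (h : r' ≤ m * r)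
    (A : Set ℝ) : cov r A ≤ (m + 1) * cov r' A := by
  classical
  set C := (finite_cells hr A).toFinset with hC
  set C' := (finite_cells hr' A).toFinset with hC'
  have hCc : #C = cov r A := by
    rw [cov, Set.ncard_eq_toFinset_card _ (finite_cells hr A)]
  have hCc' : #C' = cov r' A := by
    rw [cov, Set.ncard_eq_toFinset_card _ (finite_cells hr' A)]
  have hsub : C ⊆ C'.biUnion (fun c => Icc ⌊c * r' / r⌋ (⌊c * r' / r⌋ + m)) := by
    intro x hx
    rw [hC, Set.Finite.mem_toFinset] at hx
    obtain ⟨a, ha, rfl⟩ := hx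
    rw [mem_biUnion]
    refine ⟨⌊a / r'⌋, by rw [hC', Set.Finite.mem_toFinset]; exact ⟨a, ha, rfl⟩, ?_⟩
    have h1 := Int.floor_le (a / r')
    have h2 := Int.lt_floor_add_one (a / r')
    rw [le_div_iff₀ hr'] at h1
    rw [div_lt_iff₀ hr'] at h2
    rw [mem_Icc]
    constructor
    · exact Int.floor_le_floor (by gcongr)
    · rw [← Int.lt_add_one_iff, Int.floor_lt]
      push_cast
      have h3 : a / r < ⌊a / r'⌋ * r' / r + m := by
        rw [div_add' _ _ _ hr.ne', div_lt_div_iff_of_pos_right hr]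
        linarith
      have h4 := Int.lt_floor_add_one (⌊a / r'⌋ * r' / r)
      linarith
  rw [← hCc, ← hCc', mul_comm]
  refine (card_le_card hsub).trans (card_biUnion_le_card_mul _ _ _ fun c _ => ?_)
  rw [Int.card_Icc]
  omega

end Covering

section Expansion
open Finset

/-- Quotients of differences of elements of `Y` with denominators at least `r`. -/
def quotSet (Y : Set ℝ) (r : ℝ) : Set ℝ :=
  {q | ∃ a ∈ Y, ∃ b ∈ Y, ∃ c ∈ Y, ∃ d ∈ Y, r ≤ |c - d| ∧ q = (a - b) / (c - d)}

/-- If `Q` is almost closed under `q ↦ q / 2` and `q ↦ (q + 1) / 2`, then it is dense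
in `[0, 1]`. -/
lemma dense_of_almost_half {Q : Set ℝ} {ρ : ℝ} (hρ0 : 0 < ρ) (hρ : ρ ≤ 1 / 2) (h0 : (0 : ℝ) ∈ Q)
    (h : ∀ q ∈ Q, |q| ≤ 3 → (∃ p ∈ Q, |p - q / 2| < ρ) ∧ ∃ p ∈ Q, |p - (q + 1) / 2| < ρ) :
    ∀ t ∈ Set.Icc (0 : ℝ) 1, ∃ q ∈ Q, |t - q| ≤ 3 * ρ := by
  have key : ∀ n : ℕ, ∀ t ∈ Set.Icc (0 : ℝ) 1, ∃ q ∈ Q, |t - q| ≤ (1 / 2) ^ n + 2 * ρ := by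
    intro n
    induction n with
    | zero =>
      intro t ht
      exact ⟨0, h0, by rw [sub_zero, abs_of_nonneg ht.1]; linarith [ht.2]⟩
    | succ n ih =>
      intro t ht
      have hpow : ((1 : ℝ) / 2) ^ n ≤ 1 := pow_le_one₀ (by norm_num) (by norm_num)
      rcases le_total t (1 / 2) with ht2 | ht2
      · obtain ⟨q, hq, hqt⟩ := ih (2 * t) ⟨by linarith [ht.1], by linarith⟩
        have hq3 : |q| ≤ 3 := by
          rw [abs_le] at hqt ⊢
          constructor <;> linarith [ht.1]
        obtain ⟨p, hp, hpq⟩ := (h q hq hq3).1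
        refine ⟨p, hp, ?_⟩
        rw [pow_succ]
        rw [abs_le] at hqt ⊢
        rw [abs_lt] at hpq
        constructor <;> linarith
      · obtain ⟨q, hq, hqt⟩ := ih (2 * t - 1) ⟨by linarith, by linarith [ht.2]⟩
        have hq3 : |q| ≤ 3 := by
          rw [abs_le] at hqt ⊢
          constructor <;> linarith [ht.1, ht.2]
        obtain ⟨p, hp, hpq⟩ := (h q hq hq3).2
        refine ⟨p, hp, ?_⟩
        rw [pow_succ]
        rw [abs_le] at hqt ⊢
        rw [abs_lt] at hpq
        constructor <;> linarith
  intro t ht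
  obtain ⟨n, hn⟩ := exists_pow_lt_of_lt_one hρ0 (show (1 / 2 : ℝ) < 1 by norm_num)
  obtain ⟨q, hq, hqt⟩ := key n t ht
  exact ⟨q, hq, by linarith⟩

variable {S : ℝ → Set ℝ} {K₀ K : ℝ}

lemma ApproxField.mem_mono (hS : ApproxField S K₀) {K K' a : ℝ} (h : K ≤ K') (ha : a ∈ S K) :
    a ∈ S K' := hS.mono K K' h ha

lemma self_le_pow {K : ℝ} (hK : 1 ≤ K) {i j : ℕ} (h : i ≤ j) : K ^ i ≤ K ^ j :=
  pow_le_pow_right₀ hK h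

/-- The three-dimensional packing behind the growth of `ApproxField`s. -/
lemma ApproxField.packing (hS : ApproxField S K₀) (hK₀ : 1 ≤ K₀) (hK : K₀ ≤ K) {δ r ρ q' ξ ξ' : ℝ}
    (hδ : 0 < δ) (hr : 0 < r) (hr1 : r ≤ 1) (hρ : δ ≤ ρ * r ^ 2) (hρ1 : ρ ≤ 1)
    (hq' : |q'| ≤ 2)
    (hfar : ∀ p ∈ quotSet (S K ∩ Set.Icc (-1) 1) r, ρ ≤ |p - q'|)
    (hξ : ξ ∈ S (K ^ (64 ^ 2))) (hξ' : ξ' ∈ S (K ^ (64 ^ 2))) (hq : ξ' = ξ * q')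
    (hξr : 2 * r ≤ |ξ|) (hξ4 : |ξ| ≤ 4) (hξ'4 : |ξ'| ≤ 4) :
    cov (δ / |ξ|) (S K) * cov r (S K) * cov (7 * |ξ|) (S K) ≤
      8 * cov (δ / 16) (S (K ^ (64 ^ 6))) := by
  set h := |ξ| with hh
  have hh0 : 0 < h := by linarith
  have hK1 : 1 ≤ K := hK₀.trans hK
  obtain ⟨P1, hP1, hP1s, hP1c⟩ := exists_separated (show 0 < δ / h by positivity) (S K)
  obtain ⟨P2, hP2, hP2s, hP2c⟩ := exists_separated hr (S K)
  obtain ⟨P3, hP3, hP3s, hP3c⟩ := exists_separated (show 0 < 7 * h by positivity) (S K)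
  have hle : ∀ n : ℕ, K₀ ≤ K ^ (64 ^ n) := fun n => hK.trans (by
    simpa using self_le_pow hK1 (show 1 ≤ 64 ^ n from Nat.one_le_pow _ _ (by norm_num)))
  have hup : ∀ n : ℕ, ∀ m : ℕ, n ≤ m → ∀ a ∈ S (K ^ (64 ^ n)), a ∈ S (K ^ (64 ^ m)) :=
    fun n m hnm a ha => hS.mem_mono (self_le_pow hK1 (Nat.pow_le_pow_right (by norm_num) hnm)) ha
  have hup0 : ∀ m : ℕ, ∀ a ∈ S K, a ∈ S (K ^ (64 ^ m)) :=
    fun m a ha => hup 0 m (Nat.zero_le _) a (by simpa using ha)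
  have hstep : ∀ n : ℕ, (K ^ (64 ^ n)) ^ 64 = K ^ (64 ^ (n + 1)) := fun n => by
    rw [← pow_mul, pow_succ]
  have hadd : ∀ n : ℕ, ∀ a ∈ S (K ^ (64 ^ n)), ∀ b ∈ S (K ^ (64 ^ n)),
      a + b ∈ S (K ^ (64 ^ (n + 1))) := fun n a ha b hb => by
    rw [← hstep]; exact hS.add_mem _ (hle n) a ha b hb
  have hmul : ∀ n : ℕ, ∀ a ∈ S (K ^ (64 ^ n)), ∀ b ∈ S (K ^ (64 ^ n)),
      a * b ∈ S (K ^ (64 ^ (n + 1))) := fun n a ha b hb => by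
    rw [← hstep]; exact hS.mul_mem _ (hle n) a ha b hb
  have h16 : (16 : ℝ) ∈ S (K ^ (64 ^ 4)) := by
    have h1 : (1 : ℝ) ∈ S (K ^ (64 ^ 0)) := hS.mem_mono (hle 0) hS.one_mem
    have h2 := hadd 0 _ h1 _ h1
    have h4 := hadd 1 _ h2 _ h2
    have h8 := hadd 2 _ h4 _ h4
    have h16 := hadd 3 _ h8 _ h8
    norm_num at h16 ⊢
    exact h16
  set f : ℝ × ℝ × ℝ → ℝ := fun p => (p.2.2 + (ξ * p.1 + ξ' * p.2.1)) / 16 with hf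
  have hcard : #(P1 ×ˢ P2 ×ˢ P3) ≤ cov (δ / 16) (S (K ^ (64 ^ 6))) := by
    refine card_le_cov (by positivity) _ f ?_ ?_
    · rintro ⟨z, y, x⟩ hp
      rw [mem_product, mem_product] at hp
      obtain ⟨hz, hy, hx⟩ := hp
      simp only at hz hy hx
      constructor
      · have e1 := hmul 2 _ hξ _ (hup0 2 _ (hP1 z hz).1)
        have e2 := hmul 2 _ hξ' _ (hup0 2 _ (hP2 y hy).1)
        have e3 := hadd 3 _ e1 _ e2
        have e4 := hadd 4 _ (hup0 4 _ (hP3 x hx).1) _ e3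
        have e5 := hS.div_mem _ (hle 5) _ e4 16 (hup 4 5 (by norm_num) _ h16) (by
          rw [abs_of_pos (by norm_num)]
          refine le_trans (inv_le_one_of_one_le₀ ?_) (by norm_num)
          exact hK₀.trans (hle 5))
        rw [hstep] at e5
        exact e5
      · have a1 : |ξ * z| ≤ 4 := by
          rw [abs_mul]
          calc |ξ| * |z| ≤ 4 * 1 := mul_le_mul hξ4 (hP1 z hz).2 (abs_nonneg _) (by norm_num)
            _ = 4 := by norm_num
        have a2 : |ξ' * y| ≤ 4 := by
          rw [abs_mul]
          calc |ξ'| * |y| ≤ 4 * 1 := mul_le_mul hξ'4 (hP2 y hy).2 (abs_nonneg _) (by norm_num)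
            _ = 4 := by norm_num
        have a3 := (hP3 x hx).2
        rw [hf, abs_div, abs_of_pos (show (0 : ℝ) < 16 by norm_num), div_le_one (by norm_num)]
        simp only
        rw [abs_le] at *
        constructor <;> linarith
    · rintro ⟨z, y, x⟩ hp ⟨z', y', x'⟩ hp' hne
      rw [mem_product, mem_product] at hp hp'
      obtain ⟨hz, hy, hx⟩ := hp
      obtain ⟨hz', hy', hx'⟩ := hp'
      simp only at hz hy hx hz' hy' hx'
      have hδh : δ ≤ h := by nlinarith
      suffices hs : δ ≤ |(x - x') + (ξ * (z - z') + ξ' * (y - y'))| by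
        have e : f (z, y, x) - f (z', y', x') =
          ((x - x') + (ξ * (z - z') + ξ' * (y - y'))) / 16 := by
          rw [hf]; ring
        rw [e, abs_div, abs_of_pos (show (0 : ℝ) < 16 by norm_num)]
        gcongr
      by_cases hxx : x = x'
      · subst hxx
        rw [sub_self, zero_add]
        by_cases hyy : y = y'
        · subst hyy
          have hzz : z ≠ z' := fun hzz => hne (by rw [hzz])
          rw [sub_self, mul_zero, add_zero, abs_mul]
          have := hP1s z hz z' hz' hzz
          rwa [div_le_iff₀ hh0, mul_comm] at this
        · have h1 := hP2s y hy y' hy' hyy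
          have hyne : y - y' ≠ 0 := sub_ne_zero.2 hyy
          have h2 := hfar ((z' - z) / (y - y')) ⟨z', ⟨(hP1 z' hz').1, abs_le.1 (hP1 z' hz').2⟩,
            z, ⟨(hP1 z hz).1, abs_le.1 (hP1 z hz).2⟩, y, ⟨(hP2 y hy).1, abs_le.1 (hP2 y hy).2⟩,
            y', ⟨(hP2 y' hy').1, abs_le.1 (hP2 y' hy').2⟩, h1, rfl⟩
          have e : ξ * (z - z') + ξ' * (y - y') =
              -(ξ * (y - y') * ((z' - z) / (y - y') - q')) := by
            rw [hq]; field_simp; ring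
          rw [e, abs_neg, abs_mul, abs_mul]
          have hρ0 : 0 < ρ := by
            by_contra hcon
            have : ρ * r ^ 2 ≤ 0 := mul_nonpos_of_nonpos_of_nonneg (not_lt.1 hcon) (by positivity)
            linarith
          calc δ ≤ ρ * r ^ 2 := hρ
            _ ≤ (2 * r) * r * ρ := by nlinarith [mul_pos hρ0 (pow_pos hr 2)]
            _ ≤ |ξ| * |y - y'| * |(z' - z) / (y - y') - q'| := by gcongr
      · have h1 := hP3s x hx x' hx' hxx
        have hz2 : |z - z'| ≤ 2 := (abs_sub _ _).trans (by linarith [(hP1 z hz).2, (hP1 z' hz').2])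
        have hy2 : |y - y'| ≤ 2 := (abs_sub _ _).trans (by linarith [(hP2 y hy).2, (hP2 y' hy').2])
        have h2 : |ξ * (z - z')| ≤ h * 2 := by
          rw [abs_mul]; gcongr
        have h3 : |ξ' * (y - y')| ≤ h * 2 * 2 := by
          rw [abs_mul, hq, abs_mul]; gcongr
        have h4 : |x - x'| ≤ |(x - x') + (ξ * (z - z') + ξ' * (y - y'))| +
            (|ξ * (z - z')| + |ξ' * (y - y')|) := by
          have e : x - x' = ((x - x') + (ξ * (z - z') + ξ' * (y - y'))) -
            (ξ * (z - z') + ξ' * (y - y')) := by ring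
          calc |x - x'| = |((x - x') + (ξ * (z - z') + ξ' * (y - y'))) -
            (ξ * (z - z') + ξ' * (y - y'))| := by rw [← e]
            _ ≤ _ := (abs_sub _ _).trans (by gcongr; exact abs_add_le _ _)
        linarith
  rw [card_product, card_product] at hcard
  calc cov (δ / h) (S K) * cov r (S K) * cov (7 * h) (S K)
      ≤ (2 * #P1) * (2 * #P2) * (2 * #P3) := by gcongr
    _ = 8 * (#P1 * (#P2 * #P3)) := by ring
    _ ≤ _ := by gcongr

end Expansion

section Growth
open Finset

variable {S : ℝ → Set ℝ} {K₀ K : ℝ}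

/-- Either the quotient set is dense or the covering numbers grow. -/
lemma ApproxField.dense_or_growth (hS : ApproxField S K₀) (hK₀ : 1 ≤ K₀) (hK : K₀ ≤ K) {β : ℝ}
    (hβ : 0 < β) (hβ1 : β ≤ 1 / 2) {n k : ℕ} (hn : 2 * (2 * k) < n) :
    (∀ t ∈ Set.Icc (0 : ℝ) 1, ∃ q ∈ quotSet (S K ∩ Set.Icc (-1) 1) (β ^ (2 * k)),
      |t - q| ≤ 3 * β ^ (n - 2 * (2 * k))) ∨
    cov (β ^ (n - k)) (S K) * cov (β ^ (2 * k)) (S K) ≤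
      2176 * cov (β ^ n) (S (K ^ (64 ^ 6))) ∨
    cov (β ^ (n - 2 * k)) (S K) * cov (β ^ (2 * k)) (S K) * cov (β ^ k) (S K) ≤
      2176 * cov (β ^ n) (S (K ^ (64 ^ 6))) := by
  have hβle : β ≤ 1 := by linarith
  have hzero : (0 : ℝ) ∈ S K := hS.mem_mono hK hS.zero_mem
  have hone : (1 : ℝ) ∈ S K := hS.mem_mono hK hS.one_mem
  have hpow : ∀ m, β ^ m ≤ 1 := fun m => pow_le_one₀ hβ.le hβle
  have hρ : β ^ (n - 2 * (2 * k)) ≤ 1 / 2 := by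
    calc β ^ (n - 2 * (2 * k)) ≤ β ^ 1 := pow_le_pow_of_le_one hβ.le hβle (by omega)
      _ ≤ 1 / 2 := by simpa using hβ1
  set Q := quotSet (S K ∩ Set.Icc (-1) 1) (β ^ (2 * k)) with hQ
  have h0Q : (0 : ℝ) ∈ Q := ⟨0, ⟨hzero, by norm_num⟩, 0, ⟨hzero, by norm_num⟩, 1,
    ⟨hone, by norm_num⟩, 0, ⟨hzero, by norm_num⟩, by simpa using hpow _, by simp⟩
  by_cases H : ∀ q ∈ Q, |q| ≤ 3 → (∃ p ∈ Q, |p - q / 2| < β ^ (n - 2 * (2 * k))) ∧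
      ∃ p ∈ Q, |p - (q + 1) / 2| < β ^ (n - 2 * (2 * k))
  · exact Or.inl (dense_of_almost_half (by positivity) hρ h0Q H)
  right
  have hbad : ∃ q' ξ ξ' : ℝ, |q'| ≤ 2 ∧ (∀ p ∈ Q, β ^ (n - 2 * (2 * k)) ≤ |p - q'|) ∧
      ξ ∈ S (K ^ (64 ^ 2)) ∧ ξ' ∈ S (K ^ (64 ^ 2)) ∧ ξ' = ξ * q' ∧ 2 * β ^ (2 * k) ≤ |ξ| ∧
      |ξ| ≤ 4 ∧ |ξ'| ≤ 4 := by
    push Not at H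
    obtain ⟨q, hq, hq3, hqq⟩ := H
    obtain ⟨a, ha, b, hb, c, hc, d, hd, hcd, rfl⟩ := hq
    have hK1 : 1 ≤ K := hK₀.trans hK
    have hcdne : c - d ≠ 0 := by
      rw [← abs_pos]
      exact lt_of_lt_of_le (by positivity) hcd
    have s1 : a - b ∈ S (K ^ 64) := hS.sub_mem _ hK _ ha.1 _ hb.1
    have s2 : c - d ∈ S (K ^ 64) := hS.sub_mem _ hK _ hc.1 _ hd.1
    have h64 : K₀ ≤ K ^ 64 := hK.trans (by simpa using self_le_pow hK1 (show 1 ≤ 64 by norm_num))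
    have hee : (K ^ 64) ^ 64 = K ^ (64 ^ 2) := by rw [← pow_mul]; norm_num
    have s3 : 2 * (c - d) ∈ S (K ^ (64 ^ 2)) := by
      rw [← hee, two_mul]
      exact hS.add_mem _ h64 _ s2 _ s2
    have hab2 : |a - b| ≤ 2 := by
      rw [abs_le]; constructor <;> linarith [ha.2.1, ha.2.2, hb.2.1, hb.2.2]
    have hcd2 : |c - d| ≤ 2 := by
      rw [abs_le]; constructor <;> linarith [hc.2.1, hc.2.2, hd.2.1, hd.2.2]
    have hξa : |2 * (c - d)| = 2 * |c - d| := by rw [abs_mul]; norm_num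
    by_cases h1 : ∃ p ∈ Q, |p - (a - b) / (c - d) / 2| < β ^ (n - 2 * (2 * k))
    · have hfar := hqq h1
      refine ⟨((a - b) / (c - d) + 1) / 2, 2 * (c - d), (a - b) + (c - d), ?_, hfar, s3, ?_, ?_,
        by rw [hξa]; linarith, by rw [hξa]; linarith, ?_⟩
      · rw [abs_le] at hq3 ⊢
        constructor <;> linarith
      · rw [← hee]
        exact hS.add_mem _ h64 _ s1 _ s2
      · field_simp
      · exact (abs_add_le _ _).trans (by linarith)
    · push Not at h1
      refine ⟨(a - b) / (c - d) / 2, 2 * (c - d), a - b, ?_, h1, s3, ?_, ?_,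
        by rw [hξa]; linarith, by rw [hξa]; linarith, by linarith⟩
      · rw [abs_le] at hq3 ⊢
        constructor <;> linarith
      · refine hS.mem_mono ?_ s1
        exact self_le_pow hK1 (by norm_num)
      · field_simp
  obtain ⟨q', ξ, ξ', hq', hfar, hξ, hξ', hq, hξr, hξ4, hξ'4⟩ := hbad
  have hpack := hS.packing hK₀ hK (δ := β ^ n) (by positivity) (by positivity) (hpow (2 * k))
    (by rw [← pow_mul, ← pow_add]; exact le_of_eq (by congr 1; omega)) (hpow _) hq' hfar
    hξ hξ' hq hξr hξ4 hξ'4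
  have hh0 : 0 < |ξ| := lt_of_lt_of_le (by positivity) hξr
  have h16 : cov (β ^ n / 16) (S (K ^ (64 ^ 6))) ≤ (16 + 1) * cov (β ^ n) (S (K ^ (64 ^ 6))) :=
    cov_le_mul_cov (by positivity) (by positivity) (by push_cast; linarith) _
  have h7 : 1 ≤ cov (7 * |ξ|) (S K) := one_le_cov (by positivity) hzero
  rcases le_total (β ^ k) |ξ| with hc | hc
  · left
    have h1 : cov (β ^ (n - k)) (S K) ≤ (1 + 1) * cov (β ^ n / |ξ|) (S K) := by
      refine cov_le_mul_cov (by positivity) (by positivity) ?_ _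
      rw [Nat.cast_one, one_mul, div_le_iff₀ hh0]
      calc β ^ n = β ^ (n - k) * β ^ k := by rw [← pow_add]; congr 1; omega
        _ ≤ _ := by gcongr
    calc cov (β ^ (n - k)) (S K) * cov (β ^ (2 * k)) (S K)
        ≤ ((1 + 1) * cov (β ^ n / |ξ|) (S K)) * cov (β ^ (2 * k)) (S K) * cov (7 * |ξ|) (S K) := by
          refine le_trans ?_ (Nat.le_mul_of_pos_right _ h7)
          gcongr
      _ = 2 * (cov (β ^ n / |ξ|) (S K) * cov (β ^ (2 * k)) (S K) * cov (7 * |ξ|) (S K)) := by ring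
      _ ≤ 2 * (8 * ((16 + 1) * cov (β ^ n) (S (K ^ (64 ^ 6))))) := by
          exact Nat.mul_le_mul_left _ (hpack.trans (Nat.mul_le_mul_left _ h16))
      _ ≤ _ := by omega
  · right
    have h1 : cov (β ^ (n - 2 * k)) (S K) ≤ (1 + 1) * cov (β ^ n / |ξ|) (S K) := by
      refine cov_le_mul_cov (by positivity) (by positivity) ?_ _
      rw [Nat.cast_one, one_mul, div_le_iff₀ hh0]
      calc β ^ n = β ^ (n - 2 * k) * β ^ (2 * k) := by rw [← pow_add]; congr 1; omega
        _ ≤ _ := by gcongr; linarith [pow_pos hβ (2 * k)]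
    have h2 : cov (β ^ k) (S K) ≤ (7 + 1) * cov (7 * |ξ|) (S K) := by
      refine cov_le_mul_cov (by positivity) (by positivity) ?_ _
      push_cast; linarith
    calc cov (β ^ (n - 2 * k)) (S K) * cov (β ^ (2 * k)) (S K) * cov (β ^ k) (S K)
        ≤ ((1 + 1) * cov (β ^ n / |ξ|) (S K)) * cov (β ^ (2 * k)) (S K) *
          ((7 + 1) * cov (7 * |ξ|) (S K)) := by gcongr
      _ = 16 * (cov (β ^ n / |ξ|) (S K) * cov (β ^ (2 * k)) (S K) * cov (7 * |ξ|) (S K)) := by ring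
      _ ≤ 16 * (8 * ((16 + 1) * cov (β ^ n) (S (K ^ (64 ^ 6))))) := by
          exact Nat.mul_le_mul_left _ (hpack.trans (Nat.mul_le_mul_left _ h16))
      _ ≤ _ := by omega

/-- One-scale growth forces growth with a larger slope. -/
lemma slope_of_step {g : ℕ → ℝ} {k n₀ M : ℕ} {l : ℝ} (hk : 0 < k) (hkn : 2 * k ≤ n₀) (hl : 0 ≤ l)
    (hg : ∀ n, 0 ≤ g n)
    (hstep : ∀ n, n₀ < n → n ≤ M → g (n - k) + l * k ≤ g n ∨ g (n - 2 * k) + l * (2 * k) ≤ g n) :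
    ∀ n ≤ M, l * ((n : ℝ) - n₀) ≤ g n := by
  intro n
  induction n using Nat.strong_induction_on with
  | _ n ih =>
    intro hn
    rcases le_or_gt n n₀ with h | h
    · refine le_trans (mul_nonpos_of_nonneg_of_nonpos hl ?_) (hg n)
      rw [sub_nonpos]; exact_mod_cast h
    · rcases hstep n h hn with h1 | h1
      · have := ih (n - k) (by omega) (by omega)
        rw [Nat.cast_sub (by omega)] at this
        nlinarith
      · have := ih (n - 2 * k) (by omega) (by omega)
        rw [Nat.cast_sub (by omega)] at this
        push_cast at this
        nlinarith

/-- Repeated squaring of the scale of approximation. -/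
lemma ApproxField.dense_iterate (hS : ApproxField S K₀) (hK₀ : 1 ≤ K₀) {H : ℝ} (hH : 0 < H)
    (hH1 : H ≤ 1) (D : ℕ) (hK : K₀ ≤ K)
    (h : ∀ t ∈ Set.Icc (0 : ℝ) 1, ∃ q ∈ S K, |t - q| ≤ H / 3) :
    ∀ t ∈ Set.Icc (0 : ℝ) 1, ∃ q ∈ S (K ^ 4096 ^ D), |t - q| ≤ H ^ 2 ^ D / 3 := by
  induction D with
  | zero => simpa using h
  | succ D ih =>
    intro t ht
    have hK1 : 1 ≤ K := hK₀.trans hK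
    set κ := K ^ 4096 ^ D with hκ
    have hκK : K₀ ≤ κ := hK.trans (by
      simpa using self_le_pow hK1 (show 1 ≤ 4096 ^ D from Nat.one_le_pow _ _ (by norm_num)))
    set U := H ^ 2 ^ D with hU
    have hU0 : 0 < U := by positivity
    have hU1 : U ≤ 1 := pow_le_one₀ hH.le hH1
    have e1 : K ^ 4096 ^ (D + 1) = (κ ^ 64) ^ 64 := by
      rw [hκ, ← pow_mul, ← pow_mul]; congr 1
    have e2 : H ^ 2 ^ (D + 1) = U ^ 2 := by rw [hU, ← pow_mul, pow_succ]
    rw [e1, e2]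
    have hκ64 : κ ≤ κ ^ 64 := by
      simpa using self_le_pow (hK₀.trans hκK) (show 1 ≤ 64 by norm_num)
    obtain ⟨q, hq, hqt⟩ := ih t ht
    obtain ⟨d, hd, hdt⟩ := ih (2 * (U / 3)) ⟨by positivity, by linarith⟩
    rw [abs_le] at hdt
    have hdpos : 0 < d := by linarith
    have hle : |t - q| / d ≤ 1 := by rw [div_le_one hdpos]; linarith
    obtain ⟨p, hp, hpt⟩ := ih (|t - q| / d) ⟨by positivity, hle⟩
    have hdp : d * p ∈ S (κ ^ 64) := hS.mul_mem _ hκK _ hd _ hp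
    have hq' : q ∈ S (κ ^ 64) := hS.mem_mono hκ64 hq
    have hmain : |(|t - q| - d * p)| ≤ U ^ 2 / 3 := by
      have : |t - q| - d * p = d * (|t - q| / d - p) := by field_simp
      rw [this, abs_mul, abs_of_pos hdpos]
      calc d * |(|t - q| / d - p)| ≤ U * (U / 3) := by gcongr; linarith
        _ = U ^ 2 / 3 := by ring
    rcases le_total 0 (t - q) with hs | hs
    · refine ⟨q + d * p, hS.add_mem _ (hκK.trans hκ64) _ hq' _ hdp, ?_⟩
      rw [abs_of_nonneg hs] at hmain
      rwa [← sub_sub]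
    · refine ⟨q - d * p, hS.sub_mem _ (hκK.trans hκ64) _ hq' _ hdp, ?_⟩
      rw [abs_of_nonpos hs] at hmain
      rw [← abs_neg]
      convert hmain using 2
      ring

end Growth

section Density
open Finset

/-- A rapidly decreasing sequence of integer scales. -/
lemma exists_levels {γ θ : ℝ} (hγ : 0 < γ) (hθ : 0 < θ) (L : ℕ) : ∀ P : ℕ, 1 ≤ P →
    ∃ k : ℕ → ℕ, (∀ l ≤ L, 1 ≤ k l) ∧ ∀ l < L, 128 * (k (l + 1) : ℝ) ≤ γ * k l ∧
      ∃ D : ℕ, 2 * (P * k 0 : ℝ) ≤ 2 ^ D * (γ / 64 * (2 * k l)) ∧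
        64 * 4096 ^ D * (2 * (k (l + 1) : ℝ)) ≤ θ * (2 * (P * k 0)) := by
  induction L with
  | zero => intro P _; exact ⟨fun _ => 1, fun _ _ => le_rfl, fun l hl => by omega⟩
  | succ L ih =>
    intro P hP
    have hP0 : (1 : ℝ) ≤ P := by exact_mod_cast hP
    obtain ⟨D, hD⟩ := pow_unbounded_of_one_lt (64 * P / γ) (show (1 : ℝ) < 2 by norm_num)
    obtain ⟨f, hf⟩ := exists_nat_gt (max (128 / γ) (64 * 4096 ^ D / θ))
    have hf1 : 128 / γ < f := (le_max_left _ _).trans_lt hf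
    have hf2 : 64 * 4096 ^ D / θ < f := (le_max_right _ _).trans_lt hf
    have hfpos : (0 : ℝ) < f := lt_trans (by positivity) hf1
    have hfpos' : 1 ≤ f := by exact_mod_cast hfpos
    rw [div_lt_iff₀ hγ] at hf1 hD
    rw [div_lt_iff₀ hθ] at hf2
    obtain ⟨k, hk1, hk⟩ := ih (P * f) (Nat.mul_pos hP hfpos')
    have hk0 : (1 : ℝ) ≤ k 0 := by exact_mod_cast hk1 0 (Nat.zero_le _)
    obtain ⟨k', hk'0, hk's⟩ : ∃ k' : ℕ → ℕ, k' 0 = f * k 0 ∧ ∀ l, k' (l + 1) = k l :=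
      ⟨fun l => Nat.casesOn l (f * k 0) k, rfl, fun _ => rfl⟩
    refine ⟨k', ?_, ?_⟩
    · intro l hl
      cases l with
      | zero =>
        rw [hk'0]
        exact Nat.mul_pos hfpos' (hk1 0 (Nat.zero_le _))
      | succ l => rw [hk's]; exact hk1 l (by omega)
    · intro l hl
      cases l with
      | zero =>
        rw [hk's, hk'0]
        push_cast
        refine ⟨by nlinarith, D, ?_, ?_⟩
        · have : (P * (f * k 0) : ℝ) * 64 ≤ 2 ^ D * γ * (f * k 0) := by
            calc (P * (f * k 0) : ℝ) * 64 = (64 * P) * (f * k 0) := by ring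
              _ ≤ _ := by gcongr
          linarith
        · have h1 : (k 0 : ℝ) ≤ P * k 0 := by nlinarith
          calc 64 * 4096 ^ D * (2 * (k 0 : ℝ)) ≤ (f * θ) * (2 * (P * k 0)) := by gcongr
            _ = _ := by ring
      | succ l =>
        obtain ⟨h1, D', h2, h3⟩ := hk l (by omega)
        rw [hk's, hk's, hk'0]
        refine ⟨h1, D', ?_, ?_⟩
        · refine le_trans (le_of_eq ?_) h2
          push_cast; ring
        · refine h3.trans (le_of_eq ?_)
          push_cast; ring

/-- A quantity which is bounded cannot grow at every one of many steps. -/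
lemma exists_stable_step {N I : ℕ} {ε B : ℝ} (u : ℕ → ℕ → ℝ) (h0 : ∀ j n, 0 ≤ u j n)
    (hB : ∀ j, ∀ n ≤ N, u j n ≤ B) (hmono : ∀ j n, u j n ≤ u (j + 1) n)
    (hI : (N + 1) * B < I * ε) :
    ∃ j < I, ∀ n ≤ N, u (j + 1) n ≤ u j n + ε := by
  by_contra hcon
  push Not at hcon
  have key : ∀ j ≤ I, j * ε ≤ ∑ n ∈ range (N + 1), u j n := by
    intro j
    induction j with
    | zero => intro _; simpa using Finset.sum_nonneg fun n _ => h0 0 n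
    | succ j ih =>
      intro hj
      obtain ⟨n, hn, hlt⟩ := hcon j (by omega)
      have hmem : n ∈ range (N + 1) := mem_range.2 (by omega)
      have h1 := ih (by omega)
      rw [← add_sum_erase _ _ hmem] at h1 ⊢
      have h2 : ∑ x ∈ (range (N + 1)).erase n, u j x ≤
          ∑ x ∈ (range (N + 1)).erase n, u (j + 1) x := sum_le_sum fun x _ => hmono j x
      push_cast
      linarith
  have h1 := key I le_rfl
  have h2 : ∑ n ∈ range (N + 1), u I n ≤ ∑ _n ∈ range (N + 1), B :=
    sum_le_sum fun n hn => hB I n (by have := mem_range.1 hn; omega)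
  rw [sum_const, card_range, nsmul_eq_mul] at h2
  push_cast at h2
  linarith

/-- A quantity bounded above on a scale cannot gain slope at every level. -/
lemma exists_level_without_gain {g : ℕ → ℝ} {k : ℕ → ℕ} {L : ℕ} {γ : ℝ}
    (hk : ∀ l ≤ L, 1 ≤ k l)
    (hg0 : ∀ n, 0 ≤ g n) (hg : g (2 * k 0) ≤ 2 * (2 * k 0)) (hL : 2 < L * (γ / 4)) :
    ∃ l < L, g (2 * k l) / (2 * k l) < g (2 * k (l + 1)) / (2 * k (l + 1)) + γ / 4 := by
  by_contra hcon
  push Not at hcon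
  have key : ∀ l ≤ L, g (2 * k l) / (2 * k l) + l * (γ / 4) ≤ g (2 * k 0) / (2 * k 0) := by
    intro l
    induction l with
    | zero => intro _; simp
    | succ l ih =>
      intro hl
      have h1 := ih (by omega)
      have h2 := hcon l (by omega)
      push_cast
      linarith
  have h1 := key L le_rfl
  have h2 : 0 ≤ g (2 * k L) / (2 * k L) := div_nonneg (hg0 _) (by positivity)
  have h3 : (1 : ℝ) ≤ k 0 := by exact_mod_cast hk 0 (Nat.zero_le _)
  have h4 : g (2 * k 0) / (2 * k 0) ≤ 2 := by
    rw [div_le_iff₀ (by positivity)]; exact hg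
  linarith

lemma nat_le_exp_eight : (2176 : ℝ) ≤ Real.exp 8 := by
  have h := Real.exp_one_gt_d9
  have e : Real.exp 8 = Real.exp 1 ^ 8 := by rw [← Real.exp_nat_mul]; norm_num
  rw [e]
  calc (2176 : ℝ) ≤ 2.7 ^ 8 := by norm_num
    _ ≤ Real.exp 1 ^ 8 := by gcongr; linarith

end Density

section Density
open Finset

set_option maxHeartbeats 1600000 in
/-- **Discretized ring theorem** for approximate fields: non-concentration at all scales implies
that every point of `[0, 1]` can be approximated with a small loss. -/
theorem ApproxField.dense {γ θ : ℝ} (hγ : 0 < γ) (hγ1 : γ ≤ 1) (hθ : 0 < θ) :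
    ∃ N : ℕ, 1 ≤ N ∧ ∃ s : ℝ, 0 < s ∧ ∃ β₀ : ℝ, 0 < β₀ ∧ ∀ β : ℝ, 0 < β → β ≤ β₀ →
      ∀ S : ℝ → Set ℝ, ApproxField S (β ^ (-s)) →
      (∀ n : ℕ, 1 ≤ n → n ≤ N → β ^ (-(γ * n)) ≤ cov (β ^ n) (S (β ^ (-s)))) →
      ∀ t ∈ Set.Icc (0 : ℝ) 1, ∃ q ∈ S (β ^ (-(θ * N))), |t - q| ≤ β ^ N := by
  obtain ⟨L, hL⟩ := exists_nat_gt (2 / (γ / 4))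
  rw [div_lt_iff₀ (by positivity)] at hL
  obtain ⟨k, hk1, hk⟩ := exists_levels hγ hθ L 1 le_rfl
  set N := 2 * k 0 with hN
  set ε := γ / 64 with hε
  have hε0 : 0 < ε := by positivity
  obtain ⟨I, hI⟩ := exists_nat_gt (((N : ℝ) + 1) * (N + 1) / ε)
  rw [div_lt_iff₀ hε0] at hI
  refine ⟨N, by have := hk1 0 (Nat.zero_le _); omega, 1 / 64 ^ (6 * I), by positivity,
    min (1 / 81) (Real.exp (-(8 / ε))), by positivity, ?_⟩
  intro β hβ0 hββ S hS hlow
  have hβ81 : β ≤ 1 / 81 := hββ.trans (min_le_left _ _)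
  have hβ1 : β < 1 := by linarith
  set ℓ := -Real.log β with hℓ
  have hℓ8 : 8 ≤ ε * ℓ := by
    have := Real.log_le_log hβ0 (hββ.trans (min_le_right _ _))
    rw [Real.log_exp] at this
    have : 8 / ε ≤ ℓ := by linarith
    rw [div_le_iff₀ hε0] at this
    linarith
  have hℓ0 : 0 < ℓ := by
    by_contra hcon
    have := mul_nonpos_of_nonneg_of_nonpos hε0.le (not_lt.1 hcon)
    linarith
  have hε1 : ε ≤ 1 := by rw [hε]; linarith
  have hℓ8' : 8 ≤ ℓ := by nlinarith
  set s : ℝ := 1 / 64 ^ (6 * I) with hs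
  set b := β ^ (-s) with hb
  have hb1 : 1 ≤ b := Real.one_le_rpow_of_pos_of_le_one_of_nonpos hβ0 hβ1.le (by
    rw [hs]; simp only [one_div, Left.neg_nonpos_iff]; positivity)
  set K : ℕ → ℝ := fun j => b ^ 64 ^ (6 * j) with hK
  have hbK : ∀ j, b ≤ K j := fun j => by
    simpa using self_le_pow hb1 (show 1 ≤ 64 ^ (6 * j) from Nat.one_le_pow _ _ (by norm_num))
  have hKmono : ∀ j, K j ≤ K (j + 1) := fun j =>
    self_le_pow hb1 (Nat.pow_le_pow_right (by norm_num) (by omega))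
  have hKsucc : ∀ j, K (j + 1) = K j ^ 64 ^ 6 := fun j => by
    simp only [hK]
    rw [← pow_mul, ← pow_add]; congr 2
  have hcov1 : ∀ j n, 1 ≤ cov (β ^ n) (S (K j)) := fun j n =>
    one_le_cov (by positivity) (hS.mem_mono (hbK j) hS.zero_mem)
  have hcovpos : ∀ j n, (0 : ℝ) < cov (β ^ n) (S (K j)) := fun j n => by
    exact_mod_cast hcov1 j n
  set u : ℕ → ℕ → ℝ := fun j n => Real.log (cov (β ^ n) (S (K j))) / ℓ with hu
  have hu0 : ∀ j n, 0 ≤ u j n := fun j n => div_nonneg (Real.log_natCast_nonneg _) hℓ0.le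
  have hule : ∀ j n, u j n ≤ n + 1 := by
    intro j n
    simp only [hu]
    rw [div_le_iff₀ hℓ0]
    have h1 := cov_le (r := β ^ n) (by positivity) (pow_le_one₀ hβ0.le hβ1.le) (S (K j))
    have h2 := Real.log_le_log (hcovpos j n) h1
    rw [Real.log_div (by norm_num) (by positivity), Real.log_pow] at h2
    have h3 : Real.log 4 ≤ ℓ := by
      have := Real.log_le_sub_one_of_pos (show (0 : ℝ) < 4 by norm_num)
      linarith
    have h4 : (n : ℝ) * Real.log β = -(n * ℓ) := by rw [hℓ]; ring
    linarith
  have humono : ∀ j n, u j n ≤ u (j + 1) n := by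
    intro j n
    simp only [hu]
    gcongr
    · exact hcovpos j n
    · exact cov_mono (by positivity) (hS.mono _ _ (hKmono j))
  obtain ⟨j, hjI, hj⟩ := exists_stable_step (N := N) (I := I) (ε := ε) (B := N + 1) u hu0
    (fun j n hn => (hule j n).trans (by gcongr)) humono (by linarith)
  have hulow : ∀ n, n ≤ N → γ * n ≤ u j n := by
    intro n hn
    rcases Nat.eq_zero_or_pos n with rfl | hn0
    · simpa using hu0 j 0
    simp only [hu]
    rw [le_div_iff₀ hℓ0]
    have h1 := hlow n hn0 hn
    have h2 : (cov (β ^ n) (S b) : ℝ) ≤ cov (β ^ n) (S (K j)) := by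
      exact_mod_cast cov_mono (by positivity) (hS.mono _ _ (hbK j))
    have h3 := Real.log_le_log (by positivity) (h1.trans h2)
    rw [Real.log_rpow hβ0] at h3
    rw [hℓ]; linarith
  obtain ⟨l, hlL, hl⟩ := exists_level_without_gain (g := u j) hk1 (hu0 j)
    ((hule j _).trans (by
      have : (1 : ℝ) ≤ k 0 := by exact_mod_cast hk1 0 (Nat.zero_le _)
      push_cast; linarith)) hL
  obtain ⟨hkk, D, hD1, hD2⟩ := hk l hlL
  have hkl0 : (1 : ℝ) ≤ k l := by exact_mod_cast hk1 l hlL.le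
  have hkl1 : (1 : ℝ) ≤ k (l + 1) := by exact_mod_cast hk1 (l + 1) hlL
  have hklN : ∀ l ≤ L, k l ≤ k 0 := by
    intro l
    induction l with
    | zero => intro _; exact le_rfl
    | succ l ih =>
      intro hl'
      have h1 := ih (by omega)
      have h2 := (hk l (by omega)).1
      have h3 : (k (l + 1) : ℝ) ≤ k l := by
        have : (0 : ℝ) ≤ k l := Nat.cast_nonneg _
        nlinarith [Nat.cast_nonneg (α := ℝ) (k (l + 1))]
      have h4 : k (l + 1) ≤ k l := by exact_mod_cast h3
      omega
  set q := k (l + 1) with hq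
  set M := 2 * k l with hM
  set n₀ := ⌊γ / 8 * k l⌋₊ with hn₀
  have hn₀le : (n₀ : ℝ) ≤ γ / 8 * k l := Nat.floor_le (by positivity)
  have hqn : 2 * q ≤ n₀ := by
    apply Nat.le_floor
    push_cast
    linarith
  have hbig : ∀ n, n₀ < n → γ / 8 * k l < n := fun n hn => (Nat.floor_lt (by positivity)).1 hn
  have hb81 : b ^ 64 ^ (6 * j + 1) ≤ β ^ (-(1 : ℝ)) := by
    rw [hb, ← Real.rpow_natCast, ← Real.rpow_mul hβ0.le]
    refine Real.rpow_le_rpow_of_exponent_ge hβ0 hβ1.le ?_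
    rw [hs]
    have : ((64 : ℝ) ^ (6 * j + 1)) ≤ 64 ^ (6 * I) := by
      gcongr
      · norm_num
      · omega
    push_cast
    rw [neg_mul, one_div, inv_mul_eq_div, neg_le_neg_iff, div_le_one (by positivity)]
    exact this
  by_cases hdense : ∃ n, n₀ < n ∧ n ≤ M ∧ ∀ t ∈ Set.Icc (0 : ℝ) 1,
      ∃ p ∈ quotSet (S (K j) ∩ Set.Icc (-1) 1) (β ^ (2 * q)),
      |t - p| ≤ 3 * β ^ (n - 2 * (2 * q))
  · obtain ⟨n, hn0, hnM, hd⟩ := hdense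
    have hnb := hbig n hn0
    have h4n : 2 * (2 * q) ≤ n := by
      have : ((2 * (2 * q) : ℕ) : ℝ) ≤ n := by push_cast; nlinarith
      exact_mod_cast this
    set m := n - 2 * (2 * q) with hm
    have hmR : (m : ℝ) = n - 4 * q := by rw [hm, Nat.cast_sub h4n]; push_cast; ring
    have hmlow : γ * k l / 16 ≤ m := by rw [hmR]; linarith
    have hm1 : 1 ≤ m := by
      have : (0 : ℝ) < m := lt_of_lt_of_le (by positivity) hmlow
      exact_mod_cast this
    set κ := β ^ (-(2 * q : ℝ)) with hκ
    have hKκ : K j ^ 64 ≤ κ := by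
      have : K j ^ 64 = b ^ 64 ^ (6 * j + 1) := by
        simp only [hK]; rw [← pow_mul, ← pow_succ]
      rw [this]
      refine hb81.trans (Real.rpow_le_rpow_of_exponent_ge hβ0 hβ1.le ?_)
      linarith
    have hbκ : b ≤ κ := (hbK j).trans ((by
      simpa using self_le_pow (hb1.trans (hbK j)) (show 1 ≤ 64 by norm_num) :
        K j ≤ K j ^ 64).trans hKκ)
    set c := Real.sqrt β with hc
    have hc0 : 0 < c := Real.sqrt_pos.2 hβ0
    have hcc : c * c = β := Real.mul_self_sqrt hβ0.le
    have hc9 : c ≤ 1 / 9 := by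
      rw [hc, Real.sqrt_le_left (by norm_num)]; linarith
    have hc1 : c ≤ 1 := by linarith
    have hstart : ∀ t ∈ Set.Icc (0 : ℝ) 1, ∃ p ∈ S (κ ^ 64), |t - p| ≤ c ^ m / 3 := by
      intro t ht
      obtain ⟨p, hp, hpt⟩ := hd t ht
      obtain ⟨a, ha, b', hb', d, hd, e, he, hde, rfl⟩ := hp
      refine ⟨_, hS.div_mem κ hbκ _ (hS.mem_mono hKκ (hS.sub_mem _ (hbK j) _ ha.1 _ hb'.1)) _
        (hS.mem_mono hKκ (hS.sub_mem _ (hbK j) _ hd.1 _ he.1)) ?_, hpt.trans ?_⟩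
      · refine le_trans (le_of_eq ?_) hde
        rw [hκ, ← Real.rpow_neg hβ0.le, neg_neg, ← Real.rpow_natCast]
        push_cast; rfl
      · have h9 : c ^ m ≤ 1 / 9 := (pow_le_pow_of_le_one hc0.le hc1 hm1).trans (by simpa using hc9)
        rw [← hcc, mul_pow]
        have := mul_le_mul_of_nonneg_left h9 (pow_pos hc0 m).le
        linarith
    have hκ64 : κ ≤ κ ^ 64 := by
      simpa using self_le_pow (hb1.trans hbκ) (show 1 ≤ 64 by norm_num)
    intro t ht
    obtain ⟨p, hp, hpt⟩ := hS.dense_iterate hb1 (pow_pos hc0 m) (pow_le_one₀ hc0.le hc1) D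
      (hbκ.trans hκ64) hstart t ht
    refine ⟨p, hS.mem_mono ?_ hp, hpt.trans ?_⟩
    · rw [← pow_mul, hκ, ← Real.rpow_natCast, ← Real.rpow_mul hβ0.le]
      refine Real.rpow_le_rpow_of_exponent_ge hβ0 hβ1.le ?_
      push_cast [hN] at hD2 ⊢
      linarith
    · have h3 : 2 * N ≤ m * 2 ^ D := by
        have : ((2 * N : ℕ) : ℝ) ≤ ((m * 2 ^ D : ℕ) : ℝ) := by
          push_cast [hN]
          push_cast [hε] at hD1
          calc 2 * (2 * (k 0 : ℝ)) ≤ 2 * (2 ^ D * (γ / 64 * (2 * k l))) := by linarith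
            _ = (γ * k l / 16) * 2 ^ D := by ring
            _ ≤ _ := by gcongr
        exact_mod_cast this
      calc (c ^ m) ^ 2 ^ D / 3 ≤ (c ^ m) ^ 2 ^ D := by
            have : 0 < (c ^ m) ^ 2 ^ D := by positivity
            linarith
        _ = c ^ (m * 2 ^ D) := by rw [← pow_mul]
        _ ≤ c ^ (2 * N) := pow_le_pow_of_le_one hc0.le hc1 h3
        _ = β ^ N := by rw [pow_mul, sq, hcc]
  · exfalso
    have hMN : M ≤ N := by have := hklN l hlL.le; omega
    have hqpos : 0 < q := hk1 (l + 1) hlL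
    set lam := u j (2 * q) / (2 * q) + γ / 2 - 2 * ε with hlam
    have hq2 : 0 ≤ u j (2 * q) / (2 * q) := div_nonneg (hu0 _ _) (by positivity)
    have hqN : 2 * q ≤ N := by have := hklN (l + 1) hlL; omega
    have hlam0 : 0 ≤ lam := by rw [hlam, hε]; linarith
    have hmul : u j (2 * q) / (2 * q) * (2 * q) = u j (2 * q) := by field_simp
    have hlow2 := hulow (2 * q) hqN
    have hlow1 := hulow q (by omega)
    push_cast at hlow2
    have hlogs : ∀ x y z : ℕ, 1 ≤ x → 1 ≤ y → 1 ≤ z → x * y ≤ 2176 * z →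
        Real.log x / ℓ + Real.log y / ℓ ≤ ε + Real.log z / ℓ := by
      intro x y z hx hy hz h
      have hx' : (0 : ℝ) < x := by exact_mod_cast hx
      have hy' : (0 : ℝ) < y := by exact_mod_cast hy
      have hz' : (0 : ℝ) < z := by exact_mod_cast hz
      rw [← add_div, div_le_iff₀ hℓ0, add_mul, div_mul_cancel₀ _ hℓ0.ne', ← Real.log_mul hx'.ne' hy'.ne']
      have h1 : Real.log (x * y) ≤ Real.log (2176 * z) :=
        Real.log_le_log (by positivity) (by exact_mod_cast h)
      rw [Real.log_mul (by norm_num) hz'.ne'] at h1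
      have h2 : Real.log 2176 ≤ 8 := by
        rw [Real.log_le_iff_le_exp (by norm_num)]; exact nat_le_exp_eight
      linarith
    have hstep : ∀ n, n₀ < n → n ≤ M → u j (n - q) + lam * q ≤ u j n ∨
        u j (n - 2 * q) + lam * (2 * q) ≤ u j n := by
      intro n hn hnM
      have hnb := hbig n hn
      have h4n : 2 * (2 * q) < n := by
        have : ((2 * (2 * q) : ℕ) : ℝ) < n := by push_cast; nlinarith
        exact_mod_cast this
      have hup := hj n (by omega)
      rcases hS.dense_or_growth hb1 (hbK j) hβ0 (by linarith) h4n with h | h | h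
      · exact absurd ⟨n, hn, hnM, h⟩ hdense
      · left
        rw [← hKsucc] at h
        have h1 := hlogs _ _ _ (hcov1 j _) (hcov1 j _) (hcov1 (j + 1) n) h
        change u j (n - q) + u j (2 * q) ≤ ε + u (j + 1) n at h1
        have : lam * q ≤ u j (2 * q) - 2 * ε := by
          rw [hlam]; nlinarith
        linarith
      · right
        rw [← hKsucc] at h
        have h1 := hlogs _ _ _ (Nat.mul_pos (hcov1 j _) (hcov1 j _)) (hcov1 j q)
          (hcov1 (j + 1) n) h
        have h2 : Real.log ((cov (β ^ (n - 2 * q)) (S (K j)) * cov (β ^ (2 * q)) (S (K j)) : ℕ) : ℝ)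
            / ℓ = u j (n - 2 * q) + u j (2 * q) := by
          simp only [hu]
          rw [← add_div, ← Real.log_mul (hcovpos j _).ne' (hcovpos j _).ne']
          push_cast; rfl
        rw [h2] at h1
        change u j (n - 2 * q) + u j (2 * q) + u j q ≤ ε + u (j + 1) n at h1
        have : lam * (2 * q) ≤ u j (2 * q) + u j q - 2 * ε := by
          rw [hlam]; nlinarith
        linarith
    have hfin := slope_of_step hqpos hqn hlam0 (hu0 j) hstep M le_rfl
    have hMR : (M : ℝ) = 2 * k l := by rw [hM]; push_cast; ring
    have hlam2 : lam ≤ 2 := by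
      have h1 : u j (2 * q) / (2 * q) ≤ 3 / 2 := by
        rw [div_le_iff₀ (by positivity)]
        have := hule j (2 * q)
        push_cast at this
        linarith
      rw [hlam]; linarith
    rw [div_lt_iff₀ (by positivity)] at hl
    rw [hMR] at hfin
    nlinarith

end Density

section Projections
open Finset
open scoped Pointwise

theorem card_sq_le_card_mul_card_collisions {α β : Type*} [DecidableEq α] [DecidableEq β]
    (s : Finset α) (t : Finset β) (f : α → β) (hf : ∀ a ∈ s, f a ∈ t) :
    #s ^ 2 ≤ #t * #{p ∈ s ×ˢ s | f p.1 = f p.2} := by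
  have h1 : #s = ∑ b ∈ t, #{a ∈ s | f a = b} := card_eq_sum_card_fiberwise hf
  have h2 : #{p ∈ s ×ˢ s | f p.1 = f p.2} = ∑ b ∈ t, #{a ∈ s | f a = b} ^ 2 := by
    rw [card_eq_sum_card_fiberwise (f := fun p => f p.1) (t := t)]
    · refine sum_congr rfl fun b _ => ?_
      rw [sq, ← card_product]
      congr 1
      ext ⟨x, y⟩
      simp only [mem_filter, mem_product]
      constructor
      · rintro ⟨⟨⟨hx, hy⟩, h⟩, h'⟩
        exact ⟨⟨hx, h'⟩, hy, h.symm.trans h'⟩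
      · rintro ⟨⟨hx, h⟩, hy, h'⟩
        exact ⟨⟨⟨hx, hy⟩, h.trans h'.symm⟩, h⟩
    · intro p hp
      simp only [coe_filter, mem_product, Set.mem_ofPred_eq] at hp
      exact hf _ hp.1.1
  rw [h2, h1]
  exact sq_sum_le_card_mul_sum_sq

theorem card_range_filter_le {a c : ℝ} (hc : 0 ≤ c) (s : Finset ℕ)
    (hs : ∀ i ∈ s, |(i : ℝ) - a| ≤ c) : (#s : ℝ) ≤ 2 * c + 1 := by
  have h1 : s.map Nat.castEmbedding ⊆ Icc ⌈a - c⌉ ⌊a + c⌋ := by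
    intro z hz
    obtain ⟨i, hi, rfl⟩ := mem_map.1 hz
    have := abs_le.1 (hs i hi)
    simp only [Nat.castEmbedding_apply, mem_Icc, Int.ceil_le, Int.le_floor, Int.cast_natCast]
    constructor <;> linarith
  have h2 := card_le_card h1
  rw [card_map, Int.card_Icc] at h2
  have h3 : (#s : ℝ) ≤ ((⌊a + c⌋ + 1 - ⌈a - c⌉).toNat : ℝ) := by exact_mod_cast h2
  refine h3.trans ?_
  rcases le_total (⌊a + c⌋ + 1 - ⌈a - c⌉) 0 with h | h
  · rw [Int.toNat_of_nonpos h]; push_cast; linarith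
  · have h4 : ((⌊a + c⌋ + 1 - ⌈a - c⌉).toNat : ℝ) = ((⌊a + c⌋ + 1 - ⌈a - c⌉ : ℤ) : ℝ) := by
      exact_mod_cast Int.toNat_of_nonneg h
    rw [h4]
    push_cast
    have := Int.floor_le (a + c)
    have := Int.le_ceil (a - c)
    linarith

/-- A set of integers that is non-concentrated at large scales has a large sum with one of its
dilates. -/
theorem card_le_of_card_add_dil_le {B : Finset ℤ} (hB : B.Nonempty) {M : ℕ} (hM : 1 ≤ M)
    (hBM : ∀ b ∈ B, |(b : ℝ)| ≤ M) {A D₀ K : ℝ} (hD₀ : 1 ≤ D₀) (hA : 0 ≤ A)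
    (hconc : ∀ x : ℤ, ∀ D, D₀ ≤ D → (#{b ∈ B | |((b : ℤ) : ℝ) - x| ≤ D} : ℝ) ≤ A * D)
    (hK : ∀ t ∈ Set.Icc (0 : ℝ) 1, (#(B + dil t B) : ℝ) ≤ K * #B) :
    (#B : ℝ) ≤ K * (A * (D₀ + 8 * #B)) := by
  have hM0 : (0 : ℝ) < M := by exact_mod_cast hM
  have hn0 : (0 : ℝ) < #B := by exact_mod_cast hB.card_pos
  set τ : ℕ → ℝ := fun i => i / M with hτ
  have hτmem : ∀ i ∈ range (M + 1), τ i ∈ Set.Icc (0 : ℝ) 1 := by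
    intro i hi
    have : (i : ℝ) ≤ M := by exact_mod_cast Nat.lt_succ_iff.1 (mem_range.1 hi)
    exact ⟨by positivity, (div_le_one hM0).2 this⟩
  have hK0 : 0 < K := by
    have h1 := hK 0 ⟨le_rfl, zero_le_one⟩
    have h2 : (0 : ℝ) < #(B + dil 0 B) := by
      exact_mod_cast (hB.add (hB.image _)).card_pos
    exact pos_of_mul_pos_left (h2.trans_le h1) hn0.le
  set E : ℕ → Finset ((ℤ × ℤ) × ℤ × ℤ) := fun i =>
    {p ∈ (B ×ˢ B) ×ˢ (B ×ˢ B) | p.1.1 + ⌊τ i * p.1.2⌋ = p.2.1 + ⌊τ i * p.2.2⌋} with hE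
  have hlow : ∀ i ∈ range (M + 1), (#B : ℝ) ^ 3 ≤ K * #(E i) := by
    intro i hi
    have h1 := card_sq_le_card_mul_card_collisions (B ×ˢ B) (B + dil (τ i) B)
      (fun p => p.1 + ⌊τ i * p.2⌋) (fun p hp => by
        rw [mem_product] at hp
        exact add_mem_add hp.1 (mem_image_of_mem _ hp.2))
    rw [card_product] at h1
    have h2 : ((#B : ℝ) * #B) ^ 2 ≤ #(B + dil (τ i) B) * #(E i) := by exact_mod_cast h1
    have h3 := mul_le_mul_of_nonneg_right (hK _ (hτmem i hi)) (Nat.cast_nonneg (α := ℝ) #(E i))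
    have h4 : (#B : ℝ) * #B ^ 3 ≤ #B * (K * #(E i)) := by
      calc _ = ((#B : ℝ) * #B) ^ 2 := by ring
        _ ≤ _ := h2.trans h3
        _ = _ := by ring
    exact le_of_mul_le_mul_left h4 hn0
  set F : ℤ → ℤ → Finset (ℕ × ℤ × ℤ) := fun x y =>
    {q ∈ range (M + 1) ×ˢ (B ×ˢ B) | q.2.1 + ⌊τ q.1 * x⌋ = q.2.2 + ⌊τ q.1 * y⌋} with hF
  have hswap : ∑ i ∈ range (M + 1), #(E i) = ∑ x ∈ B, ∑ y ∈ B, #(F x y) := by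
    simp only [hE, hF, card_filter, sum_product]
    rw [sum_congr rfl fun i _ => sum_comm]
    rw [sum_comm]
    refine sum_congr rfl fun x _ => ?_
    rw [sum_congr rfl fun i _ => sum_congr rfl fun b _ => sum_comm]
    rw [sum_congr rfl fun i _ => sum_comm]
    rw [sum_comm]
  have hnear : ∀ x y, (#(F x y) : ℝ) ≤ (M + 1) * #B := by
    intro x y
    have : #(F x y) ≤ #(range (M + 1) ×ˢ B) := by
      refine card_le_card_of_injOn (fun q => (q.1, q.2.2)) ?_ ?_
      · intro q hq
        simp only [hF, coe_filter, mem_product, Set.mem_ofPred_eq] at hq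
        simpa using ⟨by simpa using hq.1.1, hq.1.2.2⟩
      · rintro ⟨i, a, b⟩ h1 ⟨i', a', b'⟩ h2 h
        simp only [hF, coe_filter, mem_product, Set.mem_ofPred_eq, Prod.mk.injEq] at h1 h2 h ⊢
        obtain ⟨rfl, rfl⟩ := h
        exact ⟨rfl, by omega, rfl⟩
    rw [card_product, card_range] at this
    exact_mod_cast this
  have hfar : ∀ x ∈ B, ∀ y ∈ B, D₀ ≤ |(y : ℝ) - x| → (#(F x y) : ℝ) ≤ 8 * A * M * #B := by
    intro x hx y hy hD
    set D := |(y : ℝ) - x| with hDdef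
    have hD0 : 0 < D := by linarith
    have hD2M : D ≤ 2 * M := by
      have := abs_sub (y : ℝ) x
      linarith [hBM x hx, hBM y hy]
    have hfl : ∀ q ∈ F x y, |((q.2.1 : ℝ) - q.2.2) - τ q.1 * (y - x)| ≤ 1 := by
      rintro ⟨i, a, b⟩ hq
      simp only [hF, mem_filter] at hq
      have h1 : (a : ℝ) + ⌊τ i * x⌋ = b + ⌊τ i * y⌋ := by exact_mod_cast hq.2
      have h2 := Int.floor_le (τ i * x)
      have h3 := Int.lt_floor_add_one (τ i * x)
      have h4 := Int.floor_le (τ i * y)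
      have h5 := Int.lt_floor_add_one (τ i * y)
      rw [abs_le]
      constructor <;> simp only <;> linarith
    set G : Finset (ℤ × ℤ) := {p ∈ B ×ˢ B | |(p.1 : ℝ) - p.2| ≤ 2 * D} with hG
    have hGcard : (#G : ℝ) ≤ #B * (A * (2 * D)) := by
      have h1 : #G = ∑ b ∈ B, #{p ∈ G | p.2 = b} := card_eq_sum_card_fiberwise (fun p hp => by
        simp only [hG, coe_filter, mem_product, Set.mem_ofPred_eq] at hp
        exact hp.1.2)
      rw [h1]
      push_cast
      rw [← nsmul_eq_mul]
      refine sum_le_card_nsmul _ _ _ fun b _ => ?_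
      refine le_trans ?_ (hconc b (2 * D) (by linarith))
      have : #{p ∈ G | p.2 = b} ≤ #{a ∈ B | |((a : ℤ) : ℝ) - b| ≤ 2 * D} := by
        refine card_le_card_of_injOn (fun p => p.1) ?_ ?_
        · rintro ⟨a, b'⟩ hp
          simp only [hG, coe_filter, mem_filter, mem_product, Set.mem_ofPred_eq] at hp ⊢
          obtain ⟨⟨⟨h1, h2⟩, h3⟩, rfl⟩ := hp
          exact ⟨h1, h3⟩
        · rintro ⟨a, b'⟩ hp ⟨a', b''⟩ hp' h
          simp only [coe_filter, Set.mem_ofPred_eq] at hp hp' h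
          rw [Prod.mk.injEq]
          exact ⟨h, hp.2.trans hp'.2.symm⟩
      exact_mod_cast this
    have h1 : #(F x y) = ∑ p ∈ G, #{q ∈ F x y | q.2 = p} := card_eq_sum_card_fiberwise (by
      intro q hq
      have h1 := abs_le.1 (hfl q hq)
      simp only [hF, coe_filter, mem_product, Set.mem_ofPred_eq] at hq
      simp only [hG, coe_filter, mem_product, Set.mem_ofPred_eq]
      refine ⟨hq.1.2, ?_⟩
      have h2 : |τ q.1 * ((y : ℝ) - x)| ≤ D := by
        rw [abs_mul, abs_of_nonneg (hτmem _ hq.1.1).1]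
        exact mul_le_of_le_one_left hD0.le (hτmem _ hq.1.1).2
      have h3 := abs_le.1 h2
      rw [abs_le]
      constructor <;> linarith)
    have h2 : ∀ p ∈ G, (#{q ∈ F x y | q.2 = p} : ℝ) ≤ 4 * M / D := by
      intro p _
      have h3 : #{q ∈ F x y | q.2 = p} = #(({q ∈ F x y | q.2 = p}).image Prod.fst) := by
        rw [card_image_of_injOn]
        rintro ⟨i, q⟩ hq ⟨i', q'⟩ hq' h
        simp only [coe_filter, Set.mem_ofPred_eq] at hq hq' h
        rw [Prod.mk.injEq]
        exact ⟨h, hq.2.trans hq'.2.symm⟩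
      rw [h3]
      have hyx : (y : ℝ) - x ≠ 0 := abs_pos.1 hD0
      refine (card_range_filter_le (a := ((p.1 : ℝ) - p.2) * M / (y - x)) (c := M / D)
        (by positivity) _ ?_).trans ?_
      · intro i hi
        obtain ⟨q, hq, rfl⟩ := mem_image.1 hi
        obtain ⟨hqF, rfl⟩ := mem_filter.1 hq
        have h4 := hfl q hqF
        have h5 : (q.1 : ℝ) - ((q.2.1 : ℝ) - q.2.2) * M / (y - x) =
            -(((q.2.1 : ℝ) - q.2.2) - τ q.1 * (y - x)) * (M / (y - x)) := by
          simp only [hτ]; field_simp; ring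
        rw [h5, abs_mul, abs_neg, abs_div, abs_of_pos hM0]
        exact mul_le_of_le_one_left (by positivity) h4
      · have : 1 ≤ 2 * M / D := (one_le_div hD0).2 hD2M
        calc 2 * (M / D) + 1 ≤ 2 * (M / D) + 2 * M / D := by linarith
          _ = _ := by ring
    rw [h1]
    push_cast
    calc ∑ p ∈ G, (#{q ∈ F x y | q.2 = p} : ℝ) ≤ #G • (4 * M / D) := sum_le_card_nsmul _ _ _ h2
      _ = #G * (4 * M / D) := nsmul_eq_mul _ _
      _ ≤ #B * (A * (2 * D)) * (4 * M / D) := by gcongr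
      _ = _ := by field_simp; ring
  have hpair : ∀ x ∈ B, ∑ y ∈ B, (#(F x y) : ℝ) ≤
      A * D₀ * ((M + 1) * #B) + #B * (8 * A * M * #B) := by
    intro x hx
    rw [← sum_filter_add_sum_filter_not B (fun y : ℤ => |(y : ℝ) - x| ≤ D₀)]
    refine add_le_add ?_ ?_
    · refine (sum_le_card_nsmul _ _ _ fun y _ => hnear x y).trans ?_
      rw [nsmul_eq_mul]
      gcongr
      exact hconc x D₀ le_rfl
    · refine (sum_le_card_nsmul _ _ (8 * A * M * #B) fun y hy => ?_).trans ?_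
      · rw [mem_filter, not_le] at hy
        exact hfar x hx y hy.1 hy.2.le
      · rw [nsmul_eq_mul]
        gcongr
        exact filter_subset _ _
  have htot : (∑ i ∈ range (M + 1), #(E i) : ℝ) ≤
      #B * (A * D₀ * ((M + 1) * #B) + #B * (8 * A * M * #B)) := by
    have : (∑ i ∈ range (M + 1), #(E i) : ℝ) = ∑ x ∈ B, ∑ y ∈ B, (#(F x y) : ℝ) := by
      exact_mod_cast hswap
    rw [this, ← nsmul_eq_mul]
    exact sum_le_card_nsmul _ _ _ hpair
  have hsum : ((M : ℝ) + 1) * (#B : ℝ) ^ 3 ≤ K * ∑ i ∈ range (M + 1), (#(E i) : ℝ) := by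
    rw [mul_sum]
    have := card_nsmul_le_sum _ _ _ hlow
    rw [card_range, nsmul_eq_mul] at this
    exact_mod_cast this
  have h1 : ((M : ℝ) + 1) * #B ^ 2 * #B ≤ ((M : ℝ) + 1) * #B ^ 2 * (K * (A * (D₀ + 8 * #B))) := by
    calc _ = ((M : ℝ) + 1) * (#B : ℝ) ^ 3 := by ring
      _ ≤ K * (#B * (A * D₀ * ((M + 1) * #B) + #B * (8 * A * M * #B))) :=
          hsum.trans (by gcongr)
      _ ≤ K * (#B * (A * D₀ * ((M + 1) * #B) + #B * (8 * A * (M + 1) * #B))) := by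
          gcongr; linarith
      _ = _ := by ring
  exact le_of_mul_le_mul_left h1 (by positivity)

end Projections

section DependentRandomChoice
open Finset

theorem pow_sum_mul_le {α : Type*} (V : Finset α) {p d : α → ℝ} (hp : ∀ a ∈ V, 0 ≤ p a)
    (hp1 : ∑ a ∈ V, p a ≤ 1) (hd : ∀ a ∈ V, 0 ≤ d a) {T : ℕ} (hT : T ≠ 0) :
    (∑ a ∈ V, p a * d a) ^ T ≤ ∑ a ∈ V, p a * d a ^ T := by
  set S := ∑ a ∈ V, p a with hS
  rcases (sum_nonneg hp).eq_or_lt with h0 | h0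
  · have hz : ∀ a ∈ V, p a = 0 := (sum_eq_zero_iff_of_nonneg hp).1 h0.symm
    rw [sum_congr rfl fun a ha => by rw [hz a ha, zero_mul], sum_const_zero, zero_pow hT]
    exact sum_nonneg fun a ha => mul_nonneg (hp a ha) (pow_nonneg (hd a ha) T)
  · have h1 := Real.pow_arith_mean_le_arith_mean_pow V (fun a => p a / S) d
      (fun a ha => div_nonneg (hp a ha) h0.le) (by rw [← sum_div]; exact div_self h0.ne') hd T
    have h2 : ∀ e : α → ℝ, ∑ a ∈ V, p a / S * e a = (∑ a ∈ V, p a * e a) / S := fun e => by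
      rw [sum_div]; exact sum_congr rfl fun a _ => by ring
    rw [h2, h2, div_pow, div_le_div_iff₀ (by positivity) h0] at h1
    have h3 : 0 ≤ ∑ a ∈ V, p a * d a ^ T :=
      sum_nonneg fun a ha => mul_nonneg (hp a ha) (pow_nonneg (hd a ha) T)
    have h4 : S ^ T ≤ S := by
      simpa using pow_le_pow_of_le_one h0.le hp1 (Nat.one_le_iff_ne_zero.2 hT)
    refine le_of_mul_le_mul_right (h1.trans ?_) h0
    gcongr

/-- **Dependent random choice** for weighted graphs. -/
theorem exists_common_neighbours {α : Type*} [DecidableEq α] (V : Finset α) (p : α → ℝ)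
    (r : α → α → Prop) [∀ a b, Decidable (r a b)] {ε ω : ℝ} {T : ℕ} (hT : T ≠ 0)
    (hp : ∀ a ∈ V, 0 ≤ p a) (hp1 : ∑ a ∈ V, p a ≤ 1) (hε : 0 < ε) (hω : 0 ≤ ω)
    (hdens : ε ≤ ∑ b ∈ V, p b * ∑ a ∈ V with r a b, p a)
    (hV : (#V : ℝ) ^ 2 * ω ^ T ≤ ε ^ T / 2) :
    ∃ t ∈ V, ∃ B ⊆ V, (∀ b ∈ B, r t b) ∧ ε ^ T / 2 ≤ ∑ b ∈ B, p b ∧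
      ∀ b₁ ∈ B, ∀ b₂ ∈ B, ω ≤ ∑ a ∈ V with r a b₁ ∧ r a b₂, p a := by
  set W : Finset (Fin T → α) := Fintype.piFinset fun _ => V with hW
  set w : (Fin T → α) → ℝ := fun τ => ∏ i, p (τ i) with hw
  have hpow : ∀ q : α → Prop, [DecidablePred q] →
      ∑ τ ∈ W with ∀ i, q (τ i), w τ = (∑ a ∈ V with q a, p a) ^ T := by
    intro q _
    have h1 : ({τ ∈ W | ∀ i, q (τ i)} : Finset (Fin T → α)) =
        Fintype.piFinset fun _ => {a ∈ V | q a} := by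
      ext τ
      simp only [hW, mem_filter, Fintype.mem_piFinset, forall_and]
    rw [h1, ← Fin.prod_const, prod_univ_sum]
  have hw0 : ∀ τ ∈ W, 0 ≤ w τ := fun τ hτ =>
    prod_nonneg fun i _ => hp _ (Fintype.mem_piFinset.1 hτ i)
  have hw1 : ∑ τ ∈ W, w τ ≤ 1 := by
    have := hpow (fun _ => True)
    simp only [implies_true, filter_true] at this
    rw [this]
    exact pow_le_one₀ (sum_nonneg hp) hp1
  set B : (Fin T → α) → Finset α := fun τ => {b ∈ V | ∀ i, r (τ i) b} with hB
  set bad : Finset (α × α) :=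
    {x ∈ V ×ˢ V | ∑ a ∈ V with r a x.1 ∧ r a x.2, p a < ω} with hbad
  set bd : (Fin T → α) → Finset (α × α) :=
    fun τ => {x ∈ bad | ∀ i, r (τ i) x.1 ∧ r (τ i) x.2} with hbd
  have hmain : ε ^ T ≤ ∑ τ ∈ W, w τ * ∑ b ∈ B τ, p b := by
    calc ε ^ T ≤ (∑ b ∈ V, p b * ∑ a ∈ V with r a b, p a) ^ T := by gcongr
      _ ≤ ∑ b ∈ V, p b * (∑ a ∈ V with r a b, p a) ^ T :=
        pow_sum_mul_le V hp hp1 (fun b _ => sum_nonneg fun a ha => hp a (mem_filter.1 ha).1) hT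
      _ = ∑ b ∈ V, ∑ τ ∈ W, if ∀ i, r (τ i) b then w τ * p b else 0 := by
        refine sum_congr rfl fun b _ => ?_
        rw [← hpow (fun a => r a b), mul_sum, sum_filter]
        refine sum_congr rfl fun τ _ => ?_
        split_ifs <;> ring
      _ = _ := by
        rw [sum_comm]
        refine sum_congr rfl fun τ _ => ?_
        rw [mul_sum, sum_filter]
  have hbadsum : ∑ τ ∈ W, w τ * #(bd τ) ≤ ε ^ T / 2 := by
    calc ∑ τ ∈ W, w τ * #(bd τ) =
        ∑ x ∈ bad, ∑ τ ∈ W with ∀ i, r (τ i) x.1 ∧ r (τ i) x.2, w τ := by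
          simp only [sum_filter]
          rw [sum_comm]
          refine sum_congr rfl fun τ _ => ?_
          rw [← sum_filter, sum_const, nsmul_eq_mul, mul_comm]
      _ = ∑ x ∈ bad, (∑ a ∈ V with r a x.1 ∧ r a x.2, p a) ^ T :=
          sum_congr rfl fun x _ => hpow (fun a => r a x.1 ∧ r a x.2)
      _ ≤ ∑ _x ∈ bad, ω ^ T := by
          refine sum_le_sum fun x hx => ?_
          have h1 : 0 ≤ ∑ a ∈ V with r a x.1 ∧ r a x.2, p a :=
            sum_nonneg fun a ha => hp a (mem_filter.1 ha).1
          have h2 := (mem_filter.1 hx).2.le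
          gcongr
      _ ≤ (#V : ℝ) ^ 2 * ω ^ T := by
          rw [sum_const, nsmul_eq_mul]
          have : #bad ≤ #V ^ 2 := by
            rw [sq, ← card_product]; exact card_filter_le _ _
          gcongr
          exact_mod_cast this
      _ ≤ _ := hV
  obtain ⟨τ, hτ, hτ2⟩ : ∃ τ ∈ W, ε ^ T / 2 ≤ ∑ b ∈ B τ, p b - #(bd τ) := by
    by_contra! hcon
    have h1 : ∑ τ ∈ W, w τ * (∑ b ∈ B τ, p b - #(bd τ)) < ∑ τ ∈ W, w τ * (ε ^ T / 2) := by
      obtain ⟨τ, hτ, hτ0⟩ : ∃ τ ∈ W, 0 < w τ := by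
        by_contra! h
        have h1 : ∑ τ ∈ W, w τ * ∑ b ∈ B τ, p b ≤ 0 := sum_nonpos fun τ hτ =>
          mul_nonpos_of_nonpos_of_nonneg (h τ hτ) (sum_nonneg fun b hb => hp b (mem_filter.1 hb).1)
        linarith [pow_pos hε T]
      refine sum_lt_sum (fun τ hτ => mul_le_mul_of_nonneg_left (hcon τ hτ).le (hw0 τ hτ))
        ⟨τ, hτ, mul_lt_mul_of_pos_left (hcon τ hτ) hτ0⟩
    simp only [mul_sub, sum_sub_distrib] at h1
    rw [← sum_mul] at h1
    have h2 := mul_le_of_le_one_left (show 0 ≤ ε ^ T / 2 by positivity) hw1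
    linarith
  have hε' : 0 < ε ^ T / 2 := by positivity
  have hBV : B τ ⊆ V := filter_subset _ _
  have hle : ∑ b ∈ B τ, p b ≤ 1 := 
    (sum_le_sum_of_subset_of_nonneg hBV fun a ha _ => hp a ha).trans hp1
  have hbd0 : bd τ = ∅ := by
    by_contra h
    have : (1 : ℝ) ≤ #(bd τ) := by exact_mod_cast (nonempty_iff_ne_empty.2 h).card_pos
    linarith
  refine ⟨τ ⟨0, Nat.pos_of_ne_zero hT⟩, Fintype.mem_piFinset.1 hτ _, B τ, hBV,
    fun b hb => (mem_filter.1 hb).2 _, ?_, fun b₁ h₁ b₂ h₂ => ?_⟩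
  · rw [hbd0, card_empty] at hτ2
    push_cast at hτ2
    linarith
  · by_contra! h
    obtain ⟨h₁, h₁'⟩ := mem_filter.1 h₁
    obtain ⟨h₂, h₂'⟩ := mem_filter.1 h₂
    have : (b₁, b₂) ∈ bd τ := by
      simp only [hbd, hbad, mem_filter, mem_product]
      exact ⟨⟨⟨h₁, h₂⟩, h⟩, fun i => ⟨h₁' i, h₂' i⟩⟩
    rw [hbd0] at this
    exact notMem_empty _ this

end DependentRandomChoice

section PositiveSpectrum
open ProbabilityTheory

/-- `φ` is the Fourier transform of the sub-probability measure `ν`, and it is nonnegative. -/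
structure PosSpectrum (ν : Measure ℝ) (φ : ℝ → ℝ) : Prop where
  mass_le : ν Set.univ ≤ 1
  charFun_eq : ∀ ζ, charFun ν ζ = φ ζ
  nonneg : ∀ ζ, 0 ≤ φ ζ

/-- Gaussian smoothing at frequency `D` of the measure `ν`. -/
noncomputable def gaussAvg (ν : Measure ℝ) (D : ℝ) : ℝ := ∫ q, Real.exp (-(D * q) ^ 2 / 2) ∂ν

theorem sq_integral_le_mul_integral_sq {α : Type*} [MeasurableSpace α] {ν : Measure α}
    [IsFiniteMeasure ν] {z : ℝ} (hz : 0 < z) (hν : ν.real Set.univ ≤ z) {f : α → ℝ}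
    (hf : Integrable f ν) (hf2 : Integrable (fun a => f a ^ 2) ν) :
    (∫ a, f a ∂ν) ^ 2 ≤ z * ∫ a, f a ^ 2 ∂ν := by
  set I := ∫ a, f a ∂ν with hI
  have h1 : 0 ≤ ∫ a, (f a - I / z) ^ 2 ∂ν := integral_nonneg fun a => sq_nonneg _
  have h2 : ∫ a, (f a - I / z) ^ 2 ∂ν =
      ∫ a, f a ^ 2 ∂ν - 2 * (I / z) * I + ν.real Set.univ * (I / z) ^ 2 := by
    have : ∀ a, (f a - I / z) ^ 2 = f a ^ 2 - 2 * (I / z) * f a + (I / z) ^ 2 := fun a => by ring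
    simp only [this]
    have h3 : Integrable (fun a => f a ^ 2 - 2 * (I / z) * f a) ν := hf2.sub (hf.const_mul _)
    rw [integral_add h3 (integrable_const _),
      integral_sub hf2 (hf.const_mul _), integral_const_mul, integral_const, smul_eq_mul]
  have h3 : ν.real Set.univ * (I / z) ^ 2 ≤ z * (I / z) ^ 2 := by gcongr
  have h4 : I ^ 2 / z ≤ ∫ a, f a ^ 2 ∂ν := by
    have e1 : 2 * (I / z) * I = 2 * (I ^ 2 / z) := by ring
    have e2 : z * (I / z) ^ 2 = I ^ 2 / z := by field_simp
    linarith
  rw [div_le_iff₀ hz] at h4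
  linarith

theorem integrable_of_abs_le {α : Type*} [MeasurableSpace α] {ν : Measure α} [IsFiniteMeasure ν]
    {f : α → ℝ} (hf : Measurable f) (C : ℝ) (h : ∀ a, |f a| ≤ C) : Integrable f ν :=
  Integrable.of_bound hf.aestronglyMeasurable C (Filter.Eventually.of_forall h)

variable {ν : Measure ℝ} {φ : ℝ → ℝ}

namespace PosSpectrum

theorem isFiniteMeasure (h : PosSpectrum ν φ) : IsFiniteMeasure ν :=
  ⟨h.mass_le.trans_lt ENNReal.one_lt_top⟩

theorem real_univ_le (h : PosSpectrum ν φ) : ν.real Set.univ ≤ 1 :=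
  ENNReal.toReal_le_of_le_ofReal zero_le_one (by simpa using h.mass_le)

theorem le_one (h : PosSpectrum ν φ) (ζ : ℝ) : φ ζ ≤ 1 := by
  have h1 := norm_charFun_le (μ := ν) ζ
  rw [h.charFun_eq, Complex.norm_real, Real.norm_eq_abs] at h1
  exact (le_abs_self _).trans (h1.trans h.real_univ_le)

theorem abs_le_one (h : PosSpectrum ν φ) (ζ : ℝ) : |φ ζ| ≤ 1 := by
  rw [abs_of_nonneg (h.nonneg ζ)]
  exact h.le_one ζ

theorem integrable_exp (h : PosSpectrum ν φ) (ζ : ℝ) :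
    Integrable (fun x : ℝ => Complex.exp (ζ * x * Complex.I)) ν := by
  have := h.isFiniteMeasure
  refine Integrable.of_bound (by fun_prop) 1 (Filter.Eventually.of_forall fun x => ?_)
  rw [← Complex.ofReal_mul, Complex.norm_exp_ofReal_mul_I]

theorem eq_integral_cos (h : PosSpectrum ν φ) (ζ : ℝ) : φ ζ = ∫ q, Real.cos (ζ * q) ∂ν := by
  have h1 := congrArg RCLike.re (h.charFun_eq ζ)
  rw [charFun_apply_real, ← integral_re (h.integrable_exp ζ)] at h1
  refine Eq.trans ?_ (h1.symm.trans (integral_congr_ae (Filter.Eventually.of_forall fun x => ?_)))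
  · simp
  · simp only [RCLike.re_eq_complex_re]
    rw [← Complex.ofReal_mul, Complex.exp_ofReal_mul_I_re]

theorem integral_sin (h : PosSpectrum ν φ) (ζ : ℝ) : ∫ q, Real.sin (ζ * q) ∂ν = 0 := by
  have h1 := congrArg RCLike.im (h.charFun_eq ζ)
  rw [charFun_apply_real, ← integral_im (h.integrable_exp ζ)] at h1
  refine Eq.trans (integral_congr_ae (Filter.Eventually.of_forall fun x => ?_)) (h1.trans ?_)
  · simp only [RCLike.im_eq_complex_im]
    rw [← Complex.ofReal_mul, Complex.exp_ofReal_mul_I_im]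
  · simp

theorem even (h : PosSpectrum ν φ) (ζ : ℝ) : φ (-ζ) = φ ζ := by
  simp [h.eq_integral_cos]

theorem integrable_cos [IsFiniteMeasure ν] (ζ : ℝ) : Integrable (fun q => Real.cos (ζ * q)) ν :=
  integrable_of_abs_le (by fun_prop) 1 fun _ => Real.abs_cos_le_one _

theorem abs_sub_le (h : PosSpectrum ν φ) {L : ℝ} (hL : ∀ᵐ q ∂ν, |q| ≤ L) (hL0 : 0 ≤ L) (x y : ℝ) :
    |φ x - φ y| ≤ L * |x - y| := by
  have hν := h.isFiniteMeasure
  rw [h.eq_integral_cos, h.eq_integral_cos, ← integral_sub (integrable_cos _) (integrable_cos _)]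
  have h1 : ∀ᵐ q ∂ν, ‖Real.cos (x * q) - Real.cos (y * q)‖ ≤ L * |x - y| := by
    filter_upwards [hL] with q hq
    rw [Real.norm_eq_abs]
    refine (Real.abs_cos_sub_cos_le _ _).trans ?_
    rw [← sub_mul, abs_mul, mul_comm]
    gcongr
  refine (norm_integral_le_of_norm_le_const h1).trans ?_
  exact mul_le_of_le_one_right (by positivity) h.real_univ_le

theorem measurable (h : PosSpectrum ν φ) : Measurable φ := by
  have := h.isFiniteMeasure
  have h1 : φ = fun ζ => (charFun ν ζ).re := by
    ext ζ; rw [h.charFun_eq, Complex.ofReal_re]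
  rw [h1]
  exact Complex.measurable_re.comp measurable_charFun

/-- The quadratic form of a positive definite function dominates the square of its linear form. -/
theorem sq_sum_le (h : PosSpectrum ν φ) (V : Finset ℤ) (p : ℤ → ℝ) (g : ℝ) :
    (∑ b ∈ V, p b * φ (g * b)) ^ 2 ≤ ∑ b ∈ V, ∑ a ∈ V, p b * (p a * φ (g * (a - b))) := by
  have hν := h.isFiniteMeasure
  set C : ℝ → ℝ := fun q => ∑ b ∈ V, p b * Real.cos (g * b * q) with hC
  set D : ℝ → ℝ := fun q => ∑ b ∈ V, p b * Real.sin (g * b * q) with hD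
  have hCm : Measurable C := by fun_prop
  have hDm : Measurable D := by fun_prop
  have hCb : ∀ q, |C q| ≤ ∑ b ∈ V, |p b| := fun q =>
    (Finset.abs_sum_le_sum_abs _ _).trans (Finset.sum_le_sum fun b _ => by
      rw [abs_mul]
      exact mul_le_of_le_one_right (abs_nonneg _) (Real.abs_cos_le_one _))
  have hDb : ∀ q, |D q| ≤ ∑ b ∈ V, |p b| := fun q =>
    (Finset.abs_sum_le_sum_abs _ _).trans (Finset.sum_le_sum fun b _ => by
      rw [abs_mul]
      exact mul_le_of_le_one_right (abs_nonneg _) (Real.abs_sin_le_one _))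
  have hsq : ∀ {f : ℝ → ℝ}, Measurable f → (∀ q, |f q| ≤ ∑ b ∈ V, |p b|) →
      Integrable (fun q => f q ^ 2) ν := fun {f} hf hb =>
    integrable_of_abs_le (by fun_prop) ((∑ b ∈ V, |p b|) ^ 2) fun q => by
      rw [abs_pow]
      exact pow_le_pow_left₀ (abs_nonneg _) (hb q) 2
  have h1 : ∑ b ∈ V, p b * φ (g * b) = ∫ q, C q ∂ν := by
    rw [hC, integral_finsetSum _ fun b _ => (integrable_cos _).const_mul _]
    refine Finset.sum_congr rfl fun b _ => ?_
    rw [integral_const_mul, h.eq_integral_cos]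
  have h2 : ∑ b ∈ V, ∑ a ∈ V, p b * (p a * φ (g * (a - b))) = ∫ q, (C q ^ 2 + D q ^ 2) ∂ν := by
    have h3 : ∀ q, C q ^ 2 + D q ^ 2 =
        ∑ b ∈ V, ∑ a ∈ V, p b * (p a * Real.cos (g * (a - b) * q)) := by
      intro q
      rw [sq, sq, hC, hD]
      simp only
      rw [Finset.sum_mul_sum, Finset.sum_mul_sum, ← Finset.sum_add_distrib]
      refine Finset.sum_congr rfl fun b _ => ?_
      rw [← Finset.sum_add_distrib]
      refine Finset.sum_congr rfl fun a _ => ?_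
      have : g * (a - b) * q = g * a * q - g * b * q := by ring
      rw [this, Real.cos_sub]
      ring
    simp only [h3]
    rw [integral_finsetSum _ fun b _ => integrable_finsetSum _ fun a _ =>
      ((integrable_cos _).const_mul _).const_mul _]
    refine Finset.sum_congr rfl fun b _ => ?_
    rw [integral_finsetSum _ fun a _ => ((integrable_cos _).const_mul _).const_mul _]
    refine Finset.sum_congr rfl fun a _ => ?_
    rw [integral_const_mul, integral_const_mul, h.eq_integral_cos]
  rw [h1, h2]
  refine (sq_integral_le_mul_integral_sq zero_lt_one h.real_univ_le (integrable_of_abs_le hCm _ hCb)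
    (hsq hCm hCb)).trans ?_
  rw [one_mul]
  refine (integral_mono (hsq hCm hCb) ((hsq hCm hCb).add (hsq hDm hDb)) fun q => ?_)
  exact le_add_of_nonneg_right (sq_nonneg _)

end PosSpectrum

theorem posSpectrum_gaussianReal :
    PosSpectrum (gaussianReal 0 1) fun t => Real.exp (-t ^ 2 / 2) where
  mass_le := prob_le_one
  charFun_eq ζ := by
    rw [charFun_gaussianReal]
    push_cast
    congr 1
    ring
  nonneg ζ := (Real.exp_pos _).le

theorem integrable_gaussAvg [IsFiniteMeasure ν] (D : ℝ) :
    Integrable (fun q => Real.exp (-(D * q) ^ 2 / 2)) ν :=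
  integrable_of_abs_le (by fun_prop) 1 fun q => by
    rw [abs_of_pos (Real.exp_pos _), Real.exp_le_one_iff]
    linarith [sq_nonneg (D * q)]

theorem gaussAvg_anti [IsFiniteMeasure ν] {D D' : ℝ} (hD : 0 ≤ D) (h : D ≤ D') :
    gaussAvg ν D' ≤ gaussAvg ν D := by
  refine integral_mono (integrable_gaussAvg _) (integrable_gaussAvg _) fun q => ?_
  refine Real.exp_le_exp.2 ?_
  rw [mul_pow, mul_pow]
  have : D ^ 2 * q ^ 2 ≤ D' ^ 2 * q ^ 2 := by gcongr
  linarith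

theorem gaussAvg_nonneg (D : ℝ) : 0 ≤ gaussAvg ν D := integral_nonneg fun _ => (Real.exp_pos _).le

theorem gaussAvg_le [IsFiniteMeasure ν] (hν : ν Set.univ ≤ 1) {D ρ : ℝ} (hD : 0 ≤ D)
    (hρ : 0 ≤ ρ) :
    gaussAvg ν D ≤ ν.real (Set.Icc (-ρ) ρ) + Real.exp (-(D * ρ) ^ 2 / 2) := by
  have h1 : ∀ q, Real.exp (-(D * q) ^ 2 / 2) ≤
      (Set.Icc (-ρ) ρ).indicator (fun _ => 1) q + Real.exp (-(D * ρ) ^ 2 / 2) := by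
    intro q
    by_cases hq : q ∈ Set.Icc (-ρ) ρ
    · rw [Set.indicator_of_mem hq]
      have : Real.exp (-(D * q) ^ 2 / 2) ≤ 1 := by
        rw [Real.exp_le_one_iff]; linarith [sq_nonneg (D * q)]
      linarith [Real.exp_pos (-(D * ρ) ^ 2 / 2)]
    · rw [Set.indicator_of_notMem hq, zero_add]
      refine Real.exp_le_exp.2 ?_
      have h2 : ρ < |q| := by
        by_contra h
        exact hq (abs_le.1 (not_lt.1 h))
      have h3 : (D * ρ) ^ 2 ≤ (D * q) ^ 2 := by
        rw [← sq_abs (D * q), abs_mul, abs_of_nonneg hD]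
        gcongr
      linarith
  have hm : MeasurableSet (Set.Icc (-ρ) ρ) := measurableSet_Icc
  have hi : Integrable ((Set.Icc (-ρ) ρ).indicator fun _ => (1 : ℝ)) ν :=
    (integrable_const _).indicator hm
  refine (integral_mono (integrable_gaussAvg _) (hi.add (integrable_const _)) h1).trans ?_
  simp only [Pi.add_apply]
  rw [integral_add hi (integrable_const _), integral_indicator_const _ hm, integral_const]
  simp only [smul_eq_mul, mul_one]
  gcongr
  exact mul_le_of_le_one_left (Real.exp_pos _).le
    (ENNReal.toReal_le_of_le_ofReal zero_le_one (by simpa using hν))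

namespace PosSpectrum

theorem integral_gaussian (h : PosSpectrum ν φ) (c D : ℝ) :
    ∫ a, φ (c + D * a) ∂(gaussianReal 0 1) =
      ∫ q, Real.cos (c * q) * Real.exp (-(D * q) ^ 2 / 2) ∂ν := by
  have hν := h.isFiniteMeasure
  simp only [h.eq_integral_cos]
  rw [integral_integral_swap]
  · refine integral_congr_ae (Filter.Eventually.of_forall fun q => ?_)
    simp only
    have h1 : ∀ a, Real.cos ((c + D * a) * q) =
        Real.cos (c * q) * Real.cos (D * q * a) - Real.sin (c * q) * Real.sin (D * q * a) := by
      intro a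
      rw [← Real.cos_add]
      congr 1; ring
    simp only [h1]
    rw [integral_sub, integral_const_mul, integral_const_mul,
      posSpectrum_gaussianReal.integral_sin, ← posSpectrum_gaussianReal.eq_integral_cos]
    · ring
    · exact (integrable_cos _).const_mul _
    · exact (integrable_of_abs_le (by fun_prop) 1 fun _ => Real.abs_sin_le_one _).const_mul _
  · exact integrable_of_abs_le (by fun_prop) 1 fun _ => Real.abs_cos_le_one _

theorem integral_gaussian_eq (h : PosSpectrum ν φ) (D : ℝ) :
    ∫ a, φ (D * a) ∂(gaussianReal 0 1) = gaussAvg ν D := by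
  simpa [gaussAvg] using h.integral_gaussian 0 D

theorem integral_gaussian_le (h : PosSpectrum ν φ) (c D : ℝ) :
    ∫ a, φ (c + D * a) ∂(gaussianReal 0 1) ≤ gaussAvg ν D := by
  have hν := h.isFiniteMeasure
  rw [h.integral_gaussian]
  refine integral_mono ?_ (integrable_gaussAvg _) fun q =>
    mul_le_of_le_one_left (Real.exp_pos _).le (Real.cos_le_one _)
  refine integrable_of_abs_le (by fun_prop) 1 fun q => ?_
  rw [abs_mul, abs_of_pos (Real.exp_pos _)]
  exact mul_le_one₀ (Real.abs_cos_le_one _) (Real.exp_pos _).le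
    (Real.exp_le_one_iff.2 (by linarith [sq_nonneg (D * q)]))

end PosSpectrum
end PositiveSpectrum

section GaussianEstimates
open ProbabilityTheory
open scoped Finset

theorem gaussianPDFReal_zero_one (x : ℝ) :
    gaussianPDFReal 0 1 x = (Real.sqrt (2 * Real.pi))⁻¹ * Real.exp (-x ^ 2 / 2) := by
  simp [gaussianPDFReal]

theorem gaussianReal_le_volume (s : Set ℝ) : gaussianReal 0 1 s ≤ volume s := by
  rw [gaussianReal_apply 0 one_ne_zero, ← setLIntegral_one]
  refine lintegral_mono fun x => ?_
  rw [gaussianPDF, ← ENNReal.ofReal_one]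
  refine ENNReal.ofReal_le_ofReal ?_
  rw [gaussianPDFReal_zero_one]
  have h1 : 1 ≤ Real.sqrt (2 * Real.pi) := by
    rw [Real.one_le_sqrt]; linarith [Real.pi_gt_three]
  exact mul_le_one₀ (inv_le_one_of_one_le₀ h1) (Real.exp_pos _).le
    (Real.exp_le_one_iff.2 (by linarith [sq_nonneg x]))

theorem gaussianReal_real_Ico_le {a b : ℝ} (h : a ≤ b) :
    (gaussianReal 0 1).real (Set.Ico a b) ≤ b - a := by
  refine ENNReal.toReal_le_of_le_ofReal (by linarith) ?_
  exact (gaussianReal_le_volume _).trans_eq Real.volume_Ico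

theorem le_gaussianReal_real_Ico {a b : ℝ} (ha : -1 ≤ a) (hb : b ≤ 1) :
    (b - a) / 6 ≤ (gaussianReal 0 1).real (Set.Ico a b) := by
  rcases lt_or_ge b a with hab | hab
  · exact (by linarith : (b - a) / 6 ≤ 0).trans measureReal_nonneg
  have h1 : ENNReal.ofReal ((b - a) / 6) ≤ gaussianReal 0 1 (Set.Ico a b) := by
    rw [gaussianReal_apply 0 one_ne_zero]
    calc ENNReal.ofReal ((b - a) / 6) = ∫⁻ _ in Set.Ico a b, ENNReal.ofReal (1 / 6) := by
          rw [setLIntegral_const, Real.volume_Ico, ← ENNReal.ofReal_mul (by norm_num)]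
          congr 1; ring
      _ ≤ _ := by
          refine setLIntegral_mono (measurable_gaussianPDF 0 1) fun x hx => ?_
          rw [gaussianPDF]
          refine ENNReal.ofReal_le_ofReal ?_
          rw [gaussianPDFReal_zero_one]
          have h2 : Real.sqrt (2 * Real.pi) ≤ 3 := by
            rw [Real.sqrt_le_left (by norm_num)]; linarith [Real.pi_le_four]
          have h3 : 1 / 2 ≤ Real.exp (-x ^ 2 / 2) := by
            have h4 := Real.add_one_le_exp (-x ^ 2 / 2)
            have h5 : x ^ 2 ≤ 1 := by
              rw [sq_le_one_iff_abs_le_one, abs_le]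
              exact ⟨ha.trans hx.1, hx.2.le.trans hb⟩
            linarith
          have h6 : (3 : ℝ)⁻¹ ≤ (Real.sqrt (2 * Real.pi))⁻¹ := by gcongr
          calc (1 : ℝ) / 6 = 3⁻¹ * (1 / 2) := by norm_num
            _ ≤ _ := by gcongr
  exact (ENNReal.ofReal_le_iff_le_toReal (measure_ne_top _ _)).1 h1

theorem gaussianReal_tail (H : ℝ) :
    (gaussianReal 0 1).real {a | H < |a|} ≤ 2 * Real.exp (1 / 2 - H) := by
  have hm : ∀ t : ℝ, mgf id (gaussianReal 0 1) t = Real.exp (t ^ 2 / 2) := fun t => by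
    rw [mgf_id_gaussianReal]; simp
  have h1 := measure_ge_le_exp_mul_mgf (μ := gaussianReal 0 1) (X := id) H
    (t := 1) zero_le_one (integrable_exp_mul_gaussianReal 1)
  have h2 := measure_le_le_exp_mul_mgf (μ := gaussianReal 0 1) (X := id) (-H)
    (t := -1) (by norm_num) (integrable_exp_mul_gaussianReal (-1))
  rw [hm, ← Real.exp_add] at h1 h2
  have h3 : {a : ℝ | H < |a|} ⊆ {a | H ≤ id a} ∪ {a | id a ≤ -H} := by
    intro a ha
    rcases lt_abs.1 (show H < |a| from ha) with h | h
    · exact Or.inl h.le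
    · exact Or.inr (by simp only [Set.mem_ofPred_eq, id]; linarith)
  refine (measureReal_mono h3 (measure_ne_top _ _)).trans ((measureReal_union_le _ _).trans ?_)
  refine (add_le_add h1 h2).trans (le_of_eq ?_)
  have e1 : -1 * H + 1 ^ 2 / 2 = 1 / 2 - H := by ring
  have e2 : - -1 * -H + (-1) ^ 2 / 2 = 1 / 2 - H := by ring
  rw [e1, e2]; ring

namespace PosSpectrum
variable {ν : Measure ℝ} {φ : ℝ → ℝ}

theorem gaussAvg_div_le (h : PosSpectrum ν φ) {m : ℝ} (hm : 1 ≤ m) (R : ℝ) :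
    gaussAvg ν (R / m) ≤ m * gaussAvg ν R := by
  have hm0 : 0 < m := by linarith
  rw [← h.integral_gaussian_eq, ← h.integral_gaussian_eq,
    integral_gaussianReal_eq_integral_smul one_ne_zero,
    integral_gaussianReal_eq_integral_smul one_ne_zero]
  have h1 := Measure.integral_comp_mul_left
    (fun a => gaussianPDFReal 0 1 a • φ (R / m * a)) m
  have h2 : ∀ a, R / m * (m * a) = R * a := fun a => by field_simp
  simp only [h2, smul_eq_mul, abs_of_pos (inv_pos.2 hm0)] at h1
  have h3 : ∫ a, gaussianPDFReal 0 1 a • φ (R / m * a) =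
      m * ∫ a, gaussianPDFReal 0 1 (m * a) * φ (R * a) := by
    rw [h1]
    simp only [smul_eq_mul]
    field_simp
  rw [h3]
  refine mul_le_mul_of_nonneg_left ?_ hm0.le
  have hpdf : ∀ a, gaussianPDFReal 0 1 (m * a) ≤ gaussianPDFReal 0 1 a := by
    intro a
    rw [gaussianPDFReal_zero_one, gaussianPDFReal_zero_one]
    refine mul_le_mul_of_nonneg_left (Real.exp_le_exp.2 ?_) (by positivity)
    have : a ^ 2 ≤ (m * a) ^ 2 := by
      rw [mul_pow]
      exact le_mul_of_one_le_left (sq_nonneg a) (one_le_pow₀ hm)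
    linarith
  refine integral_mono_of_nonneg (Filter.Eventually.of_forall fun a => ?_) ?_
    (Filter.Eventually.of_forall fun a => ?_)
  · exact mul_nonneg (gaussianPDFReal_nonneg _ _ _) (h.nonneg _)
  · refine (integrable_gaussianPDFReal 0 1).mono
      ((measurable_gaussianPDFReal 0 1).mul (h.measurable.comp (by fun_prop))).aestronglyMeasurable
      (Filter.Eventually.of_forall fun a => ?_)
    rw [norm_smul, Real.norm_eq_abs (φ _)]
    exact mul_le_of_le_one_right (norm_nonneg _) (h.abs_le_one _)
  · exact mul_le_mul_of_nonneg_right (hpdf a) (h.nonneg _)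

theorem gaussAvg_mul_le (h : PosSpectrum ν φ) {m x R : ℝ} (hm : 1 ≤ m) (hR : 0 ≤ R)
    (hx : m⁻¹ ≤ x) : gaussAvg ν (x * R) ≤ m * gaussAvg ν R := by
  have hν := h.isFiniteMeasure
  refine le_trans (gaussAvg_anti (by positivity) ?_) (h.gaussAvg_div_le hm R)
  rw [div_eq_inv_mul]
  gcongr

/-- Counting lattice points at which a positive definite function is large. -/
theorem card_mul_le (h : PosSpectrum ν φ) {L : ℝ} (hL : ∀ᵐ q ∂ν, |q| ≤ L) (hL0 : 0 ≤ L)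
    {s : Finset ℤ} {x y g D D' ε : ℝ} (hg : 0 < g) (hD' : 0 < D') (hε : 0 ≤ ε)
    (hgL : L * g ≤ ε / 2) (hDD' : g * (D + 1) ≤ D')
    (hs : ∀ b ∈ s, |(b : ℝ) - x| ≤ D ∧ ε ≤ φ (y + g * b)) :
    #s * (ε * g) ≤ 12 * D' * gaussAvg ν D' := by
  set I : ℤ → Set ℝ := fun b => Set.Ico ((g * b - g * x) / D') ((g * b - g * x + g) / D') with hI
  have hIm : ∀ b, MeasurableSet (I b) := fun b => measurableSet_Ico
  have hmem : ∀ b a, a ∈ I b ↔ g * b ≤ g * x + D' * a ∧ g * x + D' * a < g * b + g := by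
    intro b a
    simp only [hI, Set.mem_Ico, div_le_iff₀ hD', lt_div_iff₀ hD']
    constructor <;> rintro ⟨h1, h2⟩ <;> constructor <;> linarith
  have hdisj : Set.PairwiseDisjoint (s : Set ℤ) I := by
    intro b _ b' _ hbb'
    rw [Function.onFun, Set.disjoint_left]
    intro a ha ha'
    rw [hmem] at ha ha'
    apply hbb'
    have h1 : (b : ℝ) < b' + 1 := by
      refine lt_of_mul_lt_mul_left ?_ hg.le
      linarith
    have h2 : (b' : ℝ) < b + 1 := by
      refine lt_of_mul_lt_mul_left ?_ hg.le
      linarith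
    have h3 : b < b' + 1 := by exact_mod_cast h1
    have h4 : b' < b + 1 := by exact_mod_cast h2
    omega
  set f : ℝ → ℝ := fun a => φ (y + g * x + D' * a) with hf
  have hfm : Measurable f := h.measurable.comp (by fun_prop)
  have hfi : Integrable f (gaussianReal 0 1) :=
    integrable_of_abs_le hfm 1 fun a => h.abs_le_one _
  have h1 : ∑ b ∈ s, ∫ a in I b, f a ∂(gaussianReal 0 1) ≤ gaussAvg ν D' := by
    rw [← integral_biUnion_finset s (fun b _ => hIm b) hdisj fun b _ => hfi.integrableOn]
    refine le_trans (setIntegral_le_integral hfi ?_) (h.integral_gaussian_le _ D')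
    exact Filter.Eventually.of_forall fun a => h.nonneg _
  have h2 : ∀ b ∈ s, ε / 2 * (g / D' / 6) ≤ ∫ a in I b, f a ∂(gaussianReal 0 1) := by
    intro b hb
    obtain ⟨hb1, hb2⟩ := hs b hb
    rw [abs_le] at hb1
    have hlen : g / D' / 6 ≤ (gaussianReal 0 1).real (I b) := by
      refine le_trans (le_of_eq ?_) (le_gaussianReal_real_Ico ?_ ?_)
      · field_simp; ring
      · rw [le_div_iff₀ hD']
        have := mul_le_mul_of_nonneg_left hb1.1 hg.le
        linarith
      · rw [div_le_one hD']
        have := mul_le_mul_of_nonneg_left hb1.2 hg.le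
        linarith
    calc ε / 2 * (g / D' / 6) ≤ ε / 2 * (gaussianReal 0 1).real (I b) := by gcongr
      _ = ∫ _ in I b, ε / 2 ∂(gaussianReal 0 1) := by
        rw [setIntegral_const, smul_eq_mul, mul_comm]
      _ ≤ _ := by
        refine setIntegral_mono_on (integrable_const _) hfi.integrableOn (hIm b) fun a ha => ?_
        rw [hmem] at ha
        have h3 := h.abs_sub_le hL hL0 (y + g * b) (y + g * x + D' * a)
        have h4 : |y + g * b - (y + g * x + D' * a)| ≤ g := by
          rw [abs_le]; constructor <;> linarith
        have h5 := mul_le_mul_of_nonneg_left h4 hL0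
        have h6 := (abs_le.1 (h3.trans h5)).2
        simp only [hf]
        linarith
  have h3 := (Finset.card_nsmul_le_sum _ _ _ h2).trans h1
  rw [nsmul_eq_mul] at h3
  calc #s * (ε * g) = 12 * D' * (#s * (ε / 2 * (g / D' / 6))) := by field_simp; ring
    _ ≤ _ := by gcongr

end PosSpectrum
end GaussianEstimates

section LatticeLaw
open ProbabilityTheory

theorem sum_measureReal_mul {Ω : Type*} [MeasurableSpace Ω] {P : Measure Ω} [IsFiniteMeasure P]
    {κ : Ω → ℤ} (hκ : Measurable κ) (V : Finset ℤ) (hV : ∀ᵐ x ∂P, κ x ∈ V) (f : ℤ → ℝ) :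
    ∑ b ∈ V, P.real (κ ⁻¹' {b}) * f b = ∫ x, f (κ x) ∂P := by
  have hm : ∀ b, MeasurableSet (κ ⁻¹' {b}) := fun b => hκ (MeasurableSet.singleton b)
  have h1 : ∀ᵐ x ∂P, f (κ x) = ∑ b ∈ V, (κ ⁻¹' {b}).indicator (fun _ => f b) x := by
    filter_upwards [hV] with x hx
    rw [Finset.sum_eq_single_of_mem _ hx]
    · rw [Set.indicator_of_mem (by simp)]
    · intro b _ hb
      rw [Set.indicator_of_notMem]
      simpa using hb.symm
  rw [integral_congr_ae h1, integral_finsetSum _ fun b _ => (integrable_const _).indicator (hm b)]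
  refine Finset.sum_congr rfl fun b _ => ?_
  rw [integral_indicator_const _ (hm b), smul_eq_mul]

/-- A dense subset of a product has many pairs of fibres with large intersection. -/
theorem exists_popular_fibre {α β : Type*} [MeasurableSpace α] [MeasurableSpace β] {ρ : Measure α}
    {μ : Measure β} [IsFiniteMeasure ρ] (hμ : μ Set.univ ≤ 1) {S : Set (α × β)}
    (hS : MeasurableSet S) {E : Set β} (hE : ∀ᵐ x ∂μ, x ∈ E) {z δ : ℝ} (hz : 0 < z)
    (hρ : ρ.real Set.univ ≤ z) (hδ : 0 < δ) (hδS : z * δ ≤ (ρ.prod μ).real S) :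
    ∃ x₀ ∈ E, δ ^ 2 / 4 ≤
      μ.real {x | z * (δ ^ 2 / 4) ≤ ρ.real {a | (a, x) ∈ S ∧ (a, x₀) ∈ S}} := by
  have : IsFiniteMeasure μ := ⟨hμ.trans_lt ENNReal.one_lt_top⟩
  have hμ1 : μ.real Set.univ ≤ 1 := ENNReal.toReal_le_of_le_ofReal zero_le_one (by simpa using hμ)
  set s : α × β → ℝ := S.indicator fun _ => 1 with hs
  have hsm : Measurable s := measurable_const.indicator hS
  have hs01 : ∀ p, 0 ≤ s p ∧ s p ≤ 1 := fun p => by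
    by_cases hp : p ∈ S <;> simp [hs, hp]
  have hsabs : ∀ p, |s p| ≤ 1 := fun p => by rw [abs_of_nonneg (hs01 p).1]; exact (hs01 p).2
  set u : α → ℝ := fun a => ∫ x, s (a, x) ∂μ with hu
  have hum : Measurable u := hsm.stronglyMeasurable.integral_prod_right'.measurable
  have hu0 : ∀ a, 0 ≤ u a := fun a => integral_nonneg fun x => (hs01 _).1
  have hu1 : ∀ a, u a ≤ 1 := fun a => by
    have h1 : u a ≤ ∫ _, (1 : ℝ) ∂μ := integral_mono
      (integrable_of_abs_le (hsm.comp measurable_prodMk_left) 1 fun x => hsabs _)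
      (integrable_const _) fun x => (hs01 _).2
    rw [integral_const, smul_eq_mul, mul_one] at h1
    exact h1.trans hμ1
  have huabs : ∀ a, |u a| ≤ 1 := fun a => by rw [abs_of_nonneg (hu0 a)]; exact hu1 a
  have hsint : Integrable s (ρ.prod μ) := integrable_of_abs_le hsm 1 hsabs
  have h1 : z * δ ≤ ∫ a, u a ∂ρ := by
    rw [hu, ← integral_prod s hsint, hs, integral_indicator_const _ hS]
    simpa using hδS
  have h2 := sq_integral_le_mul_integral_sq hz hρ (integrable_of_abs_le hum 1 huabs)
    (integrable_of_abs_le (hum.pow_const 2) 1 fun a => by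
      rw [abs_pow]; exact pow_le_one₀ (abs_nonneg _) (huabs a))
  have h3 : z * δ ^ 2 ≤ ∫ a, u a ^ 2 ∂ρ := by
    have h4 : (z * δ) ^ 2 ≤ (∫ a, u a ∂ρ) ^ 2 := by gcongr
    have h5 : z * (z * δ ^ 2) ≤ z * ∫ a, u a ^ 2 ∂ρ := by
      calc _ = (z * δ) ^ 2 := by ring
        _ ≤ _ := h4.trans h2
    exact le_of_mul_le_mul_left h5 hz
  set f : β → ℝ := fun x₀ => ∫ a, u a * s (a, x₀) ∂ρ with hf
  have hus : Measurable fun p : α × β => u p.1 * s p := (hum.comp measurable_fst).mul hsm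
  have husabs : ∀ p : α × β, |u p.1 * s p| ≤ 1 := fun p => by
    rw [abs_mul]; exact mul_le_one₀ (huabs _) (abs_nonneg _) (hsabs _)
  have h4 : ∫ a, u a ^ 2 ∂ρ = ∫ x, f x ∂μ := by
    rw [hf, ← integral_integral_swap (f := fun a x => u a * s (a, x))
      (integrable_of_abs_le hus 1 husabs)]
    refine integral_congr_ae (Filter.Eventually.of_forall fun a => ?_)
    simp only
    rw [integral_const_mul, sq]
  have hfm : Measurable f := hus.stronglyMeasurable.integral_prod_left'.measurable
  have hf0 : ∀ x, 0 ≤ f x := fun x => integral_nonneg fun a => mul_nonneg (hu0 a) (hs01 _).1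
  obtain ⟨x₀, hx₀E, hx₀⟩ : ∃ x₀ ∈ E, z * δ ^ 2 / 2 ≤ f x₀ := by
    by_contra! hcon
    have h5 : ∫ x, f x ∂μ ≤ ∫ _, z * δ ^ 2 / 2 ∂μ := by
      refine integral_mono_of_nonneg (Filter.Eventually.of_forall hf0) (integrable_const _) ?_
      filter_upwards [hE] with x hx using (hcon x hx).le
    rw [integral_const, smul_eq_mul] at h5
    have h6 : μ.real Set.univ * (z * δ ^ 2 / 2) ≤ 1 * (z * δ ^ 2 / 2) := by gcongr
    have : 0 < z * δ ^ 2 := by positivity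
    linarith
  refine ⟨x₀, hx₀E, ?_⟩
  set v : β → ℝ := fun x => ρ.real {a | (a, x) ∈ S ∧ (a, x₀) ∈ S} with hv
  have hset : ∀ x, MeasurableSet {a | (a, x) ∈ S ∧ (a, x₀) ∈ S} := fun x =>
    (measurable_prodMk_right hS).inter (measurable_prodMk_right hS)
  have hss : Measurable fun p : α × β => s p * s (p.1, x₀) :=
    hsm.mul (hsm.comp (measurable_fst.prodMk measurable_const))
  have hssabs : ∀ p : α × β, |s p * s (p.1, x₀)| ≤ 1 := fun p => by
    rw [abs_mul]; exact mul_le_one₀ (hsabs _) (abs_nonneg _) (hsabs _)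
  have hvs : ∀ x, v x = ∫ a, s (a, x) * s (a, x₀) ∂ρ := by
    intro x
    have : ∀ a, s (a, x) * s (a, x₀) =
        {a | (a, x) ∈ S ∧ (a, x₀) ∈ S}.indicator (fun _ => (1 : ℝ)) a := by
      intro a
      by_cases h1 : (a, x) ∈ S <;> by_cases h2 : (a, x₀) ∈ S <;> simp [hs, h1, h2]
    simp only [this]
    rw [integral_indicator_const _ (hset x)]
    simp [hv]
  have hvm : Measurable v := by
    have : v = fun x => ∫ a, s (a, x) * s (a, x₀) ∂ρ := funext hvs
    rw [this]
    exact hss.stronglyMeasurable.integral_prod_left'.measurable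
  have hfv : f x₀ = ∫ x, v x ∂μ := by
    simp only [hvs]
    rw [← integral_integral_swap (f := fun a x => s (a, x) * s (a, x₀))
      (integrable_of_abs_le hss 1 hssabs)]
    refine integral_congr_ae (Filter.Eventually.of_forall fun a => ?_)
    simp only
    rw [integral_mul_const]
  have hv0 : ∀ x, 0 ≤ v x := fun x => measureReal_nonneg
  have hvz : ∀ x, v x ≤ z := fun x => (measureReal_mono (Set.subset_univ _)).trans hρ
  set X : Set β := {x | z * (δ ^ 2 / 4) ≤ v x} with hX
  have hXm : MeasurableSet X := measurableSet_le measurable_const hvm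
  have h5 : ∫ x, v x ∂μ ≤ ∫ x, (X.indicator (fun _ => z) x + z * (δ ^ 2 / 4)) ∂μ := by
    refine integral_mono (integrable_of_abs_le hvm z fun x => by
      rw [abs_of_nonneg (hv0 x)]; exact hvz x)
      (((integrable_const _).indicator hXm).add (integrable_const _)) fun x => ?_
    by_cases hx : x ∈ X
    · rw [Set.indicator_of_mem hx]
      have : 0 < z * (δ ^ 2 / 4) := by positivity
      linarith [hvz x]
    · rw [Set.indicator_of_notMem hx, zero_add]
      exact (not_le.1 hx).le
  rw [integral_add ((integrable_const _).indicator hXm) (integrable_const _),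
    integral_indicator_const _ hXm, integral_const, smul_eq_mul, smul_eq_mul] at h5
  have h6 : μ.real Set.univ * (z * (δ ^ 2 / 4)) ≤ 1 * (z * (δ ^ 2 / 4)) := by gcongr
  have h7 : z * (δ ^ 2 / 4) ≤ z * μ.real X := by linarith
  exact le_of_mul_le_mul_left h7 hz

end LatticeLaw

section Structure
open Finset
open scoped Pointwise

theorem card_add_self_le {B : Finset ℤ} (hB : B.Nonempty) {K : ℝ} (h : (#(B - B) : ℝ) ≤ K * #B) :
    (#(B + B) : ℝ) ≤ K ^ 2 * #B := by
  have hpos : (0 : ℝ) < #B := by exact_mod_cast hB.card_pos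
  have h1 : (#(B + B) : ℝ) * #B ≤ #(B - B) * #(B - B) := by
    exact_mod_cast ruzsa_triangle_inequality_add_sub_sub B B B
  refine le_of_mul_le_mul_right (h1.trans ?_) hpos
  calc (#(B - B) : ℝ) * #(B - B) ≤ (K * #B) * (K * #B) :=
        mul_le_mul h h (Nat.cast_nonneg _) ((Nat.cast_nonneg _).trans h)
    _ = K ^ 2 * #B * #B := by ring

/-- If a large part of `B` is mapped close to `B` by the dilation by `ξ`, then `ξ` acts on `B`. -/
theorem card_add_dil_le {B : Finset ℤ} (hB : B.Nonempty) {K K₁ ξ : ℝ} {m w : ℕ}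
    (h : (#(B - B) : ℝ) ≤ K * #B) (hm : 1 ≤ m * ξ)
    (hsub : (#B : ℝ) ≤ K₁ * #{b ∈ B | ∃ b₀ ∈ B, |(b₀ : ℝ) - ξ * (b : ℤ)| ≤ w}) :
    (#(B + dil ξ B) : ℝ) ≤ K ^ 3 * (2 * w + 3) * 2 * m * K₁ * #B := by
  set X := {b ∈ B | ∃ b₀ ∈ B, |(b₀ : ℝ) - ξ * (b : ℤ)| ≤ w} with hX
  have hpos : (0 : ℝ) < #B := by exact_mod_cast hB.card_pos
  have hξ : 0 < ξ := by
    by_contra! hcon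
    have : (m : ℝ) * ξ ≤ 0 := mul_nonpos_of_nonneg_of_nonpos (Nat.cast_nonneg _) hcon
    linarith
  have hK : 0 ≤ K := by
    by_contra! hcon
    have : K * #B < 0 := mul_neg_of_neg_of_pos hcon hpos
    linarith [Nat.cast_nonneg (α := ℝ) #(B - B)]
  have hX0 : (0 : ℝ) < #X := by
    refine lt_of_le_of_ne (Nat.cast_nonneg _) fun h0 => ?_
    rw [← h0, mul_zero] at hsub
    linarith
  have hK₁ : 0 < K₁ := (pos_iff_pos_of_mul_pos (hpos.trans_le hsub)).2 hX0
  have hXB : X ⊆ B := filter_subset _ _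
  have h1 : (#(dil ξ B + B) : ℝ) * #(dil ξ X) ≤ #(dil ξ X - dil ξ B) * #(dil ξ X + B) := by
    rw [mul_comm]
    exact_mod_cast ruzsa_triangle_inequality_add_sub_add (dil ξ B) (dil ξ X) B
  have h2 : (#(dil ξ X - dil ξ B) : ℝ) ≤ 2 * (K * #B) := by
    have hsub2 : dil ξ X - dil ξ B ⊆ dil ξ (B - B) + {0, 1} := by
      intro y hy
      obtain ⟨u, hu, v, hv, rfl⟩ := mem_sub.1 hy
      obtain ⟨b, hb, rfl⟩ := mem_dil.1 hu
      obtain ⟨c, hc, rfl⟩ := mem_dil.1 hv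
      refine mem_add.2 ⟨⌊ξ * ((b - c : ℤ) : ℝ)⌋, mem_dil.2 ⟨b - c, sub_mem_sub (hXB hb) hc, rfl⟩,
        ⌊ξ * b⌋ - ⌊ξ * c⌋ - ⌊ξ * ((b - c : ℤ) : ℝ)⌋, ?_, by ring⟩
      have e1 := Int.floor_le (ξ * b)
      have e2 := Int.lt_floor_add_one (ξ * b)
      have e3 := Int.floor_le (ξ * c)
      have e4 := Int.lt_floor_add_one (ξ * c)
      have e5 := Int.floor_le (ξ * ((b - c : ℤ) : ℝ))
      have e6 := Int.lt_floor_add_one (ξ * ((b - c : ℤ) : ℝ))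
      push_cast at e5 e6 ⊢
      have f1 : ((⌊ξ * b⌋ - ⌊ξ * c⌋ - ⌊ξ * ((b : ℝ) - c)⌋ : ℤ) : ℝ) < (2 : ℤ) := by
        push_cast; linarith
      have f2 : ((-1 : ℤ) : ℝ) < ((⌊ξ * b⌋ - ⌊ξ * c⌋ - ⌊ξ * ((b : ℝ) - c)⌋ : ℤ) : ℝ) := by
        push_cast; linarith
      have g1 : ⌊ξ * b⌋ - ⌊ξ * c⌋ - ⌊ξ * ((b : ℝ) - c)⌋ < 2 := by exact_mod_cast f1
      have g2 : -1 < ⌊ξ * b⌋ - ⌊ξ * c⌋ - ⌊ξ * ((b : ℝ) - c)⌋ := by exact_mod_cast f2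
      rw [mem_insert, mem_singleton]
      omega
    have h3 : (#(dil ξ (B - B)) : ℝ) ≤ K * #B :=
      le_trans (by exact_mod_cast card_image_le) h
    have h4 : ((#({0, 1} : Finset ℤ) : ℕ) : ℝ) ≤ 2 := by simp
    calc (#(dil ξ X - dil ξ B) : ℝ) ≤ #(dil ξ (B - B) + {0, 1}) := by
          exact_mod_cast card_le_card hsub2
      _ ≤ K * #B * 2 := card_add_three_le h3 h4 (by positivity)
      _ = _ := by ring
  have h3 : (#(dil ξ X + B) : ℝ) ≤ K ^ 2 * #B * (2 * w + 3) := by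
    have hsub3 : dil ξ X + B ⊆ (B + B) + Icc (-(w + 1 : ℤ)) (w + 1) := by
      intro y hy
      obtain ⟨u, hu, v, hv, rfl⟩ := mem_add.1 hy
      obtain ⟨b, hb, rfl⟩ := mem_dil.1 hu
      rw [hX, mem_filter] at hb
      obtain ⟨b₀, hb₀, hbb⟩ := hb.2
      refine mem_add.2 ⟨b₀ + v, add_mem_add hb₀ hv, ⌊ξ * b⌋ - b₀, ?_, by ring⟩
      have e1 := Int.floor_le (ξ * b)
      have e2 := Int.lt_floor_add_one (ξ * b)
      rw [abs_le] at hbb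
      have f1 : ((-(w + 1 : ℤ) : ℤ) : ℝ) ≤ ((⌊ξ * b⌋ - b₀ : ℤ) : ℝ) := by push_cast; linarith
      have f2 : ((⌊ξ * b⌋ - b₀ : ℤ) : ℝ) ≤ ((w + 1 : ℤ) : ℝ) := by push_cast; linarith
      exact mem_Icc.2 ⟨by exact_mod_cast f1, by exact_mod_cast f2⟩
    have h4 : ((#(Icc (-(w + 1 : ℤ)) (w + 1)) : ℕ) : ℝ) ≤ 2 * w + 3 := by
      rw [Int.card_Icc]
      have : ((w + 1 : ℤ) + 1 - -(w + 1 : ℤ)).toNat = 2 * w + 3 := by omega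
      rw [this]
      push_cast
      exact le_rfl
    calc (#(dil ξ X + B) : ℝ) ≤ #((B + B) + Icc (-(w + 1 : ℤ)) (w + 1)) := by
          exact_mod_cast card_le_card hsub3
      _ ≤ _ := card_add_three_le (card_add_self_le hB h) h4 (by positivity)
  have h4 : (#X : ℝ) ≤ m * #(dil ξ X) := by
    have : #X ≤ m * #(dil ξ X) := by
      refine card_le_mul_card_image _ _ fun y _ => ?_
      have hsub4 : {b ∈ X | ⌊ξ * (b : ℤ)⌋ = y} ⊆ Ico ⌈(y : ℝ) / ξ⌉ (⌈(y : ℝ) / ξ⌉ + m) := by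
        intro b hb
        obtain ⟨-, hb⟩ := mem_filter.1 hb
        have e1 := Int.floor_le (ξ * b)
        have e2 := Int.lt_floor_add_one (ξ * b)
        rw [hb] at e1 e2
        refine mem_Ico.2 ⟨Int.ceil_le.2 ?_, ?_⟩
        · rw [div_le_iff₀ hξ]; linarith
        · have f1 : (b : ℝ) < y / ξ + m := by
            rw [div_add' _ _ _ hξ.ne', lt_div_iff₀ hξ]; linarith
          have f2 : (b : ℝ) < ((⌈(y : ℝ) / ξ⌉ + m : ℤ) : ℝ) := by
            push_cast; linarith [Int.le_ceil ((y : ℝ) / ξ)]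
          exact_mod_cast f2
      refine (card_le_card hsub4).trans (le_of_eq ?_)
      rw [Int.card_Ico]
      omega
    exact_mod_cast this
  rw [add_comm B]
  refine le_of_mul_le_mul_right ?_ hX0
  calc (#(dil ξ B + B) : ℝ) * #X ≤ #(dil ξ B + B) * (m * #(dil ξ X)) := by gcongr
    _ = m * (#(dil ξ B + B) * #(dil ξ X)) := by ring
    _ ≤ m * (2 * (K * #B) * (K ^ 2 * #B * (2 * w + 3))) := by
      refine mul_le_mul_of_nonneg_left ?_ (Nat.cast_nonneg _)
      exact h1.trans (mul_le_mul h2 h3 (Nat.cast_nonneg _) (by positivity))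
    _ = K ^ 3 * (2 * w + 3) * 2 * m * #B * #B := by ring
    _ ≤ K ^ 3 * (2 * w + 3) * 2 * m * #B * (K₁ * #X) := by gcongr
    _ = _ := by ring

/-- A positive-definite form with large average over a distribution on a lattice charges
difference-closed sets. -/
theorem PosSpectrum.exists_card_sub_mul_le {ν : Measure ℝ} {φ : ℝ → ℝ} (h : PosSpectrum ν φ)
    {Ω : Type*} [MeasurableSpace Ω] {P : Measure Ω} [IsFiniteMeasure P]
    {κ : Ω → ℤ} (hκ : Measurable κ) {M : ℕ} (hM : ∀ᵐ x ∂P, κ x ∈ Icc (-(M : ℤ)) M)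
    {z δ ε ω pm g : ℝ} (hz : 0 < z) (hP : P.real Set.univ ≤ z) (hδ : 0 ≤ δ) (hε : 0 < ε)
    (hδε : 2 * ε ≤ δ ^ 2) (havg : z * δ ≤ ∫ x, φ (g * κ x) ∂P)
    (hpm : ∀ b, P.real (κ ⁻¹' {b}) ≤ z * pm) {T : ℕ} (hT : T ≠ 0) (hω : 0 ≤ ω)
    (hMω : (2 * M + 1 : ℝ) ^ 2 * ω ^ T ≤ ε ^ T / 2) {N : ℝ}
    (hN : (#{d ∈ Icc (-(2 * M : ℤ)) (2 * M) | ε ≤ φ (g * (d : ℤ))} : ℝ) ≤ N) :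
    ∃ t : ℤ, ∃ B ⊆ Icc (-(M : ℤ)) M, (∀ b ∈ B, ε ≤ φ (g * (t - b))) ∧ #B ≤ N ∧
      z * (ε ^ T / 2) ≤ P.real (κ ⁻¹' B) ∧ z * (ε ^ T / 2) ≤ #B * (z * pm) ∧
      #(B - B) * ω ≤ N ^ 2 * pm := by
  classical
  set V := Icc (-(M : ℤ)) M with hV
  set Λ := {d ∈ Icc (-(2 * M : ℤ)) (2 * M) | ε ≤ φ (g * (d : ℤ))} with hΛ
  set p : ℤ → ℝ := fun b => P.real (κ ⁻¹' {b}) / z with hp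
  have hp0 : ∀ b, 0 ≤ p b := fun b => div_nonneg measureReal_nonneg hz.le
  have hppm : ∀ b, p b ≤ pm := fun b => by
    rw [hp, div_le_iff₀ hz, mul_comm]; exact hpm b
  have hpsum : ∀ f : ℤ → ℝ, ∑ b ∈ V, p b * f b = (∫ x, f (κ x) ∂P) / z := by
    intro f
    rw [← sum_measureReal_mul hκ V hM f, sum_div]
    exact sum_congr rfl fun b _ => by rw [hp]; ring
  have hp1 : ∑ b ∈ V, p b ≤ 1 := by
    have h1 := hpsum fun _ => 1
    simp only [mul_one, integral_const, smul_eq_mul] at h1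
    rw [h1, div_le_one hz]
    exact hP
  have hmean : δ ≤ ∑ b ∈ V, p b * φ (g * b) := by
    rw [hpsum fun b => φ (g * b), le_div_iff₀ hz]
    linarith
  let r : ℤ → ℤ → Prop := fun a b => ε ≤ φ (g * ((a : ℝ) - b))
  have hrΛ : ∀ a ∈ V, ∀ b ∈ V, r a b → a - b ∈ Λ := by
    intro a ha b hb hab
    rw [hV, mem_Icc] at ha hb
    rw [hΛ, mem_filter, mem_Icc]
    exact ⟨⟨by linarith [ha.1, hb.2], by linarith [ha.2, hb.1]⟩, by push_cast; exact hab⟩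
  have hdens : ε ≤ ∑ b ∈ V, p b * ∑ a ∈ V with r a b, p a := by
    have h1 := h.sq_sum_le V p g
    have h2 : δ ^ 2 ≤ (∑ b ∈ V, p b * φ (g * b)) ^ 2 := by gcongr
    have h3 : ∀ b ∈ V, ∑ a ∈ V, p b * (p a * φ (g * (a - b))) ≤
        p b * ∑ a ∈ V with r a b, p a + p b * ε := by
      intro b _
      rw [← mul_sum, ← mul_add]
      refine mul_le_mul_of_nonneg_left ?_ (hp0 b)
      calc ∑ a ∈ V, p a * φ (g * (a - b))
          ≤ ∑ a ∈ V, ((if r a b then p a else 0) + p a * ε) := by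
            refine sum_le_sum fun a _ => ?_
            split_ifs with hab
            · nlinarith [h.le_one (g * (a - b)), hp0 a]
            · rw [zero_add]
              exact mul_le_mul_of_nonneg_left (not_le.1 hab).le (hp0 a)
        _ = ∑ a ∈ V with r a b, p a + (∑ a ∈ V, p a) * ε := by
            rw [sum_add_distrib, sum_filter, sum_mul]
        _ ≤ _ := by nlinarith
    have h4 := h1.trans (sum_le_sum h3)
    rw [sum_add_distrib, ← sum_mul] at h4
    nlinarith
  have hVcard : (#V : ℝ) = 2 * M + 1 := by
    rw [hV, Int.card_Icc]
    have : ((M : ℤ) + 1 - -(M : ℤ)).toNat = 2 * M + 1 := by omega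
    rw [this]
    push_cast
    ring
  obtain ⟨t, htV, B, hBV, htB, hBp, hcom⟩ := exists_common_neighbours V p r hT
    (fun a _ => hp0 a) hp1 hε hω hdens (by rw [hVcard]; exact hMω)
  refine ⟨t, B, hBV, htB, ?_, ?_, ?_, ?_⟩
  · refine le_trans ?_ hN
    have : #B ≤ #Λ := card_le_card_of_injOn (fun b => t - b)
      (fun b hb => hrΛ t htV b (hBV hb) (htB b hb)) (fun a _ b _ hab => by simpa using hab)
    exact_mod_cast this
  · have h1 : P.real (κ ⁻¹' B) = ∑ b ∈ B, P.real (κ ⁻¹' {b}) := by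
      rw [sum_measureReal_preimage_singleton B fun b _ => hκ (MeasurableSet.singleton b)]
    rw [h1]
    have h2 : ∑ b ∈ B, p b = (∑ b ∈ B, P.real (κ ⁻¹' {b})) / z := by rw [sum_div]
    rw [h2, le_div_iff₀ hz] at hBp
    linarith
  · have h1 : ∑ b ∈ B, p b ≤ #B * pm := by
      rw [← nsmul_eq_mul]
      exact sum_le_card_nsmul _ _ _ fun b _ => hppm b
    calc z * (ε ^ T / 2) ≤ z * (#B * pm) := by gcongr; exact hBp.trans h1
      _ = _ := by ring
  · have h1 : ∀ d ∈ B - B, ∃ x : ℤ × ℤ, x.1 ∈ B ∧ x.2 ∈ B ∧ x.1 - x.2 = d := by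
      intro d hd
      obtain ⟨b₁, hb₁, b₂, hb₂, rfl⟩ := mem_sub.1 hd
      exact ⟨(b₁, b₂), hb₁, hb₂, rfl⟩
    choose! f hf1 hf2 hf3 using h1
    set Nb : ℤ → Finset ℤ := fun d => {a ∈ V | r a (f d).1 ∧ r a (f d).2} with hNb
    have h2 : ∀ d ∈ B - B, ω ≤ #(Nb d) * pm := by
      intro d hd
      refine (hcom _ (hf1 d hd) _ (hf2 d hd)).trans ?_
      rw [← nsmul_eq_mul]
      exact sum_le_card_nsmul _ _ _ fun b _ => hppm b
    have h3 : #((B - B).sigma Nb) ≤ #(Λ ×ˢ Λ) := by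
      refine card_le_card_of_injOn (fun x => (x.2 - (f x.1).1, x.2 - (f x.1).2)) ?_ ?_
      · rintro ⟨d, a⟩ hx
        simp only [coe_sigma, Set.mem_sigma_iff, mem_coe, hNb, mem_filter] at hx
        simp only [mem_coe, mem_product]
        exact ⟨hrΛ _ hx.2.1 _ (hBV (hf1 d hx.1)) hx.2.2.1, hrΛ _ hx.2.1 _ (hBV (hf2 d hx.1)) hx.2.2.2⟩
      · rintro ⟨d, a⟩ hx ⟨d', a'⟩ hx' heq
        simp only [coe_sigma, Set.mem_sigma_iff, mem_coe] at hx hx'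
        simp only [Prod.mk.injEq] at heq
        have e1 := hf3 d hx.1
        have e2 := hf3 d' hx'.1
        obtain rfl : d = d' := by linarith [heq.1, heq.2]
        obtain rfl : a = a' := by linarith [heq.1]
        rfl
    have hpm0 : 0 ≤ pm := (hp0 0).trans (hppm 0)
    rw [card_sigma, card_product] at h3
    have h4 : (∑ d ∈ B - B, (#(Nb d) : ℝ)) ≤ #Λ * #Λ := by exact_mod_cast h3
    calc #(B - B) * ω ≤ ∑ d ∈ B - B, #(Nb d) * pm := by
          rw [← nsmul_eq_mul]; exact card_nsmul_le_sum _ _ _ h2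
      _ = (∑ d ∈ B - B, (#(Nb d) : ℝ)) * pm := by rw [sum_mul]
      _ ≤ #Λ * #Λ * pm := by gcongr
      _ ≤ N * N * pm := by
          have : (0 : ℝ) ≤ N := (Nat.cast_nonneg _).trans hN
          gcongr
      _ = _ := by ring

end Structure

section LargeSet
open ProbabilityTheory

variable {ν μ : Measure ℝ} {φ : ℝ → ℝ}

theorem measureReal_univ_le_one {α : Type*} [MeasurableSpace α] {μ : Measure α}
    (hμ : μ Set.univ ≤ 1) : μ.real Set.univ ≤ 1 :=
  ENNReal.toReal_le_of_le_ofReal zero_le_one (by simpa using hμ)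

theorem gaussianReal_real_floor_le {x R g m : ℝ} (hm : 0 < m) (hR : 0 < R) (hg : 0 < g)
    (hx : m⁻¹ ≤ x) (b : ℤ) :
    (gaussianReal 0 1).real {a | ⌊x * (R * a) / g⌋ = b} ≤ m * g / R := by
  have hx0 : 0 < x := (inv_pos.2 hm).trans_le hx
  have hxR : 0 < x * R / g := by positivity
  have hset : {a | ⌊x * (R * a) / g⌋ = b} =
      Set.Ico (b / (x * R / g)) ((b + 1) / (x * R / g)) := by
    ext a
    have : x * (R * a) / g = a * (x * R / g) := by ring
    rw [Set.mem_ofPred_eq, Set.mem_Ico, Int.floor_eq_iff, div_le_iff₀ hxR, lt_div_iff₀ hxR, this]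
  rw [hset]
  refine (gaussianReal_real_Ico_le (by gcongr; linarith)).trans ?_
  calc (b + 1) / (x * R / g) - b / (x * R / g) = x⁻¹ * g / R := by field_simp; ring
    _ ≤ m * g / R := by
      gcongr
      exact inv_le_of_inv_le₀ hm hx

theorem PosSpectrum.measurable_average (h : PosSpectrum ν φ) [IsFiniteMeasure μ] (R : ℝ) :
    Measurable fun a => ∫ x, φ (x * (R * a)) ∂μ :=
  (h.measurable.comp (by fun_prop : Measurable fun p : ℝ × ℝ => p.2 * (R * p.1))
    ).stronglyMeasurable.integral_prod_right'.measurable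

/-- The mean square over a Gaussian of averages of `φ` is controlled by the set where the averages
are large. -/
theorem PosSpectrum.integral_sq_le (h : PosSpectrum ν φ) (hμ : μ Set.univ ≤ 1) {m R θ H : ℝ}
    (hm : 1 ≤ m) (hR : 0 ≤ R) (hθ : 0 ≤ θ) (hμm : ∀ᵐ x ∂μ, x ∈ Set.Icc m⁻¹ m) :
    ∫ a, (∫ x, φ (x * (R * a)) ∂μ) ^ 2 ∂(gaussianReal 0 1) ≤
      (gaussianReal 0 1).real {a | |a| ≤ H ∧ θ ≤ ∫ x, φ (x * (R * a)) ∂μ} +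
        θ * (m * gaussAvg ν R) + 2 * Real.exp (1 / 2 - H) := by
  have : IsFiniteMeasure μ := ⟨hμ.trans_lt ENNReal.one_lt_top⟩
  have : IsFiniteMeasure ν := h.isFiniteMeasure
  have hμ1 := measureReal_univ_le_one hμ
  set G : ℝ → ℝ := fun a => ∫ x, φ (x * (R * a)) ∂μ with hG
  set γ := gaussianReal 0 1 with hγ
  have hφm : Measurable fun p : ℝ × ℝ => φ (p.2 * (R * p.1)) := h.measurable.comp (by fun_prop)
  have hGm : Measurable G := h.measurable_average R
  have hG0 : ∀ a, 0 ≤ G a := fun a => integral_nonneg fun x => h.nonneg _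
  have hG1 : ∀ a, G a ≤ 1 := fun a => by
    have h1 : G a ≤ ∫ _, (1 : ℝ) ∂μ := integral_mono
      (integrable_of_abs_le (hφm.comp measurable_prodMk_left) 1 fun x => h.abs_le_one _)
      (integrable_const _) fun x => h.le_one _
    rw [integral_const, smul_eq_mul, mul_one] at h1
    exact h1.trans hμ1
  have hGabs : ∀ a, |G a| ≤ 1 := fun a => by rw [abs_of_nonneg (hG0 a)]; exact hG1 a
  have hGi : Integrable G γ := integrable_of_abs_le hGm 1 hGabs
  have hmean : ∫ a, G a ∂γ ≤ m * gaussAvg ν R := by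
    rw [hG, integral_integral_swap (f := fun a x => φ (x * (R * a)))
      (integrable_of_abs_le hφm 1 fun p => h.abs_le_one _)]
    have h1 : ∫ x, ∫ a, φ (x * (R * a)) ∂γ ∂μ ≤ ∫ _, m * gaussAvg ν R ∂μ := by
      refine integral_mono_of_nonneg (Filter.Eventually.of_forall fun x =>
        integral_nonneg fun a => h.nonneg _) (integrable_const _) ?_
      filter_upwards [hμm] with x hx
      have h2 : ∀ a, x * (R * a) = x * R * a := fun a => by ring
      simp only [h2]
      rw [h.integral_gaussian_eq]
      exact h.gaussAvg_mul_le hm hR hx.1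
    rw [integral_const, smul_eq_mul] at h1
    refine h1.trans ?_
    have := mul_nonneg (zero_le_one.trans hm) (gaussAvg_nonneg (ν := ν) R)
    nlinarith
  set Z : Set ℝ := {a | |a| ≤ H ∧ θ ≤ G a} with hZ
  have hZm : MeasurableSet Z :=
    (measurableSet_le measurable_abs measurable_const).inter (measurableSet_le measurable_const hGm)
  set W : Set ℝ := {a | H < |a|} with hW
  have hWm : MeasurableSet W := measurableSet_lt measurable_const (by fun_prop)
  calc ∫ a, G a ^ 2 ∂γ
      ≤ ∫ a, (Z.indicator (fun _ => 1) a + θ * G a + W.indicator (fun _ => 1) a) ∂γ := by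
        refine integral_mono (integrable_of_abs_le (hGm.pow_const 2) 1 fun a => by
          rw [abs_pow]; exact pow_le_one₀ (abs_nonneg _) (hGabs a))
          ((((integrable_const _).indicator hZm).add (hGi.const_mul _)).add
            ((integrable_const _).indicator hWm)) fun a => ?_
        have h1 : G a ^ 2 ≤ 1 := pow_le_one₀ (hG0 a) (hG1 a)
        have h2 : 0 ≤ θ * G a := mul_nonneg hθ (hG0 a)
        by_cases haW : a ∈ W
        · have h3 : 0 ≤ Z.indicator (fun _ => (1 : ℝ)) a :=
            Set.indicator_nonneg (fun _ _ => zero_le_one) _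
          simp only [Set.indicator_of_mem haW]
          linarith
        · simp only [Set.indicator_of_notMem haW]
          by_cases haZ : a ∈ Z
          · simp only [Set.indicator_of_mem haZ]
            linarith
          · simp only [Set.indicator_of_notMem haZ]
            have h3 : G a < θ := by
              by_contra! hcon
              exact haZ ⟨not_lt.1 haW, hcon⟩
            nlinarith [hG0 a]
    _ = γ.real Z + θ * ∫ a, G a ∂γ + γ.real W := by
        have hi : Integrable (fun a => Z.indicator (fun _ => (1 : ℝ)) a + θ * G a) γ :=
          ((integrable_const _).indicator hZm).add (hGi.const_mul _)
        rw [integral_add hi ((integrable_const _).indicator hWm), integral_add ((integrable_const _).indicator hZm)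
          (hGi.const_mul _), integral_indicator_const _ hZm, integral_indicator_const _ hWm,
          integral_const_mul]
        simp
    _ ≤ _ := by
        gcongr
        exact gaussianReal_tail H

end LargeSet

section LatticeStructure
open ProbabilityTheory
open scoped Finset Pointwise

variable {ν μ : Measure ℝ} {φ : ℝ → ℝ}

theorem PosSpectrum.exists_lattice_set (h : PosSpectrum ν φ) {L : ℝ} (hL : ∀ᵐ q ∂ν, |q| ≤ L)
    (hL0 : 0 ≤ L) (hμ : μ Set.univ ≤ 1) {m R g H θ z ε ω N : ℝ} {M T : ℕ} (hm : 1 ≤ m)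
    (hμm : ∀ᵐ x ∂μ, x ∈ Set.Icc m⁻¹ m) (hR : 0 < R) (hg : 0 < g)
    (hz : (gaussianReal 0 1).real {a | |a| ≤ H ∧ θ ≤ ∫ x, φ (x * (R * a)) ∂μ} = z) (hz0 : 0 < z)
    (hM : m * (R * H) / g + 1 ≤ M) (hε : 0 < ε) (hLg : L * g ≤ ε / 2) (hθ : L * g ≤ θ)
    (hθε : 2 * ε ≤ (θ - L * g) ^ 2) (hT : T ≠ 0) (hω : 0 ≤ ω)
    (hMω : (2 * M + 1 : ℝ) ^ 2 * ω ^ T ≤ ε ^ T / 2) (hRM : R ≤ g * (2 * M + 1))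
    (hN : 12 * (2 * M + 1) * gaussAvg ν R ≤ N * ε) :
    ∃ t : ℤ, ∃ B ⊆ Finset.Icc (-(M : ℤ)) M, (∀ b ∈ B, ε ≤ φ (g * (t - b))) ∧ #B ≤ N ∧
      z * (ε ^ T / 2) ≤ #B * (m * g / R) ∧ #(B - B) * ω ≤ N ^ 2 * (m * g / R / z) ∧
      ∃ x₀ ∈ Set.Icc m⁻¹ m, ∃ X : Set ℝ, (ε ^ T / 2) ^ 2 / 4 ≤ μ.real X ∧
        ∀ x ∈ X, x ∈ Set.Icc m⁻¹ m → z * ((ε ^ T / 2) ^ 2 / 4) ≤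
          #{b ∈ B | ∃ b₀ ∈ B, |(b₀ : ℝ) - x₀ / x * (b : ℤ)| ≤ 1 + x₀ / x} * (m * g / R) := by
  have : IsFiniteMeasure μ := ⟨hμ.trans_lt ENNReal.one_lt_top⟩
  have : IsFiniteMeasure ν := h.isFiniteMeasure
  have hm0 : 0 < m := by linarith
  have hμ1 := measureReal_univ_le_one hμ
  set γ := gaussianReal 0 1 with hγ
  set G : ℝ → ℝ := fun a => ∫ x, φ (x * (R * a)) ∂μ with hG
  set Z : Set ℝ := {a | |a| ≤ H ∧ θ ≤ G a} with hZ
  have hZm : MeasurableSet Z := (measurableSet_le measurable_abs measurable_const).inter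
    (measurableSet_le measurable_const (h.measurable_average R))
  set ρ := γ.restrict Z with hρ
  have hρz : ρ.real Set.univ = z := by rw [hρ, measureReal_restrict_apply MeasurableSet.univ,
    Set.univ_inter, hz]
  set κ : ℝ × ℝ → ℤ := fun p => ⌊p.2 * (R * p.1) / g⌋ with hκ
  have hκm : Measurable κ := Int.measurable_floor.comp (by fun_prop)
  have hκb : ∀ᵐ p ∂(ρ.prod μ), p.1 ∈ Z ∧ p.2 ∈ Set.Icc m⁻¹ m := by
    have h1 : ∀ᵐ p ∂(ρ.prod μ), p.1 ∈ Z := Measure.quasiMeasurePreserving_fst.ae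
      (by rw [hρ]; exact ae_restrict_mem hZm)
    have h2 : ∀ᵐ p ∂(ρ.prod μ), p.2 ∈ Set.Icc m⁻¹ m := Measure.quasiMeasurePreserving_snd.ae hμm
    filter_upwards [h1, h2] with p hp1 hp2 using ⟨hp1, hp2⟩
  have hκM : ∀ᵐ p ∂(ρ.prod μ), κ p ∈ Finset.Icc (-(M : ℤ)) M := by
    filter_upwards [hκb] with p hp
    have hx0 : 0 < p.2 := (inv_pos.2 hm0).trans_le hp.2.1
    have h1 : |p.2 * (R * p.1) / g| ≤ m * (R * H) / g := by
      rw [abs_div, abs_mul, abs_mul, abs_of_pos hg, abs_of_pos hR, abs_of_pos hx0]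
      gcongr
      · exact hp.2.2
      · exact hp.1.1
    rw [abs_le] at h1
    have e1 := Int.floor_le (p.2 * (R * p.1) / g)
    have e2 := Int.lt_floor_add_one (p.2 * (R * p.1) / g)
    have f1 : ((-(M : ℤ) : ℤ) : ℝ) ≤ (κ p : ℝ) := by push_cast; linarith
    have f2 : (κ p : ℝ) ≤ ((M : ℤ) : ℝ) := by push_cast; linarith
    exact Finset.mem_Icc.2 ⟨by exact_mod_cast f1, by exact_mod_cast f2⟩
  have hPz : (ρ.prod μ).real Set.univ ≤ z := by
    rw [← Set.univ_prod_univ, measureReal_prod_prod, hρz]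
    nlinarith
  have havg : z * (θ - L * g) ≤ ∫ p, φ (g * κ p) ∂(ρ.prod μ) := by
    have hφm : Measurable fun p : ℝ × ℝ => φ (p.2 * (R * p.1)) := h.measurable.comp (by fun_prop)
    have hφi : Integrable (fun p : ℝ × ℝ => φ (p.2 * (R * p.1))) (ρ.prod μ) :=
      integrable_of_abs_le hφm 1 fun p => h.abs_le_one _
    have h1 : z * θ ≤ ∫ p, φ (p.2 * (R * p.1)) ∂(ρ.prod μ) := by
      rw [integral_prod _ hφi]
      calc z * θ = ∫ _, θ ∂ρ := by rw [integral_const, hρz, smul_eq_mul]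
        _ ≤ _ := by
          refine integral_mono_ae (integrable_const _) hφi.integral_prod_left ?_
          filter_upwards [ae_restrict_mem hZm] with a ha using ha.2
    have hφκ : Integrable (fun p => φ (g * κ p)) (ρ.prod μ) :=
      integrable_of_abs_le (h.measurable.comp ((measurable_from_top.comp hκm).const_mul g)) 1
        fun p => h.abs_le_one _
    have h2 : ∫ p, φ (p.2 * (R * p.1)) ∂(ρ.prod μ) ≤ ∫ p, (φ (g * κ p) + L * g) ∂(ρ.prod μ) := by
      refine integral_mono hφi (hφκ.add (integrable_const _)) fun p => ?_
      have h3 := h.abs_sub_le hL hL0 (p.2 * (R * p.1)) (g * κ p)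
      have h4 : |p.2 * (R * p.1) - g * κ p| ≤ g := by
        have e1 := Int.floor_le (p.2 * (R * p.1) / g)
        have e2 := Int.lt_floor_add_one (p.2 * (R * p.1) / g)
        rw [le_div_iff₀ hg] at e1
        rw [div_lt_iff₀ hg] at e2
        rw [abs_le]
        constructor <;> linarith
      have h5 := (abs_le.1 (h3.trans (mul_le_mul_of_nonneg_left h4 hL0))).2
      simp only
      linarith
    rw [integral_add hφκ (integrable_const _), integral_const, smul_eq_mul] at h2
    have h3 : (ρ.prod μ).real Set.univ * (L * g) ≤ z * (L * g) := by gcongr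
    linarith
  have hfib : ∀ x ∈ Set.Icc m⁻¹ m, ∀ b : ℤ, ρ.real {a | κ (a, x) = b} ≤ m * g / R := by
    intro x hx b
    have h1 : ρ.real {a | κ (a, x) = b} ≤ γ.real {a | κ (a, x) = b} :=
      ENNReal.toReal_mono (measure_ne_top _ _) (Measure.restrict_le_self _)
    exact h1.trans (gaussianReal_real_floor_le hm0 hR hg hx.1 b)
  have hpm : ∀ b, (ρ.prod μ).real (κ ⁻¹' {b}) ≤ z * (m * g / R / z) := by
    intro b
    have hbm : MeasurableSet (κ ⁻¹' {b}) := hκm (MeasurableSet.singleton b)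
    rw [mul_div_cancel₀ _ hz0.ne']
    have h0 : 0 ≤ m * g / R := by positivity
    refine ENNReal.toReal_le_of_le_ofReal h0 ?_
    rw [Measure.prod_apply_symm hbm]
    calc ∫⁻ x, ρ ((fun a => (a, x)) ⁻¹' (κ ⁻¹' {b})) ∂μ ≤ ∫⁻ _, ENNReal.ofReal (m * g / R) ∂μ := by
          refine lintegral_mono_ae ?_
          filter_upwards [hμm] with x hx
          have h1 := hfib x hx b
          rw [← ENNReal.ofReal_le_ofReal_iff h0, ofReal_measureReal] at h1
          exact h1
      _ ≤ _ := by
          rw [lintegral_const]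
          exact mul_le_of_le_one_right' hμ
  have hΛ : (#{d ∈ Finset.Icc (-(2 * M : ℤ)) (2 * M) | ε ≤ φ (g * (d : ℤ))} : ℝ) ≤ N := by
    have hD : 0 < g * (2 * M + 1 : ℝ) := by positivity
    have h1 := h.card_mul_le hL hL0 (s := {d ∈ Finset.Icc (-(2 * M : ℤ)) (2 * M) |
      ε ≤ φ (g * (d : ℤ))}) (x := 0) (y := 0) (D := 2 * M) hg hD hε.le hLg le_rfl (by
        intro b hb
        rw [Finset.mem_filter, Finset.mem_Icc] at hb
        have f1 : ((-(2 * M : ℤ) : ℤ) : ℝ) ≤ b := by exact_mod_cast hb.1.1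
        have f2 : (b : ℝ) ≤ ((2 * M : ℤ) : ℝ) := by exact_mod_cast hb.1.2
        push_cast at f1 f2
        rw [sub_zero, abs_le, zero_add]
        exact ⟨⟨f1, f2⟩, hb.2⟩)
    have h2 := gaussAvg_anti (ν := ν) hR.le hRM
    refine le_of_mul_le_mul_right ?_ (mul_pos hε hg)
    calc _ ≤ _ := h1
      _ ≤ 12 * (g * (2 * M + 1)) * gaussAvg ν R := by gcongr
      _ = 12 * (2 * M + 1) * gaussAvg ν R * g := by ring
      _ ≤ N * ε * g := by gcongr
      _ = _ := by ring
  obtain ⟨t, B, hBM, htB, hBN, hBS, hBz, hBB⟩ := h.exists_card_sub_mul_le hκm hκM hz0 hPz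
    (sub_nonneg.2 hθ) hε hθε havg hpm hT hω hMω hΛ
  obtain ⟨x₀, hx₀, hX⟩ := exists_popular_fibre (ρ := ρ) hμ (S := κ ⁻¹' B) (E := Set.Icc m⁻¹ m)
    (hκm B.measurableSet) hμm hz0 hρz.le (δ := ε ^ T / 2) (by positivity) hBS
  rw [mul_div_cancel₀ _ hz0.ne'] at hBz
  refine ⟨t, B, hBM, htB, hBN, hBz, hBB, x₀, hx₀, _, hX, fun x hx hxm => ?_⟩
  have hx0 : 0 < x := (inv_pos.2 hm0).trans_le hxm.1
  have hx₀0 : 0 < x₀ := (inv_pos.2 hm0).trans_le hx₀.1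
  set Y := {b ∈ B | ∃ b₀ ∈ B, |(b₀ : ℝ) - x₀ / x * (b : ℤ)| ≤ 1 + x₀ / x} with hY
  have hsub : {a | (a, x) ∈ κ ⁻¹' B ∧ (a, x₀) ∈ κ ⁻¹' B} ⊆
      ⋃ b ∈ Y, {a | κ (a, x) = b} := by
    rintro a ⟨ha, ha₀⟩
    refine Set.mem_biUnion (x := κ (a, x)) ?_ rfl
    refine Finset.mem_filter.2 ⟨ha, _, ha₀, ?_⟩
    have e1 := Int.floor_le (x * (R * a) / g)
    have e2 := Int.lt_floor_add_one (x * (R * a) / g)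
    have e3 := Int.floor_le (x₀ * (R * a) / g)
    have e4 := Int.lt_floor_add_one (x₀ * (R * a) / g)
    have e5 : x₀ * (R * a) / g = x₀ / x * (x * (R * a) / g) := by field_simp
    have hq : 0 < x₀ / x := by positivity
    have f1 := mul_le_mul_of_nonneg_left e1 hq.le
    have f2 := mul_le_mul_of_nonneg_left e2.le hq.le
    rw [abs_le]
    simp only [hκ]
    constructor <;> linarith
  calc _ ≤ _ := hx
    _ ≤ ρ.real (⋃ b ∈ Y, {a | κ (a, x) = b}) := measureReal_mono hsub (measure_ne_top _ _)
    _ ≤ ∑ b ∈ Y, ρ.real {a | κ (a, x) = b} := measureReal_biUnion_finset_le _ _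
    _ ≤ ∑ _ ∈ Y, m * g / R := Finset.sum_le_sum fun b _ => hfib x hxm b
    _ = _ := by rw [Finset.sum_const, nsmul_eq_mul]

end LatticeStructure

section StructuredSet
open ProbabilityTheory
open scoped Finset Pointwise

variable {ν μ : Measure ℝ} {φ : ℝ → ℝ}

set_option maxHeartbeats 1600000 in
/-- If averaging over multiplicative translates barely decreases the Gaussian mean of `φ`, then
the large values of `φ` contain an approximately additively closed set on which many ratios act. -/
theorem PosSpectrum.exists_structured_set (h : PosSpectrum ν φ) {L m Q : ℝ} {T : ℕ} (hT : 5 ≤ T)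
    (hQ : 64 ≤ Q) (hexp : 2 * Real.exp (1 / 2 - Q ^ T) * Q ^ (T ^ 2 + 2) ≤ 1)
    (hL : ∀ᵐ q ∂ν, |q| ≤ L) (hL0 : 0 ≤ L) (hLQ : L ≤ Q) (hμ : μ Set.univ ≤ 1) (hm : 1 ≤ m)
    (hmQ : m ≤ Q) (hμm : ∀ᵐ x ∂μ, x ∈ Set.Icc m⁻¹ m) (hn : (Q ^ T ^ 2)⁻¹ ≤ gaussAvg ν (Q ^ T ^ 2))
    (hlarge : Q⁻¹ * gaussAvg ν (Q ^ T ^ 2) ≤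
      ∫ a, (∫ x, φ (x * (Q ^ T ^ 2 * a)) ∂μ) ^ 2 ∂(gaussianReal 0 1)) :
    ∃ (t : ℤ) (B : Finset ℤ) (M : ℕ), B.Nonempty ∧ 1 ≤ M ∧ (M : ℝ) ≤ Q ^ (T ^ 2 + T + 11) ∧
      (∀ b ∈ B, |(b : ℝ)| ≤ M) ∧ (∀ b ∈ B, (Q ^ 7)⁻¹ ≤ φ ((Q ^ 9)⁻¹ * (t - b))) ∧
      Q ^ T ^ 2 * gaussAvg ν (Q ^ T ^ 2) ≤ Q ^ (7 * T) * #B ∧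
      (#(B + B) : ℝ) ≤ Q ^ (100 * T) * #B ∧
      ∃ x₀ ∈ Set.Icc m⁻¹ m, ∃ X : Set ℝ, (Q ^ (15 * T))⁻¹ ≤ μ.real X ∧
        ∀ x ∈ X, x ∈ Set.Icc m⁻¹ m → x₀ / x ∈ actSet B (Q ^ (100 * T)) := by
  have hQ0 : 0 < Q := by linarith
  have hQ1 : 1 ≤ Q := by linarith
  have hm0 : 0 < m := by linarith
  set R := Q ^ T ^ 2 with hRdef
  have hR : 0 < R := by positivity
  set n := gaussAvg ν R with hndef
  have hn0 : 0 < n := (inv_pos.2 hR).trans_le hn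
  have hpow : ∀ {a b : ℕ}, a ≤ b → Q ^ a ≤ Q ^ b := fun h => pow_le_pow_right₀ hQ1 h
  set z := (gaussianReal 0 1).real {a | |a| ≤ Q ^ T ∧ (Q ^ 3)⁻¹ ≤ ∫ x, φ (x * (R * a)) ∂μ} with hz
  have hzn : n ≤ 2 * Q * z := by
    have h1 := h.integral_sq_le hμ hm hR.le (inv_nonneg.2 (pow_nonneg hQ0.le 3)) hμm (H := Q ^ T)
    have h2 : 2 * Real.exp (1 / 2 - Q ^ T) ≤ (Q ^ 2)⁻¹ * n := by
      refine le_trans ?_ (mul_le_mul_of_nonneg_left hn (by positivity))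
      rw [← mul_inv, le_inv_comm₀ (by positivity) (by positivity), ← one_div, le_div_iff₀
        (by positivity)]
      calc _ = 2 * Real.exp (1 / 2 - Q ^ T) * Q ^ (T ^ 2 + 2) := by rw [pow_add, hRdef]; ring
        _ ≤ 1 := hexp
    have h3 : (Q ^ 3)⁻¹ * (m * n) ≤ (Q ^ 2)⁻¹ * n := by
      calc (Q ^ 3)⁻¹ * (m * n) ≤ (Q ^ 3)⁻¹ * (Q * n) := by gcongr
        _ = _ := by field_simp
    have h4 : Q⁻¹ * n ≤ z + 2 * ((Q ^ 2)⁻¹ * n) := by linarith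
    have h5 := mul_le_mul_of_nonneg_left h4 hQ0.le
    have h6 : Q * (Q⁻¹ * n) = n := by field_simp
    have h7 : Q * (z + 2 * ((Q ^ 2)⁻¹ * n)) = Q * z + 2 * n / Q := by field_simp
    have h8 : 2 * n / Q ≤ n / 2 := by
      rw [div_le_div_iff₀ hQ0 two_pos]; nlinarith
    linarith
  have hz0 : 0 < z := by
    by_contra! hcon
    nlinarith
  set M := ⌈m * (R * Q ^ T) / (Q ^ 9)⁻¹⌉₊ + 1 with hMdef
  have hM1 : m * (R * Q ^ T) / (Q ^ 9)⁻¹ + 1 ≤ M := by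
    rw [hMdef]; push_cast; linarith [Nat.le_ceil (m * (R * Q ^ T) / (Q ^ 9)⁻¹)]
  have hX1 : m * (R * Q ^ T) / (Q ^ 9)⁻¹ ≤ Q ^ (T ^ 2 + T + 10) := by
    rw [div_inv_eq_mul]
    calc m * (R * Q ^ T) * Q ^ 9 ≤ Q * (R * Q ^ T) * Q ^ 9 := by gcongr
      _ = _ := by rw [hRdef]; ring
  have hM2 : (2 * M + 1 : ℝ) ≤ Q ^ (T ^ 2 + T + 11) := by
    have h1 := (Nat.ceil_lt_add_one (a := m * (R * Q ^ T) / (Q ^ 9)⁻¹) (by positivity)).le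
    have h2 : (1 : ℝ) ≤ Q ^ (T ^ 2 + T + 10) := one_le_pow₀ hQ1
    have h3 : Q ^ (T ^ 2 + T + 11) = Q * Q ^ (T ^ 2 + T + 10) := by ring
    rw [h3, hMdef]
    push_cast
    nlinarith
  have hεT : ((Q ^ 7)⁻¹) ^ T = (Q ^ (7 * T))⁻¹ := by rw [inv_pow, ← pow_mul]
  have hu0 : 0 < (Q ^ 8)⁻¹ := by positivity
  have hQ7 : (Q ^ 7)⁻¹ = Q * (Q ^ 8)⁻¹ := by field_simp
  have hLg : L * (Q ^ 9)⁻¹ ≤ (Q ^ 8)⁻¹ := by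
    calc L * (Q ^ 9)⁻¹ ≤ Q * (Q ^ 9)⁻¹ := by gcongr
      _ = _ := by field_simp
  have hQ3 : 2 * (Q ^ 8)⁻¹ ≤ (Q ^ 3)⁻¹ := by
    have e1 : (Q ^ 3)⁻¹ = Q ^ 5 * (Q ^ 8)⁻¹ := by field_simp
    rw [e1]
    have : (2 : ℝ) ≤ Q ^ 5 := by linarith [le_self_pow₀ hQ1 (show (5 : ℕ) ≠ 0 by norm_num)]
    gcongr
  have hθ : 2 * (Q ^ 7)⁻¹ ≤ ((Q ^ 3)⁻¹ - L * (Q ^ 9)⁻¹) ^ 2 := by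
    have h1 : (Q ^ 3)⁻¹ / 2 ≤ (Q ^ 3)⁻¹ - L * (Q ^ 9)⁻¹ := by linarith
    refine le_trans ?_ (pow_le_pow_left₀ (by positivity) h1 2)
    have e1 : ((Q ^ 3)⁻¹ / 2) ^ 2 = Q * (Q ^ 7)⁻¹ / 4 := by field_simp; norm_num
    rw [e1]
    have : 0 < (Q ^ 7)⁻¹ := by positivity
    nlinarith
  have hMω : (2 * M + 1 : ℝ) ^ 2 * ((Q ^ (4 * T + 7))⁻¹) ^ T ≤ ((Q ^ 7)⁻¹) ^ T / 2 := by
    rw [hεT, inv_pow, ← pow_mul, ← div_eq_mul_inv, div_le_div_iff₀ (by positivity) two_pos,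
      ← div_eq_inv_mul, le_div_iff₀ (by positivity)]
    calc (2 * M + 1 : ℝ) ^ 2 * 2 * Q ^ (7 * T)
        ≤ (Q ^ (T ^ 2 + T + 11)) ^ 2 * Q * Q ^ (7 * T) := by gcongr; linarith
      _ = Q ^ (2 * T ^ 2 + 9 * T + 23) := by ring
      _ ≤ _ := hpow (by nlinarith)
  have hRM : R ≤ (Q ^ 9)⁻¹ * (2 * M + 1) := by
    have h1 : m * (R * Q ^ T) / (Q ^ 9)⁻¹ ≤ 2 * M + 1 := by
      linarith [Nat.cast_nonneg (α := ℝ) M]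
    rw [div_le_iff₀ (by positivity)] at h1
    have h2 : R * 1 ≤ m * (R * Q ^ T) := by
      calc R * 1 ≤ R * Q ^ T := by gcongr; exact one_le_pow₀ hQ1
        _ ≤ m * (R * Q ^ T) := le_mul_of_one_le_left (by positivity) hm
    linarith
  have hN : 12 * (2 * M + 1) * n ≤ Q ^ (T ^ 2 + T + 19) * n * (Q ^ 7)⁻¹ := by
    calc 12 * (2 * M + 1) * n ≤ Q * Q ^ (T ^ 2 + T + 11) * n := by gcongr; linarith
      _ = _ := by field_simp; ring
  obtain ⟨t, B, hBM, htB, hBN, hBz, hBB, x₀, hx₀, X, hX, hXx⟩ := h.exists_lattice_set hL hL0 hμ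
    (m := m) (R := R) (g := (Q ^ 9)⁻¹) (H := Q ^ T) (θ := (Q ^ 3)⁻¹) (ε := (Q ^ 7)⁻¹)
    (ω := (Q ^ (4 * T + 7))⁻¹) (N := Q ^ (T ^ 2 + T + 19) * n) (M := M) (T := T) hm hμm hR
    (by positivity) hz.symm hz0 hM1 (by positivity)
    (by rw [hQ7]; nlinarith) (by linarith) hθ (by omega) (by positivity) hMω hRM hN
  have hmg : m * (Q ^ 9)⁻¹ ≤ (Q ^ 8)⁻¹ := by
    calc m * (Q ^ 9)⁻¹ ≤ Q * (Q ^ 9)⁻¹ := by gcongr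
      _ = _ := by field_simp
  have hmgR : ∀ y : ℝ, 0 ≤ y → y * (m * (Q ^ 9)⁻¹ / R) * (R * Q ^ 8) ≤ y := fun y hy => by
    calc y * (m * (Q ^ 9)⁻¹ / R) * (R * Q ^ 8) ≤ y * ((Q ^ 8)⁻¹ / R) * (R * Q ^ 8) := by gcongr
      _ = y := by field_simp
  have hBlow : R * n ≤ Q ^ (7 * T) * #B := by
    have h1 := mul_le_mul_of_nonneg_right hBz (show 0 ≤ R * Q ^ 8 by positivity)
    have h2 := h1.trans (hmgR _ (Nat.cast_nonneg _))
    rw [hεT] at h2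
    calc R * n ≤ R * (2 * Q * z) := by gcongr
      _ ≤ R * (Q ^ 8 / 2 * z) := by
        have : 2 * Q ≤ Q ^ 8 / 2 := by
          have h3 : Q ^ 2 ≤ Q ^ 8 := hpow (by norm_num)
          nlinarith
        gcongr
      _ = Q ^ (7 * T) * (z * ((Q ^ (7 * T))⁻¹ / 2) * (R * Q ^ 8)) := by
        have e1 : Q ^ (7 * T) * (Q ^ (7 * T))⁻¹ = 1 := mul_inv_cancel₀ (by positivity)
        linear_combination -(R * Q ^ 8 * z / 2) * e1
      _ ≤ _ := by gcongr
  have hBpos : (0 : ℝ) < #B := by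
    have : 0 < Q ^ (7 * T) * #B := lt_of_lt_of_le (by positivity) hBlow
    exact (pos_iff_pos_of_mul_pos this).1 (by positivity)
  have hBne : B.Nonempty := Finset.card_pos.1 (by exact_mod_cast hBpos)
  have hBsub : (#(B - B) : ℝ) ≤ Q ^ (13 * T + 39) * #B := by
    rw [← div_eq_mul_inv, div_le_iff₀ (by positivity)] at hBB
    have h1 : m * (Q ^ 9)⁻¹ / R / z ≤ 2 * Q * (Q ^ 8)⁻¹ / (R * n) := by
      rw [div_div, div_le_div_iff₀ (by positivity) (by positivity)]
      calc m * (Q ^ 9)⁻¹ * (R * n) ≤ (Q ^ 8)⁻¹ * (R * (2 * Q * z)) := by gcongr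
        _ = _ := by ring
    have h2 : ∀ c A : ℝ, 0 < A → A ^ 2 * (c / A) = c * A := fun c A hA => by field_simp
    have h3 : Q ^ 8 * (Q ^ 8)⁻¹ = 1 := mul_inv_cancel₀ (by positivity)
    calc (#(B - B) : ℝ) ≤ (Q ^ (T ^ 2 + T + 19) * n) ^ 2 * (m * (Q ^ 9)⁻¹ / R / z) *
          Q ^ (4 * T + 7) := hBB
      _ ≤ (Q ^ (T ^ 2 + T + 19) * n) ^ 2 * (2 * Q * (Q ^ 8)⁻¹ / (R * n)) * Q ^ (4 * T + 7) := by
        gcongr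
      _ = Q ^ (2 * T + 38) * ((R * n) ^ 2 * (2 * Q * (Q ^ 8)⁻¹ / (R * n))) * Q ^ (4 * T + 7) := by
        rw [hRdef]; ring
      _ = 2 * Q ^ (6 * T + 38) * (Q ^ 8 * (Q ^ 8)⁻¹) * (R * n) := by
        rw [h2 _ _ (by positivity)]; ring
      _ = 2 * Q ^ (6 * T + 38) * (R * n) := by rw [h3, mul_one]
      _ ≤ Q * Q ^ (6 * T + 38) * (Q ^ (7 * T) * #B) := by gcongr; linarith
      _ = _ := by ring
  refine ⟨t, B, M, hBne, by omega, by linarith [Nat.cast_nonneg (α := ℝ) M], ?_, htB, hBlow, ?_,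
    x₀, hx₀, X, ?_, ?_⟩
  · intro b hb
    have hb := Finset.mem_Icc.1 (hBM hb)
    rw [abs_le]
    exact ⟨by exact_mod_cast hb.1, by exact_mod_cast hb.2⟩
  · refine (card_add_self_le hBne hBsub).trans ?_
    rw [← pow_mul]
    exact mul_le_mul_of_nonneg_right (hpow (by omega)) hBpos.le
  · refine le_trans ?_ hX
    rw [hεT]
    calc (Q ^ (15 * T))⁻¹ = (Q ^ (14 * T))⁻¹ * (Q ^ T)⁻¹ := by rw [← mul_inv, ← pow_add]; ring_nf
      _ ≤ (Q ^ (14 * T))⁻¹ * 16⁻¹ := by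
        gcongr
        linarith [le_self_pow₀ hQ1 (show T ≠ 0 by omega)]
      _ = _ := by
        have e1 : Q ^ (14 * T) = Q ^ (7 * T) * Q ^ (7 * T) := by ring
        rw [e1, mul_inv]
        ring
  · intro x hx hxm
    have hx0 : 0 < x := (inv_pos.2 hm0).trans_le hxm.1
    have hx₀0 : 0 < x₀ := (inv_pos.2 hm0).trans_le hx₀.1
    set ξ := x₀ / x with hξ
    have hξ0 : 0 < ξ := div_pos hx₀0 hx0
    have hξQ : ξ ≤ Q ^ 2 := by
      calc ξ = x₀ * x⁻¹ := div_eq_mul_inv _ _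
        _ ≤ Q * Q := by
          gcongr
          · exact hx₀.2.trans hmQ
          · exact (inv_le_of_inv_le₀ hm0 hxm.1).trans hmQ
        _ = Q ^ 2 := by ring
    have hξQ' : ξ⁻¹ ≤ Q ^ 2 := by
      calc ξ⁻¹ = x * x₀⁻¹ := by rw [hξ, inv_div, div_eq_mul_inv]
        _ ≤ Q * Q := by
          gcongr
          · exact hxm.2.trans hmQ
          · exact (inv_le_of_inv_le₀ hm0 hx₀.1).trans hmQ
        _ = Q ^ 2 := by ring
    have hY := hXx x hx hxm
    set Y := {b ∈ B | ∃ b₀ ∈ B, |(b₀ : ℝ) - ξ * (b : ℤ)| ≤ 1 + ξ} with hYdef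
    set w := ⌈Q ^ 2⌉₊ + 1 with hw
    have hwQ : Q ^ 2 ≤ ⌈Q ^ 2⌉₊ := Nat.le_ceil _
    have hwQ' : (⌈Q ^ 2⌉₊ : ℝ) ≤ Q ^ 2 + 1 := (Nat.ceil_lt_add_one (by positivity)).le
    have hYlow : R * n ≤ Q ^ (14 * T) * #Y := by
      have h1 := mul_le_mul_of_nonneg_right hY (show 0 ≤ R * Q ^ 8 by positivity)
      have h2 := h1.trans (hmgR _ (Nat.cast_nonneg _))
      rw [hεT] at h2
      calc R * n ≤ R * (2 * Q * z) := by gcongr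
        _ ≤ R * (Q ^ 8 / 16 * z) := by
          have : 2 * Q ≤ Q ^ 8 / 16 := by
            have h3 : Q ^ 2 ≤ Q ^ 8 := hpow (by norm_num)
            nlinarith
          gcongr
        _ = Q ^ (14 * T) * (z * (((Q ^ (7 * T))⁻¹ / 2) ^ 2 / 4) * (R * Q ^ 8)) := by
          have e1 : Q ^ (14 * T) = Q ^ (7 * T) * Q ^ (7 * T) := by ring
          have e2 : Q ^ (7 * T) * (Q ^ (7 * T))⁻¹ = 1 := mul_inv_cancel₀ (by positivity)
          rw [e1]
          linear_combination -(R * Q ^ 8 * z / 16) *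
            (Q ^ (7 * T) * (Q ^ (7 * T))⁻¹ + 1) * e2
        _ ≤ _ := by gcongr
    have hYsub : #Y ≤ #{b ∈ B | ∃ b₀ ∈ B, |(b₀ : ℝ) - ξ * (b : ℤ)| ≤ w} := by
      refine Finset.card_le_card (Finset.monotone_filter_right _ ?_)
      rintro b _ ⟨b₀, hb₀, hb⟩
      exact ⟨b₀, hb₀, hb.trans (by rw [hw]; push_cast; linarith)⟩
    have hBY : (#B : ℝ) ≤ Q ^ (15 * T + 19) *
        #{b ∈ B | ∃ b₀ ∈ B, |(b₀ : ℝ) - ξ * (b : ℤ)| ≤ w} := by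
      calc (#B : ℝ) ≤ Q ^ (T ^ 2 + T + 19) * n := hBN
        _ = Q ^ (T + 19) * (R * n) := by rw [hRdef]; ring
        _ ≤ Q ^ (T + 19) * (Q ^ (14 * T) * #Y) := by gcongr
        _ = Q ^ (15 * T + 19) * #Y := by ring
        _ ≤ _ := by gcongr
    refine ⟨?_, (card_add_dil_le hBne (m := ⌈Q ^ 2⌉₊) hBsub ?_ hBY).trans ?_⟩
    · rw [abs_of_pos hξ0]
      exact hξQ.trans (hpow (by omega))
    · calc (1 : ℝ) = ξ⁻¹ * ξ := by field_simp
        _ ≤ _ := by gcongr; exact hξQ'.trans hwQ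
    · have h1 : (2 * w + 3 : ℝ) ≤ Q ^ 3 := by
        rw [hw]
        push_cast
        nlinarith [pow_pos hQ0 2, mul_le_mul_of_nonneg_right hQ (pow_pos hQ0 2).le]
      have h2 : (2 * ⌈Q ^ 2⌉₊ : ℝ) ≤ Q ^ 3 := by
        nlinarith [pow_pos hQ0 2, mul_le_mul_of_nonneg_right hQ (pow_pos hQ0 2).le]
      calc (Q ^ (13 * T + 39)) ^ 3 * (2 * w + 3) * 2 * ⌈Q ^ 2⌉₊ * Q ^ (15 * T + 19) * #B
          = (Q ^ (13 * T + 39)) ^ 3 * (2 * w + 3) * (2 * ⌈Q ^ 2⌉₊) * Q ^ (15 * T + 19) * #B := by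
            ring
        _ ≤ (Q ^ (13 * T + 39)) ^ 3 * Q ^ 3 * Q ^ 3 * Q ^ (15 * T + 19) * #B := by gcongr
        _ = Q ^ (54 * T + 142) * #B := by ring
        _ ≤ _ := mul_le_mul_of_nonneg_right (hpow (by omega)) hBpos.le

end StructuredSet

section Step
open ProbabilityTheory
open scoped Finset Pointwise

variable {ν μ : Measure ℝ} {φ : ℝ → ℝ}

theorem measureReal_le_cov_mul [IsFiniteMeasure μ] {r p : ℝ} (hr : 0 < r) (hp0 : 0 ≤ p)
    {X S : Set ℝ} {f : ℝ → ℝ} (hf : ∀ x ∈ X, f x ∈ S ∩ Set.Icc (-1) 1)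
    (hp : ∀ x₁ ∈ X, μ.real {x ∈ X | |f x - f x₁| ≤ r} ≤ p) : μ.real X ≤ cov r S * p := by
  classical
  set C := (finite_cells hr S).toFinset with hC
  have hCc : #C = cov r S := by rw [cov, Set.ncard_eq_toFinset_card _ (finite_cells hr S)]
  have hsub : X ⊆ ⋃ j ∈ C, {x ∈ X | ⌊f x / r⌋ = j} := by
    intro x hx
    simp only [Set.mem_iUnion]
    exact ⟨⌊f x / r⌋, by rw [hC, Set.Finite.mem_toFinset]; exact ⟨f x, hf x hx, rfl⟩, hx, rfl⟩
  have hcell : ∀ j ∈ C, μ.real {x ∈ X | ⌊f x / r⌋ = j} ≤ p := by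
    intro j _
    rcases Set.eq_empty_or_nonempty {x ∈ X | ⌊f x / r⌋ = j} with h0 | ⟨x₁, hx₁, hj⟩
    · rwa [h0, measureReal_empty]
    · refine (measureReal_mono ?_).trans (hp x₁ hx₁)
      rintro x ⟨hx, hxj⟩
      refine ⟨hx, ?_⟩
      have h1 := (Int.abs_sub_lt_one_of_floor_eq_floor (hxj.trans hj.symm)).le
      rwa [← sub_div, abs_div, abs_of_pos hr, div_le_one hr] at h1
  calc μ.real X ≤ μ.real (⋃ j ∈ C, {x ∈ X | ⌊f x / r⌋ = j}) :=
        measureReal_mono hsub (measure_ne_top _ _)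
    _ ≤ ∑ j ∈ C, μ.real {x ∈ X | ⌊f x / r⌋ = j} := measureReal_biUnion_finset_le _ _
    _ ≤ ∑ _j ∈ C, p := Finset.sum_le_sum hcell
    _ = cov r S * p := by rw [Finset.sum_const, nsmul_eq_mul, hCc]

theorem abs_log_sub_log_le {x y a : ℝ} (ha : 0 < a) (hx : a ≤ x) (hy : a ≤ y) :
    |Real.log x - Real.log y| ≤ |x - y| / a := by
  have key : ∀ {x y : ℝ}, a ≤ x → a ≤ y → Real.log x - Real.log y ≤ |x - y| / a := by
    intro x y hx hy
    have hy0 : 0 < y := ha.trans_le hy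
    rw [← Real.log_div (ha.trans_le hx).ne' hy0.ne']
    refine (Real.log_le_sub_one_of_pos (div_pos (ha.trans_le hx) hy0)).trans ?_
    rw [div_sub_one hy0.ne']
    calc (x - y) / y ≤ |x - y| / y := by gcongr; exact le_abs_self _
      _ ≤ _ := by gcongr
  rw [abs_le]
  refine ⟨?_, key hx hy⟩
  have := key hy hx
  rw [abs_sub_comm] at this
  linarith

theorem measureReal_le_mul_cov [IsFiniteMeasure μ] {r p m x₀ : ℝ} (hr : 0 < r) (hm : 1 ≤ m)
    (hμm : ∀ᵐ x ∂μ, x ∈ Set.Icc m⁻¹ m) (hx₀ : x₀ ∈ Set.Icc m⁻¹ m) {X S : Set ℝ}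
    (hS : ∀ x ∈ X, x ∈ Set.Icc m⁻¹ m → x₀ / x ∈ S ∧ x / x₀ ∈ S)
    (hp : ∀ a, μ.real {x | 0 < x ∧ |Real.log x - a| ≤ m ^ 2 * r} ≤ p) :
    μ.real X ≤ 2 * p * cov r S := by
  have hm0 : 0 < m := by linarith
  have hpos : ∀ {x}, x ∈ Set.Icc m⁻¹ m → 0 < x := fun hx => (inv_pos.2 hm0).trans_le hx.1
  have hx₀0 := hpos hx₀
  have hp0 : 0 ≤ p := measureReal_nonneg.trans (hp 0)
  have hle : ∀ {x y}, x ∈ Set.Icc m⁻¹ m → y ∈ Set.Icc m⁻¹ m → (m ^ 2)⁻¹ ≤ x / y := by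
    intro x y hx hy
    rw [le_div_iff₀ (hpos hy)]
    calc (m ^ 2)⁻¹ * y ≤ (m ^ 2)⁻¹ * m := by gcongr; exact hy.2
      _ = m⁻¹ := by field_simp
      _ ≤ x := hx.1
  set X₁ := {x ∈ X | x ∈ Set.Icc m⁻¹ m ∧ x₀ ≤ x} with hX₁
  set X₂ := {x ∈ X | x ∈ Set.Icc m⁻¹ m ∧ x ≤ x₀} with hX₂
  have h1 : μ.real X₁ ≤ cov r S * p := by
    refine measureReal_le_cov_mul (f := fun x => x₀ / x) hr hp0 ?_ ?_
    · rintro x ⟨hx, hxm, hxx⟩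
      have h0 : 0 < x₀ / x := div_pos hx₀0 (hpos hxm)
      exact ⟨(hS x hx hxm).1, by linarith, (div_le_one (hpos hxm)).2 hxx⟩
    · rintro x₁ ⟨-, hx₁, -⟩
      refine (measureReal_mono ?_).trans (hp (Real.log x₁))
      rintro x ⟨⟨-, hxm, -⟩, hx⟩
      refine ⟨hpos hxm, ?_⟩
      have h2 := abs_log_sub_log_le (a := (m ^ 2)⁻¹) (by positivity) (hle hx₀ hxm) (hle hx₀ hx₁)
      rw [Real.log_div hx₀0.ne' (hpos hxm).ne', Real.log_div hx₀0.ne' (hpos hx₁).ne',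
        div_inv_eq_mul] at h2
      calc |Real.log x - Real.log x₁|
          = |Real.log x₀ - Real.log x - (Real.log x₀ - Real.log x₁)| := by
            rw [← abs_neg]; ring_nf
        _ ≤ |x₀ / x - x₀ / x₁| * m ^ 2 := h2
        _ ≤ r * m ^ 2 := by gcongr
        _ = _ := mul_comm _ _
  have h2 : μ.real X₂ ≤ cov r S * p := by
    refine measureReal_le_cov_mul (f := fun x => x / x₀) hr hp0 ?_ ?_
    · rintro x ⟨hx, hxm, hxx⟩
      have h0 : 0 < x / x₀ := div_pos (hpos hxm) hx₀0
      exact ⟨(hS x hx hxm).2, by linarith, (div_le_one hx₀0).2 hxx⟩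
    · rintro x₁ ⟨-, hx₁, -⟩
      refine (measureReal_mono ?_).trans (hp (Real.log x₁))
      rintro x ⟨⟨-, hxm, -⟩, hx⟩
      refine ⟨hpos hxm, ?_⟩
      have h2 := abs_log_sub_log_le (a := (m ^ 2)⁻¹) (by positivity) (hle hxm hx₀) (hle hx₁ hx₀)
      rw [Real.log_div (hpos hxm).ne' hx₀0.ne', Real.log_div (hpos hx₁).ne' hx₀0.ne',
        div_inv_eq_mul] at h2
      calc |Real.log x - Real.log x₁|
          = |Real.log x - Real.log x₀ - (Real.log x₁ - Real.log x₀)| := by ring_nf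
        _ ≤ |x / x₀ - x₁ / x₀| * m ^ 2 := h2
        _ ≤ r * m ^ 2 := by gcongr
        _ = _ := mul_comm _ _
  have h3 : μ.real X ≤ μ.real (X₁ ∪ X₂) := by
    rw [measureReal_def, measureReal_def]
    refine ENNReal.toReal_mono (measure_ne_top _ _) (measure_mono_ae ?_)
    filter_upwards [hμm] with x hx hxX
    rcases le_total x₀ x with h | h
    · exact Or.inl ⟨hxX, hx, h⟩
    · exact Or.inr ⟨hxX, hx, h⟩
  linarith [measureReal_union_le (μ := μ) X₁ X₂]

theorem card_add_dil_le_of_dense {B : Finset ℤ} {M : ℕ} (hBM : ∀ b ∈ B, |(b : ℝ)| ≤ M) {K ρ t q : ℝ}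
    (hρ : M * ρ ≤ 1) (hq : q ∈ actSet B K) (htq : |t - q| ≤ ρ) :
    (#(B + dil t B) : ℝ) ≤ 3 * K * #B := by
  have hsub : B + dil t B ⊆ (B + dil q B) + {-1, 0, 1} := by
    intro y hy
    obtain ⟨b, hb, z, hz, rfl⟩ := Finset.mem_add.1 hy
    obtain ⟨b', hb', rfl⟩ := mem_dil.1 hz
    have h1 : |t * b' - q * b'| ≤ 1 := by
      rw [← sub_mul, abs_mul]
      calc |t - q| * |(b' : ℝ)| ≤ ρ * M :=
          mul_le_mul htq (hBM b' hb') (abs_nonneg _) ((abs_nonneg _).trans htq)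
        _ ≤ 1 := by linarith
    rw [abs_le] at h1
    have h2 : ⌊t * b'⌋ ≤ ⌊q * b'⌋ + 1 := by
      rw [← Int.floor_add_one]; exact Int.floor_le_floor (by linarith)
    have h3 : ⌊q * b'⌋ ≤ ⌊t * b'⌋ + 1 := by
      rw [← Int.floor_add_one]; exact Int.floor_le_floor (by linarith)
    refine Finset.mem_add.2 ⟨b + ⌊q * b'⌋, Finset.add_mem_add hb (mem_dil.2 ⟨b', hb', rfl⟩),
      ⌊t * b'⌋ - ⌊q * b'⌋, ?_, by ring⟩
    simp only [Finset.mem_insert, Finset.mem_singleton]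
    omega
  have h1 : #(B + dil t B) ≤ #(B + dil q B) * 3 :=
    (Finset.card_le_card hsub).trans (Finset.card_add_le.trans (by gcongr; exact Finset.card_le_three))
  have h2 : (#(B + dil t B) : ℝ) ≤ #(B + dil q B) * 3 := by exact_mod_cast h1
  linarith [hq.2]

/-- If `φ` has a not too small Gaussian mean, averaging over multiplicative translates decreases
it: the structured set given by `exists_structured_set` would be stable under all dilations. -/
theorem PosSpectrum.integral_sq_lt (h : PosSpectrum ν φ) {L m Q : ℝ} {T : ℕ} (hT : 5 ≤ T)
    (hQ : 64 ≤ Q) (hexp : 2 * Real.exp (1 / 2 - Q ^ T) * Q ^ (T ^ 2 + 2) ≤ 1)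
    (hL : ∀ᵐ q ∂ν, |q| ≤ L) (hL0 : 0 ≤ L) (hLQ : L ≤ Q) (hμ : μ Set.univ ≤ 1) (hm : 1 ≤ m)
    (hmQ : m ≤ Q) (hμm : ∀ᵐ x ∂μ, x ∈ Set.Icc m⁻¹ m) (hn : (Q ^ T ^ 2)⁻¹ ≤ gaussAvg ν (Q ^ T ^ 2))
    {N : ℕ} {β Ks Kf D p' : ℝ} {p V : ℕ → ℝ} (hβ : 0 < β)
    (hdense : ∀ S : ℝ → Set ℝ, ApproxField S Ks →
      (∀ n : ℕ, 1 ≤ n → n ≤ N → V n ≤ cov (β ^ n) (S Ks)) →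
      ∀ t ∈ Set.Icc (0 : ℝ) 1, ∃ q ∈ S Kf, |t - q| ≤ β ^ N)
    (hKs : Q ^ (6400 * T) ≤ Ks)
    (hp : ∀ n, 1 ≤ n → n ≤ N →
      ∀ a, μ.real {x | 0 < x ∧ |Real.log x - a| ≤ m ^ 2 * β ^ n} ≤ p n)
    (hpV : ∀ n, 1 ≤ n → n ≤ N → 2 * p n * V n ≤ (Q ^ (15 * T))⁻¹ ∧ 0 < p n)
    (hMβ : Q ^ (T ^ 2 + T + 11) * β ^ N ≤ 1) (hD : 1 ≤ D) (hp' : gaussAvg ν D ≤ p')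
    (hDn : Q ^ (7 * T) * (D * Q ^ 9) ≤ Q ^ T ^ 2 * gaussAvg ν (Q ^ T ^ 2))
    (hfin : 648 * Kf * Q ^ 7 * p' < 1) :
    ∫ a, (∫ x, φ (x * (Q ^ T ^ 2 * a)) ∂μ) ^ 2 ∂(gaussianReal 0 1) <
      Q⁻¹ * gaussAvg ν (Q ^ T ^ 2) := by
  by_contra! hlarge
  have hν := h.isFiniteMeasure
  have hμf : IsFiniteMeasure μ := ⟨hμ.trans_lt ENNReal.one_lt_top⟩
  have hQ0 : 0 < Q := by linarith
  have hQ1 : 1 ≤ Q := by linarith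
  have hm0 : 0 < m := by linarith
  obtain ⟨t, B, M, hB, hM1, hM, hBM, htB, hBlow, hBB, x₀, hx₀, X, hX, hXx⟩ :=
    h.exists_structured_set hT hQ hexp hL hL0 hLQ hμ hm hmQ hμm hn hlarge
  have hB0 : (0 : ℝ) < #B := by exact_mod_cast hB.card_pos
  have hp'0 : 0 ≤ p' := (gaussAvg_nonneg D).trans hp'
  have h9 : 9 ≤ Q ^ (100 * T) := by
    linarith [le_self_pow₀ hQ1 (show 100 * T ≠ 0 by omega)]
  have hle : Q ^ (100 * T) ≤ Q ^ (6400 * T) := pow_le_pow_right₀ hQ1 (by omega)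
  have hA := approxField_actSet hB h9 hBB
  have hAs : ApproxField (actSet B) Ks :=
    approxField_actSet hB (h9.trans (hle.trans hKs))
      (hBB.trans (by gcongr; exact hle.trans hKs))
  have h64 : (Q ^ (100 * T)) ^ 64 ≤ Ks := by
    rw [← pow_mul]; exact (pow_le_pow_right₀ hQ1 (by omega)).trans hKs
  have hXS : ∀ x ∈ X, x ∈ Set.Icc m⁻¹ m → x₀ / x ∈ actSet B Ks ∧ x / x₀ ∈ actSet B Ks := by
    intro x hx hxm
    have hx0 : 0 < x := (inv_pos.2 hm0).trans_le hxm.1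
    have hx₀0 : 0 < x₀ := (inv_pos.2 hm0).trans_le hx₀.1
    have h1 := hXx x hx hxm
    refine ⟨actSet_mono (hle.trans hKs) h1, actSet_mono h64 ?_⟩
    rw [← inv_div, ← one_div]
    refine hA.div_mem _ le_rfl 1 hA.one_mem _ h1 ?_
    rw [abs_of_pos (div_pos hx₀0 hx0), inv_le_comm₀ (by positivity) (div_pos hx₀0 hx0), inv_div]
    calc x / x₀ = x * x₀⁻¹ := div_eq_mul_inv _ _
      _ ≤ Q * Q := by
        gcongr
        · exact hxm.2.trans hmQ
        · exact (inv_le_of_inv_le₀ hm0 hx₀.1).trans hmQ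
      _ = Q ^ 2 := by ring
      _ ≤ _ := pow_le_pow_right₀ hQ1 (by omega)
  have hd := hdense (actSet B) hAs fun n h1n hnN => by
    have h1 := hX.trans (measureReal_le_mul_cov (r := β ^ n) (by positivity) hm hμm hx₀ hXS
      (hp n h1n hnN))
    obtain ⟨h2, h3⟩ := hpV n h1n hnN
    exact le_of_mul_le_mul_left (h2.trans h1) (by positivity)
  have hK : ∀ t ∈ Set.Icc (0 : ℝ) 1, (#(B + dil t B) : ℝ) ≤ 3 * Kf * #B := by
    intro t ht
    obtain ⟨q, hq, htq⟩ := hd t ht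
    exact card_add_dil_le_of_dense hBM
      ((mul_le_mul_of_nonneg_right hM (by positivity)).trans hMβ) hq htq
  have hD0 : 1 ≤ D * Q ^ 9 := one_le_mul_of_one_le_of_one_le hD (one_le_pow₀ hQ1)
  have hconc : ∀ x : ℤ, ∀ D', D * Q ^ 9 ≤ D' →
      (#{b ∈ B | |((b : ℤ) : ℝ) - x| ≤ D'} : ℝ) ≤ 24 * Q ^ 7 * p' * D' := by
    intro x D' hD'
    have hD'1 : 1 ≤ D' := hD0.trans hD'
    have h1 := h.card_mul_le hL hL0 (s := {b ∈ B | |((b : ℤ) : ℝ) - x| ≤ D'}) (x := x)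
      (y := -((Q ^ 9)⁻¹ * t)) (g := (Q ^ 9)⁻¹) (D := D') (D' := (Q ^ 9)⁻¹ * (D' + 1))
      (ε := (Q ^ 7)⁻¹) (by positivity) (by positivity) (by positivity)
      (by
        have e1 : (Q ^ 7)⁻¹ = Q ^ 2 * (Q ^ 9)⁻¹ := by field_simp
        have e2 : L ≤ Q ^ 2 / 2 := by nlinarith
        have e3 : 0 < (Q ^ 9)⁻¹ := by positivity
        rw [e1]
        nlinarith) le_rfl
      (by
        intro b hb
        obtain ⟨hb1, hb2⟩ := Finset.mem_filter.1 hb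
        refine ⟨hb2, ?_⟩
        rw [show -((Q ^ 9)⁻¹ * (t : ℝ)) + (Q ^ 9)⁻¹ * b = -((Q ^ 9)⁻¹ * (t - b)) by ring, h.even]
        exact htB b hb1)
    have h2 : gaussAvg ν ((Q ^ 9)⁻¹ * (D' + 1)) ≤ p' := by
      refine (gaussAvg_anti (by linarith) ?_).trans hp'
      rw [← div_eq_inv_mul, le_div_iff₀ (by positivity)]
      linarith
    have h3 : 12 * ((Q ^ 9)⁻¹ * (D' + 1)) * gaussAvg ν ((Q ^ 9)⁻¹ * (D' + 1)) ≤
        12 * ((Q ^ 9)⁻¹ * (2 * D')) * p' :=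
      mul_le_mul (by gcongr; linarith) h2 (gaussAvg_nonneg _) (by positivity)
    have h4 := h1.trans h3
    rw [show ∀ a : ℝ, a * ((Q ^ 7)⁻¹ * (Q ^ 9)⁻¹) = a * (Q ^ 7)⁻¹ * (Q ^ 9)⁻¹ by intro a; ring,
      show 12 * ((Q ^ 9)⁻¹ * (2 * D')) * p' = 24 * p' * D' * (Q ^ 9)⁻¹ by ring] at h4
    have h5 := le_of_mul_le_mul_right h4 (by positivity)
    rw [← div_eq_mul_inv, div_le_iff₀ (by positivity)] at h5
    linarith
  have hcard := card_le_of_card_add_dil_le hB hM1 hBM hD0 (by positivity) hconc hK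
  have hDB : D * Q ^ 9 ≤ #B :=
    le_of_mul_le_mul_left (hDn.trans hBlow) (by positivity)
  have hKf : 0 < 3 * Kf := by
    have h1 := hK 0 (by norm_num)
    have h2 : 0 < #(B + dil 0 B) := by
      rw [Finset.card_pos]
      exact hB.add (hB.image _)
    have h3 : (0 : ℝ) < #(B + dil 0 B) := by exact_mod_cast h2
    exact (pos_iff_pos_of_mul_pos (h3.trans_le h1)).2 hB0
  have : (#B : ℝ) < #B := by
    calc (#B : ℝ) ≤ 3 * Kf * (24 * Q ^ 7 * p' * (D * Q ^ 9 + 8 * #B)) := hcard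
      _ ≤ 3 * Kf * (24 * Q ^ 7 * p' * (#B + 8 * #B)) := by gcongr
      _ = 648 * Kf * Q ^ 7 * p' * #B := by ring
      _ < 1 * #B := by gcongr
      _ = #B := one_mul _
  exact lt_irrefl _ this

end Step

section QuantitativeStep
open ProbabilityTheory Filter

theorem PosSpectrum.gaussAvg_le_two_mul {ν : Measure ℝ} {φ : ℝ → ℝ} (h : PosSpectrum ν φ)
    {R c γ : ℝ} (hR : 1 ≤ R) (hc : 0 < c) (hγ1 : γ ≤ 1)
    (hν : ν.real (Set.Icc (-R ^ (-(c / 8))) (R ^ (-(c / 8)))) ≤ R ^ (-(c * γ / 9))) :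
    gaussAvg ν (R ^ (c / 4)) ≤ 2 * R ^ (-(c * γ / 9)) := by
  have hνf := h.isFiniteMeasure
  have hR0 : 0 < R := by linarith
  have h1 := gaussAvg_le h.mass_le (D := R ^ (c / 4)) (ρ := R ^ (-(c / 8))) (by positivity)
    (by positivity)
  have h2 : R ^ (c / 4) * R ^ (-(c / 8)) = R ^ (c / 8) := by
    rw [← Real.rpow_add hR0]; ring_nf
  rw [h2] at h1
  have h3 : Real.exp (-(R ^ (c / 8)) ^ 2 / 2) ≤ R ^ (-(c * γ / 9)) := by
    calc Real.exp (-(R ^ (c / 8)) ^ 2 / 2) ≤ (R ^ (c / 8))⁻¹ := by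
          have hy : 0 < R ^ (c / 8) := by positivity
          rw [neg_div, Real.exp_neg]
          refine inv_anti₀ hy ?_
          have := Real.add_one_le_exp ((R ^ (c / 8)) ^ 2 / 2)
          nlinarith [sq_nonneg (R ^ (c / 8) - 1)]
      _ = R ^ (-(c / 8)) := (Real.rpow_neg hR0.le _).symm
      _ ≤ _ := Real.rpow_le_rpow_of_exponent_le hR (by nlinarith)
  linarith

set_option maxHeartbeats 1600000 in
/-- If the Gaussian average of `φ` at scale `R` is not already close to `R⁻¹`, then squaring the
average of `φ` over dilations distributed by a log-spread measure improves it by a power of `R`. -/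
theorem PosSpectrum.exists_integral_sq_le {γ c : ℝ} (hγ : 0 < γ) (hγ1 : γ ≤ 1) (hc : 0 < c)
    (hc1 : c ≤ 1) : ∃ κ : ℝ, 0 < κ ∧ ∃ ε : ℝ, 0 < ε ∧ ∀ᶠ R : ℝ in atTop,
      ∀ (ν μ : Measure ℝ) (φ : ℝ → ℝ) (L m : ℝ), PosSpectrum ν φ → (∀ᵐ q ∂ν, |q| ≤ L) → 0 ≤ L →
      L ≤ R ^ κ → μ Set.univ ≤ 1 → 1 ≤ m → m ≤ R ^ κ →
      (∀ᵐ x ∂μ, x ∈ Set.Icc m⁻¹ m) →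
      (∀ a σ : ℝ, R ^ (-2 : ℝ) ≤ σ → σ ≤ R ^ (-ε) →
        μ.real {x | 0 < x ∧ |Real.log x - a| ≤ σ} ≤ 2 * σ ^ γ) →
      ν.real (Set.Icc (-R ^ (-(c / 8))) (R ^ (-(c / 8)))) ≤ R ^ (-(c * γ / 9)) →
      R ^ (c - 1) ≤ gaussAvg ν R →
      ∫ a, (∫ x, φ (x * (R * a)) ∂μ) ^ 2 ∂(gaussianReal 0 1) ≤
        R ^ (-κ) * gaussAvg ν R := by
  obtain ⟨N, hN, s, hs, β₀, hβ₀, hdense⟩ := ApproxField.dense (γ := γ / 2) (θ := c * γ / 30)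
    (by positivity) (by linarith) (by positivity)
  have hN0 : (0 : ℝ) < N := by exact_mod_cast hN
  have hN1 : (1 : ℝ) ≤ N := by exact_mod_cast hN
  obtain ⟨T, hT⟩ := exists_nat_gt
    (50 + 6400 * N / s + 68 * N / γ + 4 * N + 24 / c + 280 / (c * γ))
  have hp1 : 0 < 6400 * N / s := by positivity
  have hp2 : 0 < 68 * N / γ := by positivity
  have hp4 : 0 < 24 / c := by positivity
  have hp5 : 0 < 280 / (c * γ) := by positivity
  have hT0 : (0 : ℝ) < T := by linarith
  have hT50 : (50 : ℝ) < T := by linarith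
  have hT5 : 5 ≤ T := by
    have : (5 : ℝ) ≤ T := by linarith
    exact_mod_cast this
  set τ : ℝ := 1 / T with hτ
  have hτ0 : 0 < τ := by positivity
  have hτT : τ * T = 1 := by rw [hτ]; field_simp
  have e1 : 6400 * τ * N ≤ s := by
    have : 6400 * N / s < T := by linarith
    rw [div_lt_iff₀ hs] at this
    nlinarith
  have e2 : 68 * τ * N ≤ γ := by
    have : 68 * N / γ < T := by linarith
    rw [div_lt_iff₀ hγ] at this
    nlinarith
  have e3 : 4 * τ * N ≤ 1 := by
    have : 4 * N < (T : ℝ) := by linarith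
    nlinarith
  have e4 : 24 * τ ≤ c := by
    have : 24 / c < T := by linarith
    rw [div_lt_iff₀ hc] at this
    nlinarith
  have e5 : 280 * τ ≤ c * γ := by
    have : 280 / (c * γ) < T := by linarith
    rw [div_lt_iff₀ (by positivity)] at this
    nlinarith
  have hτ50 : 50 * τ ≤ 1 := by nlinarith
  obtain ⟨Q₀, hQ₀⟩ := Filter.eventually_atTop.1
    ((Real.tendsto_pow_mul_exp_neg_atTop_nhds_zero (T ^ 2 + 2)).eventually
      (ge_mem_nhds (show (0 : ℝ) < Real.exp (-(1 / 2)) / 2 by positivity)))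
  have t1 := tendsto_rpow_atTop (show 0 < τ ^ 2 by positivity)
  have t2 := tendsto_rpow_neg_atTop (show 0 < 3 / (2 * (N : ℝ)) by positivity)
  have t3 := tendsto_rpow_atTop (show 0 < γ / (2 * (N : ℝ)) by positivity)
  have t4 := tendsto_rpow_atTop (show 0 < c * γ / 40 by positivity)
  refine ⟨τ ^ 2, by positivity, 1 / N, by positivity, ?_⟩
  filter_upwards [t1.eventually_ge_atTop (max Q₀ 64), t2.eventually (ge_mem_nhds hβ₀),
    t3.eventually_ge_atTop 4, t4.eventually_gt_atTop 1296, eventually_ge_atTop 1]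
    with R r1 r2 r3 r4 hR ν μ φ L m h hL hL0 hLQ hμ hm hmQ hμm hμc hνc hn
  have hR0 : 0 < R := by linarith
  have hmono : ∀ {a b : ℝ}, a ≤ b → R ^ a ≤ R ^ b := fun hab =>
    Real.rpow_le_rpow_of_exponent_le hR hab
  set Q := R ^ τ ^ 2 with hQ
  have hQ64 : 64 ≤ Q := (le_max_right _ _).trans r1
  have hQ1 : 1 ≤ Q := by linarith
  have hQ0 : 0 < Q := by linarith
  have hQp : ∀ j : ℕ, Q ^ j = R ^ (τ ^ 2 * j) := fun j => by
    rw [hQ, ← Real.rpow_natCast, ← Real.rpow_mul hR0.le]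
  have hQT2 : Q ^ T ^ 2 = R := by
    rw [hQp]
    push_cast
    rw [← mul_pow, hτT, one_pow, Real.rpow_one]
  set β := R ^ (-(3 / (2 * (N : ℝ)))) with hβ
  have hβ0 : 0 < β := by positivity
  have hβ1 : β ≤ 1 := Real.rpow_le_one_of_one_le_of_nonpos hR (by
    rw [neg_nonpos]; positivity)
  have hβp : ∀ x : ℝ, β ^ x = R ^ (-(3 / (2 * (N : ℝ))) * x) := fun x => by
    rw [hβ, ← Real.rpow_mul hR0.le]
  have hβN : β ^ N = R ^ (-(3 / 2) : ℝ) := by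
    rw [← Real.rpow_natCast, hβp]
    congr 1
    field_simp
  have hm0 : 0 < m := by linarith
  have hm2 : m ^ 2 ≤ R ^ (2 * τ) := by
    calc m ^ 2 ≤ Q ^ 2 := by gcongr
      _ = R ^ (τ ^ 2 * (2 : ℕ)) := hQp 2
      _ ≤ _ := hmono (by push_cast; nlinarith)
  have hexp : 2 * Real.exp (1 / 2 - Q ^ T) * Q ^ (T ^ 2 + 2) ≤ 1 := by
    have h1 := hQ₀ Q ((le_max_left _ _).trans r1)
    have h2 : Real.exp (1 / 2 - Q ^ T) ≤ Real.exp (1 / 2) * Real.exp (-Q) := by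
      rw [← Real.exp_add]
      refine Real.exp_le_exp.2 ?_
      linarith [le_self_pow₀ hQ1 (show T ≠ 0 by omega)]
    have h3 : Real.exp (1 / 2) * Real.exp (-(1 / 2)) = 1 := by
      rw [← Real.exp_add]; simp
    calc 2 * Real.exp (1 / 2 - Q ^ T) * Q ^ (T ^ 2 + 2)
        ≤ 2 * (Real.exp (1 / 2) * Real.exp (-Q)) * Q ^ (T ^ 2 + 2) := by gcongr
      _ = 2 * Real.exp (1 / 2) * (Q ^ (T ^ 2 + 2) * Real.exp (-Q)) := by ring
      _ ≤ 2 * Real.exp (1 / 2) * (Real.exp (-(1 / 2)) / 2) := by gcongr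
      _ = 1 := by linarith
  have hscale : ∀ n : ℕ, 1 ≤ n → n ≤ N →
      R ^ (-2 : ℝ) ≤ m ^ 2 * β ^ n ∧ m ^ 2 * β ^ n ≤ R ^ (-(1 / (N : ℝ))) := by
    intro n h1n hnN
    constructor
    · calc R ^ (-2 : ℝ) ≤ R ^ (-(3 / 2) : ℝ) := hmono (by norm_num)
        _ = β ^ N := hβN.symm
        _ ≤ β ^ n := pow_le_pow_of_le_one hβ0.le hβ1 hnN
        _ ≤ m ^ 2 * β ^ n := le_mul_of_one_le_left (by positivity) (one_le_pow₀ hm)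
    · calc m ^ 2 * β ^ n ≤ R ^ (2 * τ) * β := by
            gcongr
            exact pow_le_of_le_one hβ0.le hβ1 (by omega)
        _ = R ^ (2 * τ + -(3 / (2 * (N : ℝ)))) := (Real.rpow_add hR0 _ _).symm
        _ ≤ _ := hmono (by
          have : 2 * τ ≤ 1 / (2 * N) := by
            rw [le_div_iff₀ (by positivity)]; linarith
          have e : 3 / (2 * (N : ℝ)) = 1 / N + 1 / (2 * N) := by field_simp; norm_num
          linarith)
  have key := h.integral_sq_lt (m := m) (Q := Q) (N := N) (β := β) (Ks := β ^ (-s))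
    (Kf := β ^ (-(c * γ / 30 * N))) (D := R ^ (c / 4)) (p' := 2 * R ^ (-(c * γ / 9)))
    (p := fun n => 2 * (m ^ 2 * β ^ n) ^ γ) (V := fun n => β ^ (-(γ / 2 * n)))
    hT5 hQ64 hexp hL hL0 hLQ hμ hm hmQ hμm
    (by
      rw [hQT2, ← Real.rpow_neg_one]
      exact (hmono (by linarith)).trans hn)
    hβ0 (hdense β hβ0 r2)
    (by
      rw [hQp, hβp]
      refine hmono ?_
      push_cast
      have e : -(3 / (2 * (N : ℝ))) * -s = 3 * s / (2 * N) := by ring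
      rw [e, le_div_iff₀ (by positivity)]
      have : τ ^ 2 * (6400 * T) = 6400 * τ := by linear_combination (6400 * τ) * hτT
      rw [this]
      linarith)
    (fun n h1n hnN a => hμc a _ (hscale n h1n hnN).1 (hscale n h1n hnN).2)
    (by
      intro n h1n hnN
      refine ⟨?_, by positivity⟩
      have h1n' : (1 : ℝ) ≤ n := by exact_mod_cast h1n
      have a1 : (m ^ 2 * β ^ n) ^ γ * β ^ (-(γ / 2 * n)) = (m ^ 2) ^ γ * β ^ (γ / 2 * n) := by
        rw [Real.mul_rpow (by positivity) (by positivity), mul_assoc, ← Real.rpow_natCast β,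
          ← Real.rpow_mul hβ0.le, ← Real.rpow_add hβ0]
        congr 2
        ring
      have a2 : (m ^ 2) ^ γ ≤ R ^ (2 * τ) := by
        refine le_trans ?_ hm2
        calc (m ^ 2) ^ γ ≤ (m ^ 2) ^ (1 : ℝ) :=
              Real.rpow_le_rpow_of_exponent_le (one_le_pow₀ hm) hγ1
          _ = m ^ 2 := Real.rpow_one _
      have a3 : β ^ (γ / 2 * n) ≤ R ^ (-(3 * γ / (4 * (N : ℝ)))) := by
        calc β ^ (γ / 2 * n) ≤ β ^ (γ / 2) :=
              Real.rpow_le_rpow_of_exponent_ge hβ0 hβ1 (by nlinarith)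
          _ = _ := by rw [hβp]; congr 1; field_simp; norm_num
      calc 2 * (2 * (m ^ 2 * β ^ n) ^ γ) * β ^ (-(γ / 2 * n))
          = 4 * ((m ^ 2 * β ^ n) ^ γ * β ^ (-(γ / 2 * n))) := by ring
        _ ≤ R ^ (γ / (2 * (N : ℝ))) * (R ^ (2 * τ) * R ^ (-(3 * γ / (4 * (N : ℝ))))) := by
          rw [a1]; gcongr
        _ = R ^ (γ / (2 * (N : ℝ)) + (2 * τ + -(3 * γ / (4 * (N : ℝ))))) := by
          rw [← Real.rpow_add hR0, ← Real.rpow_add hR0]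
        _ ≤ R ^ (-(τ ^ 2 * (15 * T : ℕ))) := by
          refine hmono ?_
          push_cast
          have e : τ ^ 2 * (15 * T) = 15 * τ := by linear_combination (15 * τ) * hτT
          have e' : 3 * γ / (4 * (N : ℝ)) = γ / (2 * N) + γ / (4 * N) := by field_simp; norm_num
          have : 17 * τ ≤ γ / (4 * N) := by
            rw [le_div_iff₀ (by positivity)]; linarith
          rw [e, e']
          linarith
        _ = _ := by rw [Real.rpow_neg hR0.le, hQp])
    (by
      rw [hβN, hQp, ← Real.rpow_add hR0]
      refine Real.rpow_le_one_of_one_le_of_nonpos hR ?_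
      push_cast
      have e : τ ^ 2 * (T ^ 2 + T + 11) = 1 + τ + 11 * τ ^ 2 := by
        linear_combination (τ * T + 1 + τ) * hτT
      rw [e]
      nlinarith)
    (Real.one_le_rpow hR (by positivity))
    (h.gaussAvg_le_two_mul hR hc hγ1 hνc)
    (by
      rw [hQT2, hQp, hQp, ← Real.rpow_add hR0, ← Real.rpow_add hR0]
      calc R ^ (τ ^ 2 * (7 * T : ℕ) + (c / 4 + τ ^ 2 * (9 : ℕ))) ≤ R ^ (1 + (c - 1)) := by
            refine hmono ?_
            push_cast
            have e : τ ^ 2 * (7 * T) = 7 * τ := by linear_combination (7 * τ) * hτT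
            rw [e]
            nlinarith
        _ = R * R ^ (c - 1) := by rw [Real.rpow_add hR0, Real.rpow_one]
        _ ≤ _ := by gcongr)
    (by
      rw [hβp, hQp]
      have e : -(3 / (2 * (N : ℝ))) * -(c * γ / 30 * N) = c * γ / 20 := by field_simp; norm_num
      rw [e]
      calc 648 * R ^ (c * γ / 20) * R ^ (τ ^ 2 * (7 : ℕ)) * (2 * R ^ (-(c * γ / 9)))
          = 1296 * (R ^ (c * γ / 20) * R ^ (τ ^ 2 * (7 : ℕ)) * R ^ (-(c * γ / 9))) := by ring
        _ < R ^ (c * γ / 40) *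
            (R ^ (c * γ / 20) * R ^ (τ ^ 2 * (7 : ℕ)) * R ^ (-(c * γ / 9))) := by gcongr
        _ = R ^ (c * γ / 40 + (c * γ / 20 + τ ^ 2 * (7 : ℕ) + -(c * γ / 9))) := by
          rw [← Real.rpow_add hR0, ← Real.rpow_add hR0, ← Real.rpow_add hR0]
        _ ≤ 1 := by
          refine Real.rpow_le_one_of_one_le_of_nonpos hR ?_
          push_cast
          have : 0 < c * γ := by positivity
          nlinarith)
  rw [hQT2] at key
  rw [Real.rpow_neg hR0.le]
  exact key.le

end QuantitativeStep

section Tower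
open ProbabilityTheory

variable {ν μ lam : Measure ℝ} {φ : ℝ → ℝ}

/-- A positive definite function whose spectral measure is supported on `[-L, L]` and gives mass
at most `p` to intervals of radius `ρ`. -/
structure SpreadSpectrum (ν : Measure ℝ) (φ : ℝ → ℝ) (L ρ p : ℝ) : Prop
    extends PosSpectrum ν φ where
  supp_nonneg : 0 ≤ L
  supp : ∀ᵐ q ∂ν, |q| ≤ L
  spread : ∀ a, ν (Set.Icc (a - ρ) (a + ρ)) ≤ ENNReal.ofReal p

theorem prod_univ_le_one [SFinite ν] (hμ : μ Set.univ ≤ 1) (hν : ν Set.univ ≤ 1) :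
    μ.prod ν Set.univ ≤ 1 := by
  rw [← Set.univ_prod_univ, Measure.prod_prod]
  exact mul_le_one' hμ hν

theorem lintegral_le_of_univ_le_one {f : ℝ → ℝ≥0∞} {p : ℝ≥0∞} (hμ : μ Set.univ ≤ 1)
    (hf : ∀ᵐ x ∂μ, f x ≤ p) : ∫⁻ x, f x ∂μ ≤ p := by
  calc ∫⁻ x, f x ∂μ ≤ ∫⁻ _, p ∂μ := lintegral_mono_ae hf
    _ = p * μ Set.univ := lintegral_const _
    _ ≤ p * 1 := by gcongr
    _ = p := mul_one p

/-- Symmetrization of a measure: its spectrum is nonnegative. -/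
theorem spreadSpectrum_conv_neg {L ρ p : ℝ} (h1 : lam Set.univ ≤ 1) (hL : 0 ≤ L)
    (hsupp : ∀ᵐ q ∂lam, |q| ≤ L) (hspread : ∀ a, lam (Set.Icc (a - ρ) (a + ρ)) ≤ ENNReal.ofReal p) :
    SpreadSpectrum (lam ∗ lam.map fun q => -q) (fun ζ => ‖charFun lam ζ‖ ^ 2) (2 * L) ρ p := by
  have hf : IsFiniteMeasure lam := ⟨h1.trans_lt ENNReal.one_lt_top⟩
  have hneg : lam.map (fun q => -q) Set.univ ≤ 1 := by
    rwa [Measure.map_apply measurable_neg MeasurableSet.univ, Set.preimage_univ]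
  refine ⟨⟨?_, fun ζ => ?_, fun ζ => by positivity⟩, by linarith, ?_, fun a => ?_⟩
  · rw [Measure.conv, Measure.map_apply (by fun_prop) MeasurableSet.univ, Set.preimage_univ]
    exact prod_univ_le_one h1 hneg
  · have h2 : charFun (lam.map fun q => -q) ζ = charFun lam (-ζ) := by
      have := charFun_map_mul (μ := lam) (-1) ζ
      simpa using this
    rw [charFun_conv, h2, charFun_neg, Complex.mul_conj, Complex.normSq_eq_norm_sq]
  · have hneg' : ∀ᵐ q ∂(lam.map fun q => -q), |q| ≤ L := by
      rw [ae_map_iff (by fun_prop) (measurableSet_le (by fun_prop) (by fun_prop))]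
      simpa using hsupp
    rw [Measure.conv, ae_map_iff (by fun_prop) (measurableSet_le (by fun_prop) (by fun_prop))]
    filter_upwards [Measure.quasiMeasurePreserving_fst.ae hsupp,
      Measure.quasiMeasurePreserving_snd.ae hneg'] with q hq1 hq2
    linarith [abs_add_le q.1 q.2]
  · rw [Measure.conv_comm, Measure.conv, Measure.map_apply (by fun_prop) measurableSet_Icc,
      Measure.prod_apply (measurableSet_Icc.preimage (by fun_prop))]
    refine lintegral_le_of_univ_le_one hneg (Filter.Eventually.of_forall fun x => ?_)
    refine le_trans (measure_mono ?_) (hspread (a - x))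
    rintro y hy
    simp only [Set.mem_preimage, Set.mem_Icc] at hy ⊢
    constructor <;> linarith [hy.1, hy.2]

theorem PosSpectrum.charFun_mconv (h : PosSpectrum ν φ) [IsFiniteMeasure μ] (ζ : ℝ) :
    charFun (μ ∗ₘ ν) ζ = ((∫ x, φ (x * ζ) ∂μ : ℝ) : ℂ) := by
  have := h.isFiniteMeasure
  rw [charFun_apply_real, Measure.mconv, integral_map (by fun_prop)
    (Measurable.aestronglyMeasurable (by fun_prop)), integral_prod]
  · rw [← integral_complex_ofReal]
    refine integral_congr_ae (Filter.Eventually.of_forall fun x => ?_)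
    simp only
    rw [← h.charFun_eq, charFun_apply_real]
    congr 1 with q
    push_cast
    ring_nf
  · refine Integrable.of_bound (Measurable.aestronglyMeasurable (by fun_prop)) 1
      (Filter.Eventually.of_forall fun x => ?_)
    rw [← Complex.ofReal_mul, Complex.norm_exp_ofReal_mul_I]

/-- Averaging over multiplicative translates and squaring preserves positive definiteness and
the spreading of the spectral measure. -/
theorem SpreadSpectrum.mconv {L ρ p m : ℝ} (h : SpreadSpectrum ν φ L ρ p) (hμ : μ Set.univ ≤ 1)
    (hm : 1 ≤ m) (hρ : 0 ≤ ρ) (hμm : ∀ᵐ x ∂μ, x ∈ Set.Icc m⁻¹ m) :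
    SpreadSpectrum ((μ ∗ₘ ν) ∗ (μ ∗ₘ ν).map fun q => -q) (fun ζ => (∫ x, φ (x * ζ) ∂μ) ^ 2)
      (2 * m * L) (ρ / m) p := by
  have hν := h.isFiniteMeasure
  have hμf : IsFiniteMeasure μ := ⟨hμ.trans_lt ENNReal.one_lt_top⟩
  have hm0 : 0 < m := by linarith
  have hfun : (fun ζ => (∫ x, φ (x * ζ) ∂μ) ^ 2) = fun ζ => ‖charFun (μ ∗ₘ ν) ζ‖ ^ 2 := by
    ext ζ
    rw [h.charFun_mconv, Complex.norm_real, Real.norm_eq_abs, sq_abs]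
  rw [hfun, mul_assoc]
  refine spreadSpectrum_conv_neg ?_ (mul_nonneg hm0.le h.supp_nonneg) ?_ fun a => ?_
  · rw [Measure.mconv, Measure.map_apply (by fun_prop) MeasurableSet.univ, Set.preimage_univ]
    exact prod_univ_le_one hμ h.mass_le
  · rw [Measure.mconv, ae_map_iff (by fun_prop) (measurableSet_le (by fun_prop) (by fun_prop))]
    filter_upwards [Measure.quasiMeasurePreserving_fst.ae hμm,
      Measure.quasiMeasurePreserving_snd.ae h.supp] with q hq1 hq2
    have h0 : 0 < q.1 := (inv_pos.2 hm0).trans_le hq1.1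
    rw [abs_mul, abs_of_pos h0]
    exact mul_le_mul hq1.2 hq2 (abs_nonneg _) hm0.le
  · rw [Measure.mconv, Measure.map_apply (by fun_prop) measurableSet_Icc,
      Measure.prod_apply (measurableSet_Icc.preimage (by fun_prop))]
    refine lintegral_le_of_univ_le_one hμ ?_
    filter_upwards [hμm] with x hx
    refine le_trans (measure_mono ?_) (h.spread (a / x))
    have h0 : 0 < x := (inv_pos.2 hm0).trans_le hx.1
    rintro y ⟨hy1, hy2⟩
    simp only at hy1 hy2
    have h1 : ρ / m ≤ ρ * x := by
      rw [div_eq_mul_inv]; gcongr; exact hx.1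
    have h2 : a / x * x = a := by field_simp
    constructor
    · refine le_of_mul_le_mul_right ?_ h0
      rw [sub_mul, h2]; linarith
    · refine le_of_mul_le_mul_right ?_ h0
      rw [add_mul, h2]; linarith

/-- Integrals over a product space of functions of the product of the coordinates. -/
theorem integral_pi_succ {E : Type*} [NormedAddCommGroup E] [NormedSpace ℝ E]
    [MeasurableSpace E] [BorelSpace E] [SecondCountableTopology E]
    {n : ℕ} (μ : Fin (n + 1) → Measure ℝ) [∀ i, IsFiniteMeasure (μ i)] {f : ℝ → E}
    (hf : Measurable f) {C : ℝ} (hC : ∀ x, ‖f x‖ ≤ C) (η : ℝ) :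
    ∫ x, f (η * ∏ i, x i) ∂(Measure.pi μ) =
      ∫ y : Fin n → ℝ, ∫ x, f (x * (η * ∏ i, y i)) ∂(μ 0) ∂(Measure.pi fun i : Fin n => μ i.succ) := by
  have h1 := (measurePreserving_piFinSuccAbove μ 0).symm
  rw [← h1.integral_comp']
  simp only [Fin.zero_succAbove]
  rw [integral_prod_symm]
  · refine integral_congr_ae (Filter.Eventually.of_forall fun y => ?_)
    simp only
    congr 1 with x
    congr 1
    rw [Fin.prod_univ_succ]
    simp
    ring
  · refine Integrable.of_bound (Measurable.aestronglyMeasurable ?_) C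
      (Filter.Eventually.of_forall fun x => hC _)
    refine hf.comp (Measurable.const_mul ?_ η)
    exact (Finset.univ.measurable_prod fun i _ => measurable_pi_apply i).comp
      (MeasurableEquiv.measurable _)

end Tower

section Peeling
open ProbabilityTheory
open scoped Finset

variable {ν : Measure ℝ} {φ : ℝ → ℝ}

theorem isFiniteMeasure_of_univ_le_one {α : Type*} [MeasurableSpace α] {μ : Measure α}
    (h : μ Set.univ ≤ 1) : IsFiniteMeasure μ := ⟨h.trans_lt ENNReal.one_lt_top⟩

theorem pi_univ_le_one {n : ℕ} {μ : Fin n → Measure ℝ} (hμ : ∀ i, μ i Set.univ ≤ 1) :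
    Measure.pi μ Set.univ ≤ 1 := by
  have := fun i => isFiniteMeasure_of_univ_le_one (hμ i)
  rw [Measure.pi_univ]
  exact Finset.prod_le_one' fun i _ => hμ i

theorem measurable_mul_prod {n : ℕ} (η : ℝ) :
    Measurable fun y : Fin n → ℝ => η * ∏ i, y i :=
  (Finset.univ.measurable_prod fun i _ => measurable_pi_apply i).const_mul η

theorem PosSpectrum.measurable_average_one (h : PosSpectrum ν φ) {μ : Measure ℝ}
    [IsFiniteMeasure μ] : Measurable fun ζ => ∫ x, φ (x * ζ) ∂μ := by
  simpa using h.measurable_average (μ := μ) 1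

theorem PosSpectrum.integral_mem_Icc (h : PosSpectrum ν φ) {μ : Measure ℝ}
    (hμ : μ Set.univ ≤ 1) (ζ : ℝ) : ∫ x, φ (x * ζ) ∂μ ∈ Set.Icc (0 : ℝ) 1 := by
  have hμf := isFiniteMeasure_of_univ_le_one hμ
  refine ⟨integral_nonneg fun x => h.nonneg _, ?_⟩
  calc ∫ x, φ (x * ζ) ∂μ ≤ ∫ _, (1 : ℝ) ∂μ :=
        integral_mono (integrable_of_abs_le (h.measurable.comp (by fun_prop)) 1
          fun x => h.abs_le_one _) (integrable_const _) fun x => h.le_one _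
    _ ≤ 1 := by simpa using measureReal_univ_le_one hμ

theorem PosSpectrum.sq_integral_pi_le (h : PosSpectrum ν φ) {n : ℕ} {μ : Fin (n + 1) → Measure ℝ}
    (hμ : ∀ i, μ i Set.univ ≤ 1) (η : ℝ) :
    (∫ x, φ (η * ∏ i, x i) ∂(Measure.pi μ)) ^ 2 ≤
      ∫ y : Fin n → ℝ, (∫ x, φ (x * (η * ∏ i, y i)) ∂(μ 0)) ^ 2
        ∂(Measure.pi fun i : Fin n => μ i.succ) := by
  have := fun i => isFiniteMeasure_of_univ_le_one (hμ i)
  have hpi := pi_univ_le_one fun i : Fin n => hμ i.succ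
  have hpif := isFiniteMeasure_of_univ_le_one hpi
  have hm : Measurable fun y : Fin n → ℝ => ∫ x, φ (x * (η * ∏ i, y i)) ∂(μ 0) :=
    h.measurable_average_one.comp (measurable_mul_prod η)
  have hb : ∀ y : Fin n → ℝ, ∫ x, φ (x * (η * ∏ i, y i)) ∂(μ 0) ∈ Set.Icc (0 : ℝ) 1 :=
    fun y => h.integral_mem_Icc (hμ 0) _
  rw [integral_pi_succ μ h.measurable (C := 1) (fun x => h.abs_le_one x)]
  refine (sq_integral_le_mul_integral_sq zero_lt_one (measureReal_univ_le_one hpi)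
    (integrable_of_abs_le hm 1 fun y => ?_) (integrable_of_abs_le (hm.pow_const 2) 1 fun y => ?_)).trans
    (one_mul _).le
  · rw [abs_of_nonneg (hb y).1]; exact (hb y).2
  · rw [abs_of_nonneg (sq_nonneg _)]; exact pow_le_one₀ (hb y).1 (hb y).2

theorem sq_norm_integral_exp_le {n : ℕ} {μ : Fin (n + 1) → Measure ℝ}
    (hμ : ∀ i, μ i Set.univ ≤ 1) (η : ℝ) :
    ‖∫ x, Complex.exp (Complex.I * (η : ℂ) * ∏ i, (x i : ℂ)) ∂(Measure.pi μ)‖ ^ 2 ≤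
      ∫ y : Fin n → ℝ, ‖charFun (μ 0) (η * ∏ i, y i)‖ ^ 2
        ∂(Measure.pi fun i : Fin n => μ i.succ) := by
  have := fun i => isFiniteMeasure_of_univ_le_one (hμ i)
  have hpi := pi_univ_le_one fun i : Fin n => hμ i.succ
  have hpif := isFiniteMeasure_of_univ_le_one hpi
  have h1 := integral_pi_succ μ (f := fun z : ℝ => Complex.exp (z * Complex.I)) (by fun_prop)
    (C := 1) (fun z => (Complex.norm_exp_ofReal_mul_I z).le) η
  have h2 : ∀ x : Fin (n + 1) → ℝ, Complex.exp (Complex.I * (η : ℂ) * ∏ i, (x i : ℂ)) =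
      Complex.exp (((η * ∏ i, x i : ℝ) : ℂ) * Complex.I) := fun x => by
    push_cast; ring_nf
  have h3 : ∀ ζ : ℝ, ∫ x, Complex.exp (((x * ζ : ℝ) : ℂ) * Complex.I) ∂(μ 0) =
      charFun (μ 0) ζ := fun ζ => by
    rw [charFun_apply_real]; congr 1 with x; push_cast; ring_nf
  simp_rw [h2, h1, h3]
  have hm : Measurable fun y : Fin n → ℝ => ‖charFun (μ 0) (η * ∏ i, y i)‖ :=
    ((measurable_charFun (μ := μ 0)).comp (measurable_mul_prod η)).norm
  have hb : ∀ y : Fin n → ℝ, ‖charFun (μ 0) (η * ∏ i, y i)‖ ≤ 1 := fun y =>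
    (norm_charFun_le _).trans (measureReal_univ_le_one (hμ 0))
  refine le_trans (pow_le_pow_left₀ (norm_nonneg _) (norm_integral_le_integral_norm _) 2) ?_
  refine (sq_integral_le_mul_integral_sq zero_lt_one (measureReal_univ_le_one hpi)
    (integrable_of_abs_le hm 1 fun y => ?_) (integrable_of_abs_le (hm.pow_const 2) 1 fun y => ?_)).trans
    (one_mul _).le
  · rw [abs_of_nonneg (norm_nonneg _)]; exact hb y
  · rw [abs_of_nonneg (sq_nonneg _)]; exact pow_le_one₀ (norm_nonneg _) (hb y)

theorem PosSpectrum.integral_pi_le (h : PosSpectrum ν φ) {n : ℕ} {μ : Fin (n + 1) → Measure ℝ}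
    (hμ : ∀ i, μ i Set.univ ≤ 1) {m η b : ℝ} (hm : 1 ≤ m) (hb : 0 ≤ b)
    (hμm : ∀ i, ∀ᵐ x ∂(μ i), x ∈ Set.Icc m⁻¹ m)
    (hle : ∀ ζ, |η| / m ^ n ≤ |ζ| → |ζ| ≤ |η| * m ^ n → ∫ x, φ (x * ζ) ∂(μ 0) ≤ b) :
    ∫ x, φ (η * ∏ i, x i) ∂(Measure.pi μ) ≤ b := by
  have := fun i => isFiniteMeasure_of_univ_le_one (hμ i)
  have hpi := pi_univ_le_one fun i : Fin n => hμ i.succ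
  have hpif := isFiniteMeasure_of_univ_le_one hpi
  have hm0 : 0 < m := by linarith
  rw [integral_pi_succ μ h.measurable (C := 1) (fun x => h.abs_le_one x)]
  have hae : ∀ᵐ y ∂(Measure.pi fun i : Fin n => μ i.succ), ∀ i, y i ∈ Set.Icc m⁻¹ m :=
    Filter.eventually_all.2 fun i =>
      Measure.tendsto_eval_ae_ae.eventually (hμm i.succ)
  calc ∫ y : Fin n → ℝ, ∫ x, φ (x * (η * ∏ i, y i)) ∂(μ 0) ∂(Measure.pi fun i : Fin n => μ i.succ)
      ≤ ∫ _ : Fin n → ℝ, b ∂(Measure.pi fun i : Fin n => μ i.succ) := by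
        refine integral_mono_ae (integrable_of_abs_le (h.measurable_average_one.comp
          (measurable_mul_prod η)) 1 fun y => ?_) (integrable_const _) ?_
        · have := h.integral_mem_Icc (hμ 0) (η * ∏ i, y i)
          rw [abs_of_nonneg this.1]
          exact this.2
        · filter_upwards [hae] with y hy
          have hpos : ∀ i, 0 < y i := fun i => (inv_pos.2 hm0).trans_le (hy i).1
          have hprod : 0 < ∏ i, y i := Finset.prod_pos fun i _ => hpos i
          refine hle _ ?_ ?_
          · rw [abs_mul, abs_of_pos hprod, div_eq_mul_inv, ← inv_pow]
            gcongr
            calc m⁻¹ ^ n = ∏ _i : Fin n, m⁻¹ := by simp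
              _ ≤ _ := Finset.prod_le_prod (fun i _ => by positivity) fun i _ => (hy i).1
          · rw [abs_mul, abs_of_pos hprod]
            gcongr
            calc ∏ i, y i ≤ ∏ _i : Fin n, m :=
                  Finset.prod_le_prod (fun i _ => (hpos i).le) fun i _ => (hy i).2
              _ = _ := by simp
    _ ≤ b := by
      rw [integral_const, smul_eq_mul]
      exact mul_le_of_le_one_left hb (measureReal_univ_le_one hpi)

/-- Superlevel sets of `φ` are covered by few cells, so averages of `φ` over a measure that gives
little mass to each cell are small. -/
theorem PosSpectrum.average_le (h : PosSpectrum ν φ) {μ : Measure ℝ} (hμ : μ Set.univ ≤ 1)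
    {L m ζ f g D p : ℝ} (hL : ∀ᵐ q ∂ν, |q| ≤ L) (hL0 : 0 ≤ L) (hm : 1 ≤ m)
    (hμm : ∀ᵐ x ∂μ, x ∈ Set.Icc m⁻¹ m) (hζ : ζ ≠ 0) (hf : 0 < f) (hg : 0 < g)
    (hLg : 4 * (L * g) ≤ f) (hD : m * |ζ| + 2 * g ≤ D)
    (hp : ∀ a, μ.real {x | 0 < x ∧ |Real.log x - a| ≤ m * g / |ζ|} ≤ p) :
    ∫ x, φ (x * ζ) ∂μ ≤ f + 24 * D * gaussAvg ν D / (f * g) * p := by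
  classical
  have hμf := isFiniteMeasure_of_univ_le_one hμ
  have hm0 : 0 < m := by linarith
  have hζ0 : 0 < |ζ| := abs_pos.2 hζ
  have hp0 : 0 ≤ p := measureReal_nonneg.trans (hp 0)
  have hD0 : 0 < D := lt_of_lt_of_le (by positivity) hD
  set E := {x | x ∈ Set.Icc m⁻¹ m ∧ f ≤ φ (x * ζ)} with hE
  have hφm : Measurable fun x => φ (x * ζ) := h.measurable.comp (by fun_prop)
  have hEm : MeasurableSet E :=
    measurableSet_Icc.inter (measurableSet_le measurable_const hφm)
  have h1 : ∫ x, φ (x * ζ) ∂μ ≤ f + μ.real E := by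
    calc ∫ x, φ (x * ζ) ∂μ ≤ ∫ x, (f + E.indicator (fun _ => 1) x) ∂μ := by
          refine integral_mono_ae (integrable_of_abs_le hφm 1 fun x => h.abs_le_one _)
            ((integrable_const _).add ((integrable_const _).indicator hEm)) ?_
          filter_upwards [hμm] with x hx
          by_cases hxE : x ∈ E
          · simp only [Set.indicator_of_mem hxE]
            linarith [h.le_one (x * ζ)]
          · simp only [Set.indicator_of_notMem hxE]
            by_contra! hcon
            exact hxE ⟨hx, by linarith⟩
      _ = μ.real Set.univ * f + μ.real E := by
          rw [integral_add (integrable_const _) ((integrable_const _).indicator hEm),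
            integral_const, smul_eq_mul, integral_indicator_const _ hEm, smul_eq_mul, mul_one]
      _ ≤ f + μ.real E := by
          gcongr
          exact mul_le_of_le_one_left hf.le (measureReal_univ_le_one hμ)
  set C := (Finset.Icc (-⌈m * |ζ| / g⌉) ⌈m * |ζ| / g⌉).filter
    fun b : ℤ => ∃ x ∈ E, ⌊x * ζ / g⌋ = b with hC
  have hbd : ∀ x ∈ E, |x * ζ / g| ≤ m * |ζ| / g := by
    rintro x ⟨hx, -⟩
    rw [abs_div, abs_mul, abs_of_pos hg, abs_of_pos ((inv_pos.2 hm0).trans_le hx.1)]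
    gcongr
    exact hx.2
  have hcard : (#C : ℝ) ≤ 24 * D * gaussAvg ν D / (f * g) := by
    have h2 := h.card_mul_le hL hL0 (s := C) (x := 0) (y := 0) (g := g) (D := m * |ζ| / g + 1)
      (D' := D) (ε := f / 2) hg hD0 (by positivity) (by linarith)
      (by
        have : g * (m * |ζ| / g + 1 + 1) = m * |ζ| + 2 * g := by field_simp; ring
        linarith)
      (by
        intro b hb
        obtain ⟨-, x, hx, rfl⟩ := Finset.mem_filter.1 hb
        have h3 := hbd x hx
        have h4 := Int.floor_le (x * ζ / g)
        have h5 := Int.lt_floor_add_one (x * ζ / g)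
        rw [abs_le] at h3
        refine ⟨by rw [sub_zero, abs_le]; constructor <;> linarith, ?_⟩
        have h6 := (abs_le.1 (h.abs_sub_le hL hL0 (x * ζ) (0 + g * ⌊x * ζ / g⌋))).2
        have h7 : |x * ζ - (0 + g * ⌊x * ζ / g⌋)| ≤ g := by
          have e : x * ζ = g * (x * ζ / g) := by field_simp
          rw [abs_le]
          constructor <;> nlinarith
        have h8 : L * |x * ζ - (0 + g * ⌊x * ζ / g⌋)| ≤ L * g := by gcongr
        linarith [hx.2])
    rw [le_div_iff₀ (by positivity)]
    linarith
  have hcover : E ⊆ ⋃ b ∈ C, {x ∈ E | ⌊x * ζ / g⌋ = b} := by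
    intro x hx
    simp only [Set.mem_iUnion]
    refine ⟨⌊x * ζ / g⌋, Finset.mem_filter.2 ⟨Finset.mem_Icc.2 ?_, x, hx, rfl⟩, hx, rfl⟩
    have h3 := abs_le.1 (hbd x hx)
    constructor
    · rw [Int.le_floor]
      push_cast
      linarith [Int.le_ceil (m * |ζ| / g)]
    · exact (Int.floor_le_ceil _).trans (Int.ceil_le_ceil h3.2)
  have hcell : ∀ b ∈ C, μ.real {x ∈ E | ⌊x * ζ / g⌋ = b} ≤ p := by
    intro b hb
    obtain ⟨-, x₁, hx₁, rfl⟩ := Finset.mem_filter.1 hb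
    refine (measureReal_mono ?_).trans (hp (Real.log x₁))
    rintro x ⟨hx, hxb⟩
    have h3 := (Int.abs_sub_lt_one_of_floor_eq_floor hxb).le
    rw [← sub_div, ← sub_mul, abs_div, abs_mul, abs_of_pos hg, div_le_one hg] at h3
    refine ⟨(inv_pos.2 hm0).trans_le hx.1.1, ?_⟩
    refine (abs_log_sub_log_le (inv_pos.2 hm0) hx.1.1 hx₁.1.1).trans ?_
    rw [div_inv_eq_mul, le_div_iff₀ hζ0]
    nlinarith
  have h2 : μ.real E ≤ 24 * D * gaussAvg ν D / (f * g) * p := by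
    calc μ.real E ≤ μ.real (⋃ b ∈ C, {x ∈ E | ⌊x * ζ / g⌋ = b}) :=
          measureReal_mono hcover (measure_ne_top _ _)
      _ ≤ ∑ b ∈ C, μ.real {x ∈ E | ⌊x * ζ / g⌋ = b} := measureReal_biUnion_finset_le _ _
      _ ≤ ∑ _b ∈ C, p := Finset.sum_le_sum hcell
      _ = #C * p := by rw [Finset.sum_const, nsmul_eq_mul]
      _ ≤ _ := by gcongr
  linarith

end Peeling

section Final
open ProbabilityTheory

/-- A measure of mass at most one on `[m⁻¹, m]` whose logarithm is non-concentrated, with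
exponent `γ`, at all scales in `[s, t]`. -/
structure LogSpread (μ : Measure ℝ) (m s t γ : ℝ) : Prop where
  mass_le : μ Set.univ ≤ 1
  supp : ∀ᵐ x ∂μ, x ∈ Set.Icc m⁻¹ m
  le_rpow : ∀ a σ, s ≤ σ → σ ≤ t → μ.real {x | 0 < x ∧ |Real.log x - a| ≤ σ} ≤ 2 * σ ^ γ

theorem eventually_le_rpow {e : ℝ} (he : 0 < e) (C : ℝ) :
    ∀ᶠ R : ℝ in Filter.atTop, C ≤ R ^ e :=
  (tendsto_rpow_atTop he).eventually_ge_atTop C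

theorem PosSpectrum.eventually_average_le {γ e : ℝ} (hγ : 0 < γ) (hγ1 : γ ≤ 1) (he : γ = 64 * e) :
    ∀ᶠ R : ℝ in Filter.atTop, ∀ (ν μ : Measure ℝ) (φ : ℝ → ℝ) (L m ζ t : ℝ), PosSpectrum ν φ →
      (∀ᵐ q ∂ν, |q| ≤ L) → 0 ≤ L → L ≤ R ^ e → 1 ≤ m → m ≤ R ^ e →
      R ^ (1 - e) ≤ |ζ| → |ζ| ≤ R ^ (1 + e) → R ^ (-1 : ℝ) ≤ t → LogSpread μ m (R ^ (-2 : ℝ)) t γ →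
      gaussAvg ν R ≤ R ^ (16 * e - 1) → ∫ x, φ (x * ζ) ∂μ ≤ R ^ (-e) := by
  have he0 : 0 < e := by linarith
  filter_upwards [eventually_le_rpow he0 49, Filter.eventually_ge_atTop 1] with R hX hR1
  intro ν μ φ L m ζ t h hL hL0 hLR hm hmR hζ1 hζ2 ht hμ hG
  have hR0 : 0 < R := by linarith
  have := h.isFiniteMeasure
  have hm0 : 0 < m := by linarith
  have add : ∀ a b : ℝ, R ^ a * R ^ b = R ^ (a + b) := fun a b => (Real.rpow_add hR0 a b).symm
  have mono : ∀ {a b : ℝ}, a ≤ b → R ^ a ≤ R ^ b := fun hab =>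
    Real.rpow_le_rpow_of_exponent_le hR1 hab
  have pos : ∀ a : ℝ, 0 < R ^ a := fun a => Real.rpow_pos_of_pos hR0 a
  have hζ0 : 0 < |ζ| := (pos _).trans_le hζ1
  have hζ : ζ ≠ 0 := abs_pos.1 hζ0
  have hRD : R ≤ R ^ (1 + 3 * e) := by
    simpa using mono (a := 1) (b := 1 + 3 * e) (by linarith)
  have hσ1 : R ^ (-2 : ℝ) ≤ m * R ^ (-4 * e) / |ζ| := by
    rw [le_div_iff₀ hζ0]
    calc R ^ (-2 : ℝ) * |ζ| ≤ R ^ (-2 : ℝ) * R ^ (1 + e) := by gcongr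
      _ = R ^ (-2 + (1 + e)) := add _ _
      _ ≤ R ^ (-4 * e) := mono (by linarith)
      _ ≤ m * R ^ (-4 * e) := le_mul_of_one_le_left (pos _).le hm
  have hσ2 : m * R ^ (-4 * e) / |ζ| ≤ R ^ (-1 : ℝ) := by
    rw [div_le_iff₀ hζ0]
    calc m * R ^ (-4 * e) ≤ R ^ e * R ^ (-4 * e) := by gcongr
      _ = R ^ (e + -4 * e) := add _ _
      _ ≤ R ^ (-1 + (1 - e)) := mono (by linarith)
      _ = R ^ (-1 : ℝ) * R ^ (1 - e) := (add _ _).symm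
      _ ≤ R ^ (-1 : ℝ) * |ζ| := by gcongr
  have hp : ∀ a, μ.real {x | 0 < x ∧ |Real.log x - a| ≤ m * R ^ (-4 * e) / |ζ|} ≤
      2 * R ^ (-64 * e) := fun a => by
    refine (hμ.le_rpow a _ hσ1 (hσ2.trans ht)).trans ?_
    gcongr
    calc (m * R ^ (-4 * e) / |ζ|) ^ γ ≤ (R ^ (-1 : ℝ)) ^ γ := by gcongr
      _ = R ^ (-64 * e) := by rw [← Real.rpow_mul hR0.le]; congr 1; linarith
  have hGD : gaussAvg ν (R ^ (1 + 3 * e)) ≤ R ^ (16 * e - 1) :=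
    (gaussAvg_anti hR0.le hRD).trans hG
  have hG0 := gaussAvg_nonneg (ν := ν) (R ^ (1 + 3 * e))
  refine (h.average_le hμ.mass_le hL hL0 hm hμ.supp hζ (pos (-2 * e)) (pos (-4 * e))
    (D := R ^ (1 + 3 * e)) ?_ ?_ hp).trans ?_
  · calc 4 * (L * R ^ (-4 * e)) ≤ R ^ e * (R ^ e * R ^ (-4 * e)) := by gcongr; linarith
      _ = R ^ (-2 * e) := by rw [add, add]; ring_nf
  · have h1 : m * |ζ| ≤ R ^ (1 + 2 * e) := by
      calc m * |ζ| ≤ R ^ e * R ^ (1 + e) := by gcongr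
        _ = _ := by rw [add]; ring_nf
    have h2 : R ^ (-4 * e) ≤ R ^ (1 + 2 * e) := mono (by linarith)
    calc m * |ζ| + 2 * R ^ (-4 * e) ≤ 49 * R ^ (1 + 2 * e) := by linarith [pos (1 + 2 * e)]
      _ ≤ R ^ e * R ^ (1 + 2 * e) := by gcongr
      _ = _ := by rw [add]; ring_nf
  · have h1 : 24 * R ^ (1 + 3 * e) * gaussAvg ν (R ^ (1 + 3 * e)) / (R ^ (-2 * e) * R ^ (-4 * e)) *
        (2 * R ^ (-64 * e)) ≤ 48 * R ^ (-2 * e) := by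
      calc _ ≤ 24 * R ^ (1 + 3 * e) * R ^ (16 * e - 1) / (R ^ (-2 * e) * R ^ (-4 * e)) *
            (2 * R ^ (-64 * e)) := by
            have := pos (1 + 3 * e); have := pos (-2 * e); have := pos (-4 * e)
            have := pos (-64 * e)
            gcongr
        _ = 48 * (R ^ (1 + 3 * e) * R ^ (16 * e - 1) / R ^ (-6 * e) * R ^ (-64 * e)) := by
            rw [add (-2 * e), show -2 * e + -4 * e = -6 * e by ring]; ring
        _ = 48 * R ^ (-39 * e) := by
            rw [add, ← Real.rpow_sub hR0, add]; ring_nf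
        _ ≤ _ := by gcongr 48 * ?_; exact mono (by linarith)
    calc _ ≤ R ^ (-2 * e) + 48 * R ^ (-2 * e) := by gcongr
      _ = 49 * R ^ (-2 * e) := by ring
      _ ≤ R ^ e * R ^ (-2 * e) := by gcongr
      _ = _ := by rw [add]; ring_nf

end Final

section Core
open ProbabilityTheory

theorem LogSpread.mono {μ : Measure ℝ} {m s t t' γ : ℝ} (h : LogSpread μ m s t γ) (ht : t' ≤ t) :
    LogSpread μ m s t' γ :=
  ⟨h.mass_le, h.supp, fun a σ h1 h2 => h.le_rpow a σ h1 (h2.trans ht)⟩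

theorem le_rpow_div_two_pow_succ {X R e : ℝ} {j : ℕ} (hR : 0 < R) (h : X ^ 2 ≤ R ^ (-e / 2 ^ j)) :
    X ≤ R ^ (-e / 2 ^ (j + 1)) := by
  refine (abs_le_of_sq_le_sq' ?_ (Real.rpow_pos_of_pos hR _).le).2
  rw [← Real.rpow_natCast (R ^ _), ← Real.rpow_mul hR.le]
  rwa [show -e / 2 ^ (j + 1) * (2 : ℕ) = -e / 2 ^ j by rw [pow_succ]; push_cast; field_simp]

theorem PosSpectrum.gaussAvg_le_one {ν : Measure ℝ} {φ : ℝ → ℝ} (h : PosSpectrum ν φ) (D : ℝ) :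
    gaussAvg ν D ≤ 1 := by
  rw [← h.integral_gaussian_eq]
  calc ∫ a, φ (D * a) ∂(gaussianReal 0 1) ≤ ∫ _, (1 : ℝ) ∂(gaussianReal 0 1) :=
        integral_mono (integrable_of_abs_le (h.measurable.comp (by fun_prop)) 1
          fun x => h.abs_le_one _) (integrable_const _) fun x => h.le_one _
    _ = 1 := by simp

/-- Averages of a positive definite function over products: each factor either improves the
Gaussian average by a power of `R`, or that average is already small enough to conclude. -/
theorem SpreadSpectrum.exists_integral_pi_le {γ e : ℝ} (hγ : 0 < γ) (hγ1 : γ ≤ 1)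
    (he : γ = 64 * e) : ∃ κ : ℝ, 0 < κ ∧ κ ≤ e ∧ ∃ ε : ℝ, 0 < ε ∧ ∀ J : ℕ, 1 ≤ κ * J →
      ∀ᶠ R : ℝ in Filter.atTop, ∀ (j i : ℕ), i + j = J → ∀ (μ : Fin (j + 1) → Measure ℝ)
        (ν : Measure ℝ) (φ : ℝ → ℝ) (L ρ p m η : ℝ), SpreadSpectrum ν φ L ρ p → 1 ≤ m →
        (2 * m) ^ j * L ≤ R ^ κ → m ^ (J + 1) ≤ R ^ κ → R ^ (-(16 * e / 8)) ≤ ρ / m ^ j →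
        p ≤ R ^ (-(16 * e * γ / 9)) → gaussAvg ν R ≤ R ^ (-κ * i) → |η| = R →
        (∀ i, LogSpread (μ i) m (R ^ (-2 : ℝ)) (R ^ (-ε)) γ) →
        ∫ x, φ (η * ∏ i, x i) ∂(Measure.pi μ) ≤ R ^ (-e / 2 ^ j) := by
  have he0 : 0 < e := by linarith
  obtain ⟨κ₀, hκ₀, ε₀, hε₀, hstep⟩ := PosSpectrum.exists_integral_sq_le hγ hγ1
    (c := 16 * e) (by linarith) (by linarith)
  refine ⟨min κ₀ e, lt_min hκ₀ he0, min_le_right _ _, min ε₀ 1, lt_min hε₀ one_pos, fun J hJ => ?_⟩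
  filter_upwards [hstep, PosSpectrum.eventually_average_le hγ hγ1 he,
    Filter.eventually_ge_atTop 1] with R hstep hfin hR1
  have hR0 : 0 < R := by linarith
  set κ := min κ₀ e
  have mono : ∀ {a b : ℝ}, a ≤ b → R ^ a ≤ R ^ b := fun hab =>
    Real.rpow_le_rpow_of_exponent_le hR1 hab
  have hκe : R ^ κ ≤ R ^ e := mono (min_le_right _ _)
  have hκκ : R ^ κ ≤ R ^ κ₀ := mono (min_le_left _ _)
  have hfinal : ∀ (j : ℕ), j ≤ J → ∀ (μ : Fin (j + 1) → Measure ℝ)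
        (ν : Measure ℝ) (φ : ℝ → ℝ) (L ρ p m η : ℝ), SpreadSpectrum ν φ L ρ p → 1 ≤ m →
        L ≤ R ^ κ → m ^ (J + 1) ≤ R ^ κ → gaussAvg ν R ≤ R ^ (16 * e - 1) → |η| = R →
        (∀ i, LogSpread (μ i) m (R ^ (-2 : ℝ)) (R ^ (-min ε₀ 1)) γ) →
        ∫ x, φ (η * ∏ i, x i) ∂(Measure.pi μ) ≤ R ^ (-e / 2 ^ j) := by
    intro j hj μ ν φ L ρ p m η h hm hL hmJ hG hη hμ
    have hm0 : 0 < m := by linarith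
    have hmj : m ^ j ≤ R ^ e :=
      (pow_le_pow_right₀ hm (by omega)).trans (hmJ.trans hκe)
    have hm1 : m ≤ R ^ e := (le_self_pow₀ hm (by omega)).trans (hmJ.trans hκe)
    refine le_trans (b := R ^ (-e)) ?_ (mono ?_)
    · refine h.integral_pi_le (fun i => (hμ i).mass_le) hm (Real.rpow_pos_of_pos hR0 _).le
        (fun i => (hμ i).supp) fun ζ hζ1 hζ2 => ?_
      rw [hη] at hζ1 hζ2
      refine hfin ν (μ 0) φ L m ζ _ h.toPosSpectrum h.supp h.supp_nonneg (hL.trans hκe) hm hm1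
        ?_ ?_ (mono (neg_le_neg (min_le_right _ _))) (hμ 0) hG
      · refine le_trans ?_ hζ1
        rw [Real.rpow_sub hR0, Real.rpow_one]
        gcongr
      · refine hζ2.trans ?_
        rw [Real.rpow_add hR0, Real.rpow_one]
        gcongr
    · rw [neg_div]
      exact neg_le_neg (div_le_self he0.le (one_le_pow₀ (by norm_num)))
  intro j
  induction j with
  | zero =>
    intro i hi μ ν φ L ρ p m η h hm hL hmJ hρ hp hG hη hμ
    refine hfinal 0 (by omega) μ ν φ L ρ p m η h hm (by simpa using hL) hmJ (hG.trans (mono ?_)) hη hμ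
    obtain rfl : i = J := by omega
    linarith
  | succ j ih =>
    intro i hi μ ν φ L ρ p m η h hm hL hmJ hρ hp hG hη hμ
    have hm0 : 0 < m := by linarith
    have hL1 : L ≤ R ^ κ := by
      refine le_trans (le_mul_of_one_le_left h.supp_nonneg (one_le_pow₀ ?_)) hL
      linarith
    rcases le_total (gaussAvg ν R) (R ^ (16 * e - 1)) with hG1 | hG1
    · exact hfinal (j + 1) (by omega) μ ν φ L ρ p m η h hm hL1 hmJ hG1 hη hμ
    have hpos : 0 < R ^ (-(16 * e / 8)) := Real.rpow_pos_of_pos hR0 _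
    have hρ0 : R ^ (-(16 * e / 8)) ≤ ρ := by
      rw [le_div_iff₀ (by positivity)] at hρ
      exact (le_mul_of_one_le_right hpos.le (one_le_pow₀ hm)).trans hρ
    have h' := h.mconv (hμ 0).mass_le hm (hpos.le.trans hρ0) (hμ 0).supp
    have hG' := hstep ν (μ 0) φ L m h.toPosSpectrum h.supp h.supp_nonneg (hL1.trans hκκ)
      (hμ 0).mass_le hm ((le_self_pow₀ hm (by omega)).trans (hmJ.trans hκκ)) (hμ 0).supp
      (fun a σ h1 h2 => (hμ 0).le_rpow a σ h1 (h2.trans (mono (neg_le_neg (min_le_left _ _)))))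
      ?_ hG1
    · refine le_rpow_div_two_pow_succ hR0
        ((h.sq_integral_pi_le (fun i => (hμ i).mass_le) η).trans ?_)
      refine ih (i + 1) (by omega) (fun i => μ i.succ) _ _ _ _ _ m η h' hm ?_ hmJ ?_ hp ?_ hη
        fun i => hμ i.succ
      · calc (2 * m) ^ j * (2 * m * L) = (2 * m) ^ (j + 1) * L := by ring
          _ ≤ _ := hL
      · rwa [div_div, ← pow_succ']
      · rw [← h'.integral_gaussian_eq]
        calc _ ≤ R ^ (-κ₀) * gaussAvg ν R := hG'
          _ ≤ R ^ (-κ) * R ^ (-κ * i) := by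
            have := gaussAvg_nonneg (ν := ν) R
            have := mono (neg_le_neg (min_le_left κ₀ e))
            gcongr
          _ = _ := by rw [← Real.rpow_add hR0]; push_cast; ring_nf
    · have hp1 := h.spread 0
      have := h.isFiniteMeasure
      refine ENNReal.toReal_le_of_le_ofReal (Real.rpow_pos_of_pos hR0 _).le ?_
      refine le_trans (measure_mono ?_) (hp1.trans (ENNReal.ofReal_le_ofReal hp))
      exact Set.Icc_subset_Icc (by linarith) (by linarith)

theorem LogSpread.measure_Icc_le {μ : Measure ℝ} {m s t γ ρ : ℝ} (h : LogSpread μ m s t γ)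
    (hm : 1 ≤ m) (h1 : s ≤ 2 * (m * ρ)) (h2 : 2 * (m * ρ) ≤ t) (a : ℝ) :
    μ (Set.Icc (a - ρ) (a + ρ)) ≤ ENNReal.ofReal (2 * (2 * (m * ρ)) ^ γ) := by
  have hm0 : 0 < m := by linarith
  have := isFiniteMeasure_of_univ_le_one h.mass_le
  by_cases hne : ∃ x₁ ∈ Set.Icc m⁻¹ m, x₁ ∈ Set.Icc (a - ρ) (a + ρ)
  · obtain ⟨x₁, hx₁, hxa⟩ := hne
    refine le_trans (measure_mono_ae ?_)
      ((ENNReal.le_ofReal_iff_toReal_le (measure_ne_top μ _) ?_).2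
        (h.le_rpow (Real.log x₁) _ h1 h2))
    · filter_upwards [h.supp] with x hx hxI
      refine ⟨(inv_pos.2 hm0).trans_le hx.1, ?_⟩
      refine (abs_log_sub_log_le (inv_pos.2 hm0) hx.1 hx₁.1).trans ?_
      rw [div_inv_eq_mul]
      have : |x - x₁| ≤ 2 * ρ := by
        rw [abs_le]
        constructor <;> linarith [hxI.1, hxI.2, hxa.1, hxa.2]
      nlinarith
    · exact measureReal_nonneg.trans (h.le_rpow 0 _ h1 h2)
  · refine le_of_eq_of_le (measure_eq_zero_iff_ae_notMem.2 ?_) zero_le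
    filter_upwards [h.supp] with x hx hxI
    exact hne ⟨x, hx, hxI⟩

/-- The estimate for measures supported on `[m⁻¹, m]` with `m` a small power of `|η|`. -/
theorem exists_norm_integral_exp_le {γ : ℝ} (hγ : 0 < γ) (hγ1 : γ ≤ 1) :
    ∃ k : ℕ, 1 ≤ k ∧ ∃ δ : ℝ, 0 < δ ∧ ∃ ε : ℝ, 0 < ε ∧ ∀ᶠ R : ℝ in Filter.atTop,
      ∀ (μ : Fin k → Measure ℝ) (m η : ℝ), 1 ≤ m → m ≤ R ^ δ → |η| = R →
        (∀ i, LogSpread (μ i) m (R ^ (-2 : ℝ)) (R ^ (-ε)) γ) →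
        ‖∫ x, Complex.exp (Complex.I * (η : ℂ) * ∏ i, (x i : ℂ)) ∂(Measure.pi μ)‖ ≤ R ^ (-ε) := by
  obtain ⟨e, he⟩ : ∃ e : ℝ, γ = 64 * e := ⟨γ / 64, by ring⟩
  have he0 : 0 < e := by linarith
  obtain ⟨κ, hκ, hκe, ε, hε, H⟩ := SpreadSpectrum.exists_integral_pi_le hγ hγ1 he
  obtain ⟨J, hJ⟩ := exists_nat_ge (1 / κ)
  rw [div_le_iff₀' hκ] at hJ
  set ε' := min ε (e / 2 ^ (J + 1))
  have hε'e : ε' ≤ e := (min_le_right _ _).trans (div_le_self he0.le (one_le_pow₀ (by norm_num)))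
  refine ⟨J + 2, by omega, κ / (18 * (J + 1)), by positivity, ε', lt_min hε (by positivity), ?_⟩
  filter_upwards [H J hJ, Filter.eventually_ge_atTop 1, eventually_le_rpow (e := κ / 2) (by linarith)
    (2 ^ (J + 1)), eventually_le_rpow (e := e / 2) (by linarith) 2,
    eventually_le_rpow (e := γ * e / 6) (by positivity) 4] with R H hR1 hRκ hRe hRγ
  intro μ m η hm hmR hη hμ
  have hR0 : 0 < R := by linarith
  have hm0 : 0 < m := by linarith
  have add : ∀ a b : ℝ, R ^ a * R ^ b = R ^ (a + b) := fun a b => (Real.rpow_add hR0 a b).symm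
  have mono : ∀ {a b : ℝ}, a ≤ b → R ^ a ≤ R ^ b := fun hab =>
    Real.rpow_le_rpow_of_exponent_le hR1 hab
  have pos : ∀ a : ℝ, 0 < R ^ a := fun a => Real.rpow_pos_of_pos hR0 a
  have hmJ : m ^ (J + 1) ≤ R ^ (κ / 18) := by
    calc m ^ (J + 1) ≤ (R ^ (κ / (18 * (J + 1)))) ^ (J + 1) := by gcongr
      _ = R ^ (κ / 18) := by
        rw [← Real.rpow_natCast (R ^ _), ← Real.rpow_mul hR0.le]
        congr 1
        push_cast
        field_simp
  set ρ := m ^ J * R ^ (-(16 * e / 8)) with hρdef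
  have hσ : 2 * (m * ρ) ≤ 2 * R ^ (e / 18 - 2 * e) := by
    have : m * ρ = m ^ (J + 1) * R ^ (-(16 * e / 8)) := by rw [hρdef]; ring
    rw [this]
    gcongr
    calc m ^ (J + 1) * R ^ (-(16 * e / 8)) ≤ R ^ (e / 18) * R ^ (-(16 * e / 8)) := by
          gcongr
          exact hmJ.trans (mono (by linarith))
      _ = _ := by rw [add]; ring_nf
  have hσ1 : R ^ (-2 : ℝ) ≤ 2 * (m * ρ) := by
    have h1 : R ^ (-2 : ℝ) ≤ R ^ (-(16 * e / 8)) := mono (by linarith)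
    have h2 : R ^ (-(16 * e / 8)) ≤ ρ := le_mul_of_one_le_left (pos _).le (one_le_pow₀ hm)
    nlinarith [pos (-2)]
  have hσ2 : 2 * (m * ρ) ≤ R ^ (-ε') := by
    refine hσ.trans ?_
    calc 2 * R ^ (e / 18 - 2 * e) ≤ R ^ (e / 2) * R ^ (e / 18 - 2 * e) := by gcongr
      _ = R ^ (e / 2 + (e / 18 - 2 * e)) := add _ _
      _ ≤ _ := mono (by linarith)
  have hp : 2 * (2 * (m * ρ)) ^ γ ≤ R ^ (-(16 * e * γ / 9)) := by
    calc 2 * (2 * (m * ρ)) ^ γ ≤ 2 * (2 * R ^ (e / 18 - 2 * e)) ^ γ := by gcongr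
      _ = 2 * (2 ^ γ * R ^ ((e / 18 - 2 * e) * γ)) := by
        rw [Real.mul_rpow (by norm_num) (pos _).le, ← Real.rpow_mul hR0.le]
      _ ≤ 2 * (2 * R ^ ((e / 18 - 2 * e) * γ)) := by
        gcongr
        simpa using Real.rpow_le_rpow_of_exponent_le (x := 2) (by norm_num) hγ1
      _ = 4 * R ^ ((e / 18 - 2 * e) * γ) := by ring
      _ ≤ R ^ (γ * e / 6) * R ^ ((e / 18 - 2 * e) * γ) := by gcongr
      _ = _ := by rw [add]; ring_nf
  have hspec := spreadSpectrum_conv_neg (hμ 0).mass_le hm0.le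
    (by
      filter_upwards [(hμ 0).supp] with x hx
      rw [abs_of_pos ((inv_pos.2 hm0).trans_le hx.1)]
      exact hx.2)
    ((hμ 0).measure_Icc_le hm hσ1 hσ2)
  have hmain := H J 0 (by omega) (fun i => μ i.succ) _ _ _ _ _ m η hspec hm
    (by
      calc (2 * m) ^ J * (2 * m) = 2 ^ (J + 1) * m ^ (J + 1) := by ring
        _ ≤ R ^ (κ / 2) * R ^ (κ / 18) := by gcongr
        _ = R ^ (κ / 2 + κ / 18) := add _ _
        _ ≤ R ^ κ := mono (by linarith))
    (hmJ.trans (mono (by linarith)))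
    (by rw [hρdef, mul_div_cancel_left₀ _ (by positivity)])
    hp (by simpa using hspec.gaussAvg_le_one R) hη
    fun i => (hμ i.succ).mono (mono (neg_le_neg (min_le_left _ _)))
  refine (le_rpow_div_two_pow_succ hR0
    ((sq_norm_integral_exp_le (fun i => (hμ i).mass_le) η).trans hmain)).trans (mono ?_)
  rw [neg_div]
  exact neg_le_neg (min_le_right _ _)

end Core

section Truncation
open ProbabilityTheory

theorem lintegral_pi_prod {k : ℕ} {μ : Fin k → Measure ℝ} [∀ j, IsProbabilityMeasure (μ j)]
    {f : ℝ → ℝ≥0∞} (hf : Measurable f) :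
    ∫⁻ x, ∏ j, f (x j) ∂(Measure.pi μ) = ∏ j, ∫⁻ x, f x ∂(μ j) := by
  rw [lintegral_prod_eq_prod_lintegral_of_indepFun Finset.univ
    (fun j (x : Fin k → ℝ) => f (x j)) (iIndepFun_pi fun _ => hf.aemeasurable)
    fun j => hf.comp (measurable_pi_apply j)]
  exact Finset.prod_congr rfl fun j _ => (measurePreserving_eval μ j).lintegral_comp hf

theorem lt_abs_log_of_notMem_Icc {x r : ℝ} (hx : 0 < x)
    (h : x ∉ Set.Icc (Real.exp r)⁻¹ (Real.exp r)) : r < |Real.log x| := by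
  by_contra! hr
  rw [abs_le] at hr
  refine h ⟨?_, ?_⟩
  · rw [← Real.exp_neg]
    exact (Real.le_log_iff_exp_le hx).1 hr.1
  · exact (Real.log_le_iff_le_exp hx).1 hr.2

/-- Markov's inequality for the exponential moments. -/
theorem pi_compl_box_le {k : ℕ} {μ : Fin k → Measure ℝ} [∀ j, IsProbabilityMeasure (μ j)]
    (hμ : ∀ j, μ j (Set.Ioi 0)ᶜ = 0) {r s : ℝ} (hs : 0 ≤ s) :
    Measure.pi μ (Set.univ.pi fun _ => Set.Icc (Real.exp r)⁻¹ (Real.exp r))ᶜ ≤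
      ENNReal.ofReal (Real.exp (-(s * r))) *
        ∏ j, ∫⁻ x, ENNReal.ofReal (Real.exp (s * |Real.log x|)) ∂(μ j) := by
  set B := Set.Icc (Real.exp r)⁻¹ (Real.exp r)
  have hS : MeasurableSet (Set.univ.pi fun _ : Fin k => B) :=
    MeasurableSet.univ_pi fun _ => measurableSet_Icc
  have hfm : Measurable fun x => ENNReal.ofReal (Real.exp (s * |Real.log x|)) := by fun_prop
  have hae : ∀ᵐ x ∂(Measure.pi μ), ∀ j, x j ∈ Set.Ioi (0 : ℝ) :=
    Filter.eventually_all.2 fun j =>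
      Measure.tendsto_eval_ae_ae.eventually (mem_ae_iff.2 (hμ j))
  rw [← lintegral_pi_prod hfm, ← lintegral_const_mul _ (by fun_prop), ← lintegral_indicator_one hS.compl]
  refine lintegral_mono_ae ?_
  filter_upwards [hae] with x hx
  by_cases hxS : x ∈ (Set.univ.pi fun _ : Fin k => B)ᶜ
  · rw [Set.indicator_of_mem hxS, Pi.one_apply]
    simp only [Set.mem_compl_iff, Set.mem_univ_pi, not_forall] at hxS
    obtain ⟨j, hj⟩ := hxS
    have hlog := lt_abs_log_of_notMem_Icc (hx j) hj
    calc (1 : ℝ≥0∞) = ENNReal.ofReal (Real.exp (-(s * r))) * ENNReal.ofReal (Real.exp (s * r)) := by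
          rw [← ENNReal.ofReal_mul (Real.exp_pos _).le, ← Real.exp_add]
          simp
      _ ≤ ENNReal.ofReal (Real.exp (-(s * r))) *
          ENNReal.ofReal (Real.exp (s * |Real.log (x j)|)) := by gcongr
      _ ≤ _ := by
        gcongr
        refine Finset.single_le_prod' (f := fun j => ENNReal.ofReal (Real.exp (s * |Real.log (x j)|)))
          (fun i _ => ?_) (Finset.mem_univ j)
        rw [ENNReal.one_le_ofReal]
        exact Real.one_le_exp (by positivity)
  · rw [Set.indicator_of_notMem hxS]
    exact zero_le

theorem LogSpread.restrict {μ : Measure ℝ} [IsProbabilityMeasure μ] {m s t γ γ' : ℝ}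
    (hs : 0 < s) (ht : t ≤ 1) (hγ : γ ≤ γ')
    (h : ∀ a σ : ℝ, s ≤ σ → σ ≤ t →
      μ {x : ℝ | 0 < x ∧ |Real.log x - a| ≤ σ} ≤ ENNReal.ofReal (2 * σ ^ γ')) :
    LogSpread (μ.restrict (Set.Icc m⁻¹ m)) m s t γ := by
  refine ⟨?_, ae_restrict_mem measurableSet_Icc, fun a σ h1 h2 => ?_⟩
  · rw [Measure.restrict_apply_univ]
    exact prob_le_one
  · have hσ : 0 < σ := hs.trans_le h1
    refine ENNReal.toReal_le_of_le_ofReal (by positivity)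
      ((Measure.restrict_apply_le _ _).trans ((h a σ h1 h2).trans (ENNReal.ofReal_le_ofReal ?_)))
    gcongr 2 * ?_
    exact Real.rpow_le_rpow_of_exponent_ge hσ (h2.trans ht) hγ

theorem norm_integral_le_add_compl {α : Type*} [MeasurableSpace α] {μ : Measure α}
    [IsFiniteMeasure μ] {f : α → ℂ} (hf : Measurable f) (h1 : ∀ x, ‖f x‖ ≤ 1) {S : Set α}
    (hS : MeasurableSet S) : ‖∫ x, f x ∂μ‖ ≤ ‖∫ x in S, f x ∂μ‖ + μ.real Sᶜ := by
  have hint : Integrable f μ := Integrable.of_bound hf.aestronglyMeasurable 1 (by simp [h1])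
  rw [← integral_add_compl hS hint]
  refine (norm_add_le _ _).trans (add_le_add_right ?_ _)
  simpa using norm_setIntegral_le_of_norm_le_const (measure_lt_top μ Sᶜ) fun x _ => h1 x

end Truncation

/-- **Sum-product estimate for oscillatory integrals of measures on `(0,∞)`.**

Let `γ₃ > 0`. There exist `ε₁ ∈ (0,1)`, an integer `k ≥ 1` and a constant `c > 0`
(depending only on `γ₃`) such that: for every `η` with `|η| ≥ 1` and Borel probability
measures `μ₁, …, μ_k` on `(0,∞)` whose logarithms are non-concentrated at all scales
`σ ∈ [|η|^{-2}, |η|^{-ε₁}]` (i.e. `μ_j {x > 0 : |log x − a| ≤ σ} ≤ 2σ^{γ₃}`), one has,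
for all `t ∈ (0, ε₁)`,
`|∫ e^{iη x₁⋯x_k} dμ₁⋯dμ_k| ≤ c|η|^{-ε₁} + |η|^{-t³/(2√k)} ∏ⱼ Mⱼ(t²)`,
where `Mⱼ(s) = ∫ e^{s|log x|} dμⱼ`. -/
theorem sum_product_measures (γ₃ : ℝ) (hγ₃ : 0 < γ₃) :
    ∃ ε₁ ∈ Set.Ioo (0:ℝ) 1, ∃ k : ℕ, 1 ≤ k ∧ ∃ c : ℝ, 0 < c ∧
      ∀ η : ℝ, 1 ≤ |η| →
      ∀ μ : Fin k → Measure ℝ,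
        (∀ j, IsProbabilityMeasure (μ j)) →
        (∀ j, μ j (Set.Ioi (0:ℝ))ᶜ = 0) →
        (∀ j : Fin k, ∀ a σ : ℝ, |η| ^ (-2 : ℝ) ≤ σ → σ ≤ |η| ^ (-ε₁) →
          μ j {x : ℝ | 0 < x ∧ |Real.log x - a| ≤ σ} ≤ ENNReal.ofReal (2 * σ ^ γ₃)) →
      ∀ t : ℝ, 0 < t → t < ε₁ →
        ENNReal.ofReal
            ‖∫ x : Fin k → ℝ,
                Complex.exp (Complex.I * (η : ℂ) * ∏ j, (x j : ℂ)) ∂(Measure.pi μ)‖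
          ≤ ENNReal.ofReal (c * |η| ^ (-ε₁)) +
            ENNReal.ofReal (|η| ^ (-(t ^ 3) / (2 * Real.sqrt k))) *
              ∏ j, ∫⁻ x : ℝ, ENNReal.ofReal (Real.exp (t ^ 2 * |Real.log x|)) ∂(μ j) := by
  obtain ⟨k, hk, δ, hδ, ε, hε, H⟩ := exists_norm_integral_exp_le (γ := min γ₃ 1)
    (lt_min hγ₃ one_pos) (min_le_right _ _)
  obtain ⟨R₀, H⟩ := (H.and (Filter.eventually_ge_atTop 1)).exists_forall_of_atTop
  have hR₀ : 1 ≤ R₀ := (H R₀ le_rfl).2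
  set ε₁ := min (min δ ε) (1 / 2) with hε₁
  have hε₁0 : 0 < ε₁ := by positivity
  refine ⟨ε₁, ⟨hε₁0, (min_le_right _ _).trans_lt (by norm_num)⟩, k, hk, R₀ ^ ε₁, by positivity,
    fun η hη μ hμp hμ0 hμ t ht0 ht => ?_⟩
  have hη0 : 0 < |η| := by linarith
  have hfm : Measurable fun x : Fin k → ℝ =>
      Complex.exp (Complex.I * (η : ℂ) * ∏ j, (x j : ℂ)) := by
    fun_prop
  have hf1 : ∀ x : Fin k → ℝ, ‖Complex.exp (Complex.I * (η : ℂ) * ∏ j, (x j : ℂ))‖ ≤ 1 := by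
    intro x
    have : Complex.I * (η : ℂ) * ∏ j, (x j : ℂ) = ((η * ∏ j, x j : ℝ) : ℂ) * Complex.I := by
      push_cast; ring
    rw [this, Complex.norm_exp_ofReal_mul_I]
  rcases lt_or_ge |η| R₀ with hlt | hge
  · refine le_add_right (ENNReal.ofReal_le_ofReal ?_)
    refine (norm_integral_le_of_norm_le_const (Filter.Eventually.of_forall hf1)).trans ?_
    rw [probReal_univ, one_mul, Real.rpow_neg hη0.le, ← div_eq_mul_inv,
      one_le_div (by positivity)]
    gcongr
  · set r := t / (2 * Real.sqrt k) * Real.log |η| with hr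
    have hk1 : 1 ≤ Real.sqrt k := Real.one_le_sqrt.2 (by exact_mod_cast hk)
    have hlog : 0 ≤ Real.log |η| := Real.log_nonneg hη
    set S : Set (Fin k → ℝ) := Set.univ.pi fun _ => Set.Icc (Real.exp r)⁻¹ (Real.exp r)
    have hS : MeasurableSet S := MeasurableSet.univ_pi fun _ => measurableSet_Icc
    have hbox : ‖∫ x in S, Complex.exp (Complex.I * (η : ℂ) * ∏ j, (x j : ℂ)) ∂(Measure.pi μ)‖ ≤
        |η| ^ (-ε) := by
      rw [Measure.restrict_pi_pi]
      refine (H |η| hge).1 _ (Real.exp r) η (Real.one_le_exp (by positivity)) ?_ rfl fun j => ?_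
      · rw [Real.rpow_def_of_pos hη0, Real.exp_le_exp, hr, mul_comm]
        gcongr
        calc t / (2 * Real.sqrt k) ≤ t := div_le_self ht0.le (by linarith)
          _ ≤ δ := ht.le.trans ((min_le_left _ _).trans (min_le_left _ _))
      · refine LogSpread.restrict (Real.rpow_pos_of_pos hη0 _)
          (Real.rpow_le_one_of_one_le_of_nonpos hη (by linarith)) (min_le_left _ _)
          fun a σ h1 h2 => hμ j a σ h1 (h2.trans ?_)
        exact Real.rpow_le_rpow_of_exponent_le hη
          (neg_le_neg ((min_le_left _ _).trans (min_le_right _ _)))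
    have hc : |η| ^ (-ε) ≤ R₀ ^ ε₁ * |η| ^ (-ε₁) :=
      (Real.rpow_le_rpow_of_exponent_le hη
        (neg_le_neg ((min_le_left _ _).trans (min_le_right _ _)))).trans
        (le_mul_of_one_le_left (by positivity) (Real.one_le_rpow hR₀ hε₁0.le))
    have hexp : |η| ^ (-(t ^ 3) / (2 * Real.sqrt k)) = Real.exp (-(t ^ 2 * r)) := by
      rw [Real.rpow_def_of_pos hη0, hr]
      congr 1
      ring
    rw [hexp]
    calc _ ≤ ENNReal.ofReal (R₀ ^ ε₁ * |η| ^ (-ε₁) + (Measure.pi μ).real Sᶜ) :=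
          ENNReal.ofReal_le_ofReal ((norm_integral_le_add_compl hfm hf1 hS).trans
            (by gcongr; exact hbox.trans hc))
      _ = ENNReal.ofReal (R₀ ^ ε₁ * |η| ^ (-ε₁)) + Measure.pi μ Sᶜ := by
          rw [ENNReal.ofReal_add (by positivity) measureReal_nonneg, ofReal_measureReal]
      _ ≤ _ := by
          gcongr
          exact pi_compl_box_le hμ0 (sq_nonneg t)
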